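/- arXiv:0804.2910 — 2 statements merged into one kernel-verified Lean document; each statement's English description precedes it below -/
import Mathlib

section
/- Let d ≥ 1 and let P ⊂ ℝ^d be a lattice d-polytope whose topological interior contains exactly k lattice points (k ≥ 0). Then Vol(P) ≥ (dk + 1)/d!. -/
open MeasureTheory Set
open scoped ENNReal

noncomputable section

/-- A point of `ℝ^d` is a lattice point if all its coordinates are integers. -/
def IsLatticePt (d : ℕ) (x : Fin d → ℝ) : Prop := ∀ i, ∃ z : ℤ, x i = (z : ℝ)

/-- A lattice `d`-simplex: the convex hull of `d+1` affinely independent points of `ℤ^d`. -/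
def IsLatticeSimplex (d : ℕ) (T : Set (Fin d → ℝ)) : Prop :=
  ∃ v : Fin (d + 1) → Fin d → ℤ,
    AffineIndependent ℝ (fun i => fun j => ((v i j : ℤ) : ℝ)) ∧
    T = convexHull ℝ (Set.range (fun i => fun j => ((v i j : ℤ) : ℝ)))

/-- A lattice `d`-polytope: convex hull of a finite set of lattice points affinely
spanning `ℝ^d`. -/
def IsLatticePolytope (d : ℕ) (P : Set (Fin d → ℝ)) : Prop :=
  ∃ F : Finset (Fin d → ℤ),
    affineSpan ℝ ((fun v : Fin d → ℤ => fun j : Fin d => (v j : ℝ)) '' ↑F) = ⊤ ∧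
    P = convexHull ℝ ((fun v : Fin d → ℤ => fun j : Fin d => (v j : ℝ)) '' ↑F)

/-- Clean: the only lattice points on the boundary are the vertices (extreme points). -/
def IsClean (d : ℕ) (P : Set (Fin d → ℝ)) : Prop :=
  frontier P ∩ {x | IsLatticePt d x} = Set.extremePoints ℝ P

/-- Unimodular equivalence of subsets of `ℝ^d`. -/
def UnimodEquiv (d : ℕ) (P Q : Set (Fin d → ℝ)) : Prop :=
  ∃ (M : Matrix (Fin d) (Fin d) ℤ) (u : Fin d → ℤ),
    (M.det = 1 ∨ M.det = -1) ∧
    (fun x => (M.map (fun z : ℤ => (z : ℝ))).mulVec x + (fun i => (u i : ℝ))) '' P = Q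

/-- `S_d(k) = conv(e_1, …, e_d, -k(e_1 + ⋯ + e_d))`. -/
def Sdk (d k : ℕ) : Set (Fin d → ℝ) :=
  convexHull ℝ
    ((Set.range fun i : Fin d => (Pi.single i 1 : Fin d → ℝ)) ∪ {fun _ => -(k : ℝ)})

/-- `T_{a_1,…,a_d}`: vertex set `{0, e_1, …, e_{d-1}, (a_1,…,a_d)}`. -/
def Ta (d : ℕ) (a : Fin d → ℤ) : Set (Fin d → ℝ) :=
  convexHull ℝ
    ({(0 : Fin d → ℝ)} ∪
      {x | ∃ i : Fin d, i.val < d - 1 ∧ x = (Pi.single i 1 : Fin d → ℝ)} ∪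
      {fun i => (a i : ℝ)})


open scoped Matrix

/-- greedy choice of functionals -/
theorem mvb_greedy {V ι κ : Type*} [AddCommGroup V] [Module ℝ V] [FiniteDimensional ℝ V]
    [DecidableEq ι] [Nonempty κ]
    (φ : ι → κ → Module.Dual ℝ V) (J : ι → Finset κ) (N : ℕ) (I : Finset ι)
    (hlin : ∀ i ∈ I, LinearIndepOn ℝ (φ i) (J i : Set κ))
    (hN : ∀ i ∈ I, N ≤ (J i).card) (hI : I.card ≤ N) :
    ∃ m : ι → κ, (∀ i ∈ I, m i ∈ J i) ∧ ∃ y : V, ∀ i ∈ I, φ i (m i) y < 0 := by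
  classical
  induction I using Finset.induction_on with
  | empty =>
    exact ⟨fun _ => Classical.arbitrary κ, by simp, 0, by simp⟩
  | insert a I ha ih =>
    rw [Finset.card_insert_of_notMem ha] at hI
    obtain ⟨m, hm, y, hy⟩ := ih (fun i hi => hlin i (Finset.mem_insert_of_mem hi))
      (fun i hi => hN i (Finset.mem_insert_of_mem hi)) (by omega)
    let L : I → Module.Dual ℝ V := fun i => φ i (m i)
    have hex : ∃ k ∈ J a, φ a k ∉ Submodule.span ℝ (Set.range L) := by
      by_contra hcon
      push Not at hcon
      have h1 : Submodule.span ℝ (φ a '' (J a : Set κ)) ≤ Submodule.span ℝ (Set.range L) := by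
        rw [Submodule.span_le]
        rintro _ ⟨k, hk, rfl⟩
        exact hcon k hk
      have h2 := Submodule.finrank_mono h1
      have h3 : Module.finrank ℝ (Submodule.span ℝ (φ a '' (J a : Set κ))) = (J a).card := by
        have := finrank_span_eq_card (hlin a (Finset.mem_insert_self _ _))
        rw [← Set.image_eq_range] at this
        simpa using this
      have h4 : Module.finrank ℝ (Submodule.span ℝ (Set.range L)) ≤ I.card := by
        have := finrank_range_le_card (R := ℝ) L
        rw [Fintype.card_coe] at this
        exact this
      have := hN a (Finset.mem_insert_self _ _)
      omega
    obtain ⟨k, hk, hkn⟩ := hex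
    have hz : ∃ z : V, (∀ i ∈ I, φ i (m i) z = 0) ∧ φ a k z ≠ 0 := by
      by_contra hcon
      push Not at hcon
      apply hkn
      apply mem_span_of_iInf_ker_le_ker
      intro z hz
      rw [Submodule.mem_iInf] at hz
      exact hcon z (fun i hi => hz ⟨i, hi⟩)
    obtain ⟨z, hz0, hz1⟩ := hz
    refine ⟨Function.update m a k, ?_, y + ((-1 - φ a k y) / φ a k z) • z, ?_⟩
    · intro i hi
      rcases Finset.mem_insert.1 hi with rfl | hi'
      · simpa using hk
      · rw [Function.update_of_ne (by rintro rfl; exact ha hi')]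
        exact hm i hi'
    · intro i hi
      rcases Finset.mem_insert.1 hi with rfl | hi'
      · simp only [Function.update_self, map_add, map_smul, smul_eq_mul]
        rw [div_mul_cancel₀ _ hz1]; linarith
      · rw [Function.update_of_ne (by rintro rfl; exact ha hi')]
        simp [hz0 i hi', hy i hi']

/-- real version of an integer matrix -/
def mvbR {n : ℕ} (A : Matrix (Fin n) (Fin n) ℤ) : Matrix (Fin n) (Fin n) ℝ :=
  A.map (fun z : ℤ => (z : ℝ))

theorem mvbR_det {n : ℕ} (A : Matrix (Fin n) (Fin n) ℤ) : (mvbR A).det = (A.det : ℝ) := by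
  have := (Int.castRingHom ℝ).map_det A
  simpa [mvbR, RingHom.mapMatrix_apply] using this.symm

theorem mvbR_unit {n : ℕ} {A : Matrix (Fin n) (Fin n) ℤ} (h : A.det ≠ 0) :
    IsUnit (mvbR A).det := by
  rw [mvbR_det]; exact (Int.cast_ne_zero.2 h).isUnit

/-- coordinates with respect to the rows -/
def mvbC {n : ℕ} (A : Matrix (Fin n) (Fin n) ℤ) (y : Fin n → ℝ) : Fin n → ℝ :=
  y ᵥ* (mvbR A)⁻¹

theorem mvbC_spec {n : ℕ} {A : Matrix (Fin n) (Fin n) ℤ} (h : A.det ≠ 0) (y : Fin n → ℝ) :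
    mvbC A y ᵥ* mvbR A = y := by
  simp [mvbC, Matrix.vecMul_vecMul, Matrix.nonsing_inv_mul _ (mvbR_unit h)]

theorem mvbC_uniq {n : ℕ} {A : Matrix (Fin n) (Fin n) ℤ} (h : A.det ≠ 0) (c : Fin n → ℝ) :
    mvbC A (c ᵥ* mvbR A) = c := by
  simp [mvbC, Matrix.vecMul_vecMul, Matrix.mul_nonsing_inv _ (mvbR_unit h)]

theorem mvbC_add {n : ℕ} (A : Matrix (Fin n) (Fin n) ℤ) (x y : Fin n → ℝ) :
    mvbC A (x + y) = mvbC A x + mvbC A y := Matrix.add_vecMul _ _ _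

theorem mvbC_smul {n : ℕ} (A : Matrix (Fin n) (Fin n) ℤ) (t : ℝ) (y : Fin n → ℝ) :
    mvbC A (t • y) = t • mvbC A y := Matrix.smul_vecMul _ _ _

theorem mvbC_cont {n : ℕ} (A : Matrix (Fin n) (Fin n) ℤ) (m : Fin n) :
    Continuous (fun y => mvbC A y m) := by
  unfold mvbC Matrix.vecMul dotProduct
  fun_prop

def mvbF {n : ℕ} (A : Matrix (Fin n) (Fin n) ℤ) (m : Fin n) : Module.Dual ℝ (Fin n → ℝ) where
  toFun y := mvbC A y m
  map_add' x y := by rw [mvbC_add]; rfl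
  map_smul' t y := by rw [mvbC_smul]; rfl

theorem mvbF_indep {n : ℕ} {A : Matrix (Fin n) (Fin n) ℤ} (h : A.det ≠ 0) :
    LinearIndependent ℝ (mvbF A) := by
  rw [Fintype.linearIndependent_iff]
  intro g hg i
  have := congrArg (fun f => f ((Pi.single i 1 : Fin n → ℝ) ᵥ* mvbR A)) hg
  simp only [LinearMap.sum_apply, LinearMap.smul_apply, mvbF, LinearMap.coe_mk, AddHom.coe_mk,
    mvbC_uniq h, LinearMap.zero_apply, smul_eq_mul] at this
  simpa [Pi.single_apply] using this

/-- homogenization -/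
def mvbH {d : ℕ} (x : Fin d → ℝ) : Fin (d + 1) → ℝ := Fin.cons 1 x

def mvbHZ {d : ℕ} (x : Fin d → ℤ) : Fin (d + 1) → ℤ := Fin.cons 1 x

theorem mvbHZ_cast {d : ℕ} (x : Fin d → ℤ) :
    (fun i => ((mvbHZ x i : ℤ) : ℝ)) = mvbH (fun i => (x i : ℝ)) := by
  funext i
  refine Fin.cases ?_ (fun i => ?_) i <;> simp [mvbHZ, mvbH]

theorem mvbC_sum {d : ℕ} {A : Matrix (Fin (d+1)) (Fin (d+1)) ℤ} (h : A.det ≠ 0)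
    (h1 : ∀ m, A m 0 = 1) (y : Fin (d+1) → ℝ) : ∑ m, mvbC A y m = y 0 := by
  conv_rhs => rw [← mvbC_spec h y]
  simp [Matrix.vecMul, dotProduct, mvbR, h1]

theorem mvb_det_update {n : ℕ} {A : Matrix (Fin n) (Fin n) ℤ} (h : A.det ≠ 0)
    (p : Fin n → ℤ) (m : Fin n) :
    ((A.updateRow m p).det : ℝ) = mvbC A (fun i => (p i : ℝ)) m * (A.det : ℝ) := by
  rw [← mvbR_det, ← mvbR_det]
  have : mvbR (A.updateRow m p) = (mvbR A).updateRow m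
      (∑ k, mvbC A (fun i => (p i : ℝ)) k • mvbR A k) := by
    have h2 : (∑ k, mvbC A (fun i => (p i : ℝ)) k • mvbR A k) = fun i => (p i : ℝ) := by
      conv_rhs => rw [← mvbC_spec h (fun i => (p i : ℝ))]
      rw [Matrix.vecMul_eq_sum]
    rw [h2]
    ext i j
    by_cases hi : i = m
    · subst hi; simp [mvbR]
    · simp [mvbR, Matrix.updateRow_ne hi]
  rw [this, Matrix.det_updateRow_sum, smul_eq_mul]

/-- covering of the subdivided simplex -/
theorem mvb_split_cover {n : ℕ} {A : Matrix (Fin n) (Fin n) ℤ} (h : A.det ≠ 0)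
    (p : Fin n → ℤ) (hp : ∀ m, 0 ≤ mvbC A (fun i => (p i : ℝ)) m)
    (hp' : ∃ m, 0 < mvbC A (fun i => (p i : ℝ)) m)
    (y : Fin n → ℝ) (hy : ∀ m, 0 ≤ mvbC A y m) :
    ∃ m, 0 < mvbC A (fun i => (p i : ℝ)) m ∧ ∀ k, 0 ≤ mvbC (A.updateRow m p) y k := by
  classical
  set c := mvbC A (fun i => (p i : ℝ)) with hc
  set b := mvbC A y with hb
  obtain ⟨m0, hm0⟩ := hp'
  obtain ⟨m, hm, hmin⟩ := Finset.exists_min_image (Finset.univ.filter fun m => 0 < c m)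
    (fun m => b m / c m) ⟨m0, by simpa using hm0⟩
  simp only [Finset.mem_filter, Finset.mem_univ, true_and] at hm hmin
  refine ⟨m, hm, ?_⟩
  have hdet : (A.updateRow m p).det ≠ 0 := by
    have := mvb_det_update h p m
    intro h0
    rw [h0] at this
    have h3 : (A.det : ℝ) ≠ 0 := Int.cast_ne_zero.2 h
    have : c m * (A.det : ℝ) ≠ 0 := mul_ne_zero hm.ne' h3
    simp_all
  set t := b m / c m with ht
  have ht0 : 0 ≤ t := div_nonneg (hy m) hm.le
  let e : Fin n → ℝ := Function.update (fun k => b k - t * c k) m t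
  have key : e ᵥ* mvbR (A.updateRow m p) = y := by
    have e1 : e = (b - t • c) + t • (Pi.single m 1 : Fin n → ℝ) := by
      funext k
      by_cases hk : k = m
      · subst hk
        have : b k - t * c k = 0 := by rw [ht, div_mul_cancel₀ _ hm.ne', sub_self]
        simp [e, this]
      · simp [e, hk]
    have e2 : (b - t • c) ᵥ* mvbR (A.updateRow m p) = (b - t • c) ᵥ* mvbR A := by
      funext j
      simp only [Matrix.vecMul, dotProduct]
      apply Finset.sum_congr rfl
      intro k _
      by_cases hk : k = m
      · subst hk
        have : b k - t * c k = 0 := by rw [ht, div_mul_cancel₀ _ hm.ne', sub_self]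
        simp [this]
      · simp [mvbR, Matrix.updateRow_ne hk]
    have e3 : (Pi.single m 1 : Fin n → ℝ) ᵥ* mvbR (A.updateRow m p) = fun i => (p i : ℝ) := by
      funext j; simp [mvbR]
    rw [e1, Matrix.add_vecMul, e2, Matrix.smul_vecMul, e3, Matrix.sub_vecMul, Matrix.smul_vecMul,
      hb, hc, mvbC_spec h, mvbC_spec h]
    simp
  rw [← key, mvbC_uniq hdet]
  intro k
  by_cases hk : k = m
  · subst hk; simpa [e] using ht0
  · simp only [e, Function.update_of_ne hk]
    rcases (hp k).lt_or_eq with h4 | h4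
    · have := hmin k h4
      rw [le_div_iff₀ h4] at this
      linarith
    · rw [← h4]; simpa using hy k

/-- a (counted) lattice covering of `P` with vertices in `V`. -/
def mvbCov (d : ℕ) (P : Set (Fin d → ℝ)) (V : Set (Fin (d + 1) → ℤ)) (N : ℕ) (D : ℝ) : Prop :=
  ∃ (ι : Type) (_ : Fintype ι) (A : ι → Matrix (Fin (d + 1)) (Fin (d + 1)) ℤ),
    (∀ i, (A i).det ≠ 0) ∧ (∀ i m, A i m ∈ V) ∧
    (∀ x ∈ P, ∃ i, ∀ m, 0 ≤ mvbC (A i) (mvbH x) m) ∧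
    (∑ i, |((A i).det : ℝ)| = D) ∧ N ≤ Fintype.card ι

/-- the key local counting estimate -/
theorem mvb_count (d : ℕ) (P : Set (Fin d → ℝ)) {ι : Type} [Fintype ι] [DecidableEq ι]
    (A : ι → Matrix (Fin (d + 1)) (Fin (d + 1)) ℤ)
    (hdet : ∀ i, (A i).det ≠ 0)
    (hcov : ∀ x ∈ P, ∃ i, ∀ m, 0 ≤ mvbC (A i) (mvbH x) m)
    (q : Fin d → ℝ) (hq : q ∈ interior P)
    (I : Finset ι) (hI : ∀ i, i ∈ I ↔ ∀ m, 0 ≤ mvbC (A i) (mvbH q) m)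
    (J : ι → Finset (Fin (d + 1))) (hJ : ∀ i m, m ∈ J i ↔ 0 < mvbC (A i) (mvbH q) m)
    (hJ2 : ∀ i ∈ I, 2 ≤ (J i).card) :
    d ≤ ∑ i ∈ I, ((J i).card - 1) := by
  by_contra hlt
  push Not at hlt
  have hcard : ∀ i ∈ I, I.card ≤ ((J i)ᶜ).card := by
    intro i hi
    rw [Finset.card_compl, Fintype.card_fin]
    rw [← Finset.add_sum_erase I _ hi] at hlt
    have h1 : (I.erase i).card ≤ ∑ k ∈ I.erase i, ((J k).card - 1) := by
      rw [Finset.card_eq_sum_ones]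
      apply Finset.sum_le_sum
      intro k hk
      have := hJ2 k (Finset.mem_of_mem_erase hk)
      omega
    rw [Finset.card_erase_of_mem hi] at h1
    have := hJ2 i hi
    have : 0 < I.card := Finset.card_pos.2 ⟨i, hi⟩
    omega
  obtain ⟨m, hm, y, hy⟩ := mvb_greedy (fun i => mvbF (A i)) (fun i => (J i)ᶜ) I.card I
    (fun i _ => (mvbF_indep (hdet i)).linearIndepOn _) hcard le_rfl
  have hzero : ∀ i ∈ I, mvbC (A i) (mvbH q) (m i) = 0 := by
    intro i hi
    have h1 := hm i hi
    rw [Finset.mem_compl, hJ] at h1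
    exact le_antisymm (not_lt.1 h1) ((hI i).1 hi _)
  -- direction with zero first coordinate
  let z : Fin (d + 1) → ℝ := y - y 0 • mvbH q
  have hz0 : z 0 = 0 := by simp [z, mvbH]
  have hz : ∀ i ∈ I, mvbC (A i) z (m i) < 0 := by
    intro i hi
    have h1 : mvbC (A i) y (m i) < 0 := hy i hi
    have h2 : y = z + y 0 • mvbH q := by simp [z]
    rw [h2, mvbC_add, mvbC_smul] at h1
    simpa [hzero i hi] using h1
  let w : Fin d → ℝ := fun i => z i.succ
  have hline : ∀ ε : ℝ, mvbH (q + ε • w) = mvbH q + ε • z := by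
    intro ε
    funext k
    refine Fin.cases ?_ (fun k => ?_) k
    · simp [mvbH, hz0]
    · simp [mvbH, w]
  have hc : Continuous (fun ε : ℝ => q + ε • w) := by fun_prop
  have ev1 : ∀ᶠ ε in nhds (0 : ℝ), q + ε • w ∈ P := by
    have : ∀ᶠ x in nhds (q + (0 : ℝ) • w), x ∈ P := by
      rw [zero_smul, add_zero]
      exact mem_interior_iff_mem_nhds.1 hq
    exact hc.continuousAt.eventually this
  have ev2 : ∀ i, i ∉ I → ∀ᶠ ε in nhds (0 : ℝ), ∃ k, mvbC (A i) (mvbH q + ε • z) k < 0 := by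
    intro i hi
    rw [hI] at hi
    push Not at hi
    obtain ⟨k, hk⟩ := hi
    have hcc : Continuous (fun ε : ℝ => mvbC (A i) (mvbH q + ε • z) k) :=
      (mvbC_cont (A i) k).comp (by fun_prop)
    have := hcc.continuousAt.eventually_lt (continuousAt_const (y := (0 : ℝ)) (x := (0 : ℝ)))
      (by simpa using hk)
    exact this.mono fun ε h => ⟨k, h⟩
  have ev3 : ∀ᶠ ε in nhds (0 : ℝ), ∀ i, i ∉ I → ∃ k, mvbC (A i) (mvbH q + ε • z) k < 0 := by
    rw [Filter.eventually_all]
    intro i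
    by_cases hi : i ∈ I
    · simp [hi]
    · simpa [hi] using ev2 i hi
  have ev4 : ∃ ε : ℝ, (q + ε • w ∈ P ∧ ∀ i, i ∉ I → ∃ k, mvbC (A i) (mvbH q + ε • z) k < 0) ∧
      0 < ε := by
    have h5 := (ev1.and ev3).filter_mono (nhdsWithin_le_nhds (s := Set.Ioi 0))
    exact (h5.and self_mem_nhdsWithin).exists
  obtain ⟨ε, ⟨hεP, hε⟩, hpos⟩ := ev4
  obtain ⟨i, hi⟩ := hcov _ hεP
  rw [hline] at hi
  by_cases hiI : i ∈ I
  · have h6 := hi (m i)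
    rw [mvbC_add, mvbC_smul] at h6
    simp only [Pi.add_apply, Pi.smul_apply, smul_eq_mul, hzero i hiI, zero_add] at h6
    have := mul_neg_of_pos_of_neg hpos (hz i hiI)
    linarith
  · obtain ⟨k, hk⟩ := hε i hiI
    exact absurd (hi k) (not_le.2 hk)

theorem mvb_insert (d : ℕ) (P : Set (Fin d → ℝ)) (V : Set (Fin (d + 1) → ℤ)) (N : ℕ) (D : ℝ)
    (hV : ∀ v ∈ V, v 0 = 1) (h : mvbCov d P V N D) (p : Fin d → ℤ)
    (hp : (fun i => (p i : ℝ)) ∈ interior P) (hpV : mvbHZ p ∉ V) :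
    mvbCov d P (insert (mvbHZ p) V) (N + d) D := by
  classical
  obtain ⟨ι, _, A, hdet, hrow, hcov, hsum, hN⟩ := h
  set q : Fin d → ℝ := fun i => (p i : ℝ) with hq
  have hrow1 : ∀ i m, A i m 0 = 1 := fun i m => hV _ (hrow i m)
  let I : Finset ι := Finset.univ.filter fun i => ∀ m, 0 ≤ mvbC (A i) (mvbH q) m
  let J : ι → Finset (Fin (d + 1)) := fun i => Finset.univ.filter fun m => 0 < mvbC (A i) (mvbH q) m
  have hI : ∀ i, i ∈ I ↔ ∀ m, 0 ≤ mvbC (A i) (mvbH q) m := fun i => by simp [I]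
  have hJ : ∀ i m, m ∈ J i ↔ 0 < mvbC (A i) (mvbH q) m := fun i m => by simp [J]
  have hcs : ∀ i, ∑ m, mvbC (A i) (mvbH q) m = 1 := fun i => by
    rw [mvbC_sum (hdet i) (hrow1 i)]; simp [mvbH]
  have hJsum : ∀ i ∈ I, ∑ m ∈ J i, mvbC (A i) (mvbH q) m = 1 := by
    intro i hi
    rw [← hcs i]
    apply Finset.sum_subset (Finset.subset_univ _)
    intro m _ hm
    rw [hJ] at hm
    exact le_antisymm (not_lt.1 hm) ((hI i).1 hi m)
  have hJ2 : ∀ i ∈ I, 2 ≤ (J i).card := by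
    intro i hi
    by_contra hlt
    have h01 : (J i).card = 0 ∨ (J i).card = 1 := by omega
    rcases h01 with h0 | h1
    · have := hJsum i hi
      rw [Finset.card_eq_zero.1 h0] at this
      simp at this
    · obtain ⟨m, hm⟩ := Finset.card_eq_one.1 h1
      have h2 := hJsum i hi
      rw [hm, Finset.sum_singleton] at h2
      have h3 : mvbC (A i) (mvbH q) = Pi.single m 1 := by
        funext k
        by_cases hk : k = m
        · subst hk; simpa using h2
        · have : k ∉ J i := by rw [hm]; simpa using hk
          rw [hJ] at this
          rw [Pi.single_eq_of_ne hk]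
          exact le_antisymm (not_lt.1 this) ((hI i).1 hi k)
      have h4 := mvbC_spec (hdet i) (mvbH q)
      rw [h3] at h4
      apply hpV
      have : mvbHZ p = A i m := by
        funext k
        have h5 := congrFun h4 k
        rw [hq, ← mvbHZ_cast] at h5
        simp [mvbR] at h5
        exact h5.symm
      rw [this]; exact hrow i m
  have hcount := mvb_count d P A hdet hcov q hp I hI J hJ hJ2
  let K : ι → Finset (Fin (d + 1)) := fun i => if i ∈ I then J i else {0}
  let A' : (Σ i, K i) → Matrix (Fin (d + 1)) (Fin (d + 1)) ℤ := fun s =>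
    if s.1 ∈ I then (A s.1).updateRow s.2 (mvbHZ p) else A s.1
  have hdu : ∀ i m, (((A i).updateRow m (mvbHZ p)).det : ℝ) =
      mvbC (A i) (mvbH q) m * ((A i).det : ℝ) := by
    intro i m
    rw [mvb_det_update (hdet i), mvbHZ_cast]
  refine ⟨Σ i, K i, inferInstance, A', ?_, ?_, ?_, ?_, ?_⟩
  · rintro ⟨i, m, hm⟩
    by_cases hi : i ∈ I
    · simp only [K, hi, if_true, hJ] at hm
      simp only [A', hi, if_true]
      rw [← Int.cast_ne_zero (α := ℝ), hdu]
      exact mul_ne_zero hm.ne' (Int.cast_ne_zero.2 (hdet i))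
    · simpa [A', hi] using hdet i
  · rintro ⟨i, m, hm⟩ k
    by_cases hi : i ∈ I
    · simp only [A', hi, if_true]
      by_cases hk : k = m
      · subst hk; left; funext j; simp
      · right
        have : (A i).updateRow m (mvbHZ p) k = A i k := by
          funext j; rw [Matrix.updateRow_ne hk]
        rw [this]
        exact hrow i k
    · right; simpa [A', hi] using hrow i k
  · intro x hx
    obtain ⟨i, hi⟩ := hcov x hx
    by_cases hiI : i ∈ I
    · obtain ⟨m, hm, hk⟩ := mvb_split_cover (hdet i) (mvbHZ p)
        (by rw [mvbHZ_cast]; exact (hI i).1 hiI)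
        (by
          rw [mvbHZ_cast]
          have : (J i).Nonempty := Finset.card_pos.1 (by have := hJ2 i hiI; omega)
          obtain ⟨m, hm⟩ := this
          exact ⟨m, (hJ i m).1 hm⟩) (mvbH x) hi
      rw [mvbHZ_cast] at hm
      refine ⟨⟨i, m, by simp only [K, hiI, if_true, hJ]; exact hm⟩, ?_⟩
      simpa only [A', hiI, if_true] using hk
    · refine ⟨⟨i, 0, by simp [K, hiI]⟩, ?_⟩
      simpa only [A', hiI, if_false] using hi
  · rw [← hsum, Fintype.sum_sigma]
    apply Finset.sum_congr rfl
    intro i _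
    by_cases hi : i ∈ I
    · have h1 : ∑ y : K i, |((A' ⟨i, y⟩).det : ℝ)| =
          ∑ m ∈ K i, mvbC (A i) (mvbH q) m * |((A i).det : ℝ)| := by
        rw [← Finset.sum_coe_sort (K i)]
        apply Finset.sum_congr rfl
        rintro m _
        simp only [A', hi, if_true]
        rw [hdu, abs_mul, abs_of_nonneg ((hI i).1 hi _)]
      rw [h1, ← Finset.sum_mul]
      simp only [K, hi, if_true]
      rw [hJsum i hi, one_mul]
    · have h1 : ∑ y : K i, |((A' ⟨i, y⟩).det : ℝ)| =
          ∑ m ∈ K i, |((A i).det : ℝ)| := by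
        rw [← Finset.sum_coe_sort (K i)]
        apply Finset.sum_congr rfl
        rintro m _
        simp only [A', hi, if_false]
      rw [h1]
      simp [K, hi]
  · rw [Fintype.card_sigma]
    have h1 : ∀ i, Fintype.card (K i) = 1 + if i ∈ I then (J i).card - 1 else 0 := by
      intro i
      rw [Fintype.card_coe]
      by_cases hi : i ∈ I
      · simp only [K, hi, if_true]
        have := hJ2 i hi
        omega
      · simp [K, hi]
    rw [Finset.sum_congr rfl fun i _ => h1 i, Finset.sum_add_distrib]
    have h2 : (∑ i : ι, if i ∈ I then (J i).card - 1 else 0) = ∑ i ∈ I, ((J i).card - 1) := by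
      rw [← Finset.sum_filter]; simp
    rw [h2]
    simp only [Finset.sum_const, Finset.card_univ, smul_eq_mul, mul_one]
    omega

theorem mvb_generic {α E : Type*} [Fintype α] [AddCommGroup E] [Module ℝ E] (W : α → E) :
    ∃ h : α → ℝ, ∀ S : Finset α, ¬ LinearIndepOn ℝ W (S : Set α) →
      ∃ r : α → ℝ, (∀ a, a ∉ S → r a = 0) ∧ ∑ a, r a • W a = 0 ∧ ∑ a, r a * h a ≠ 0 := by
  classical
  have h1 : ∀ S : Finset α, ∃ r : α → ℝ, ¬ LinearIndepOn ℝ W (S : Set α) →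
      ((∀ a, a ∉ S → r a = 0) ∧ ∑ a, r a • W a = 0 ∧ r ≠ 0) := by
    intro S
    by_cases hS : LinearIndepOn ℝ W (S : Set α)
    · exact ⟨0, fun h => absurd hS h⟩
    · have hS' := hS
      rw [linearIndepOn_finset_iff] at hS'
      push Not at hS'
      obtain ⟨f, hf, i, hi, hfi⟩ := hS'
      refine ⟨fun a => if a ∈ S then f a else 0, fun _ => ⟨fun a ha => by simp [ha], ?_, ?_⟩⟩
      · simpa [ite_smul, ← Finset.sum_filter] using hf
      · intro h0
        have := congrFun h0 i
        simp [hi] at this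
        exact hfi this
  choose r hr using h1
  let ψ : Finset α → ((α → ℝ) →ₗ[ℝ] ℝ) := fun S => ∑ a, r S a • LinearMap.proj a
  have hψ : ∀ S h, ψ S h = ∑ a, r S a * h a := by intro S h; simp [ψ]
  let s : Finset (Subspace ℝ (α → ℝ)) :=
    (Finset.univ.filter fun S : Finset α => ¬ LinearIndepOn ℝ W (S : Set α)).image
      fun S => LinearMap.ker (ψ S)
  have hs : ⊤ ∉ s := by
    intro ht
    simp only [s, Finset.mem_image, Finset.mem_filter, Finset.mem_univ, true_and] at ht
    obtain ⟨S, hS, hk⟩ := ht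
    obtain ⟨_, _, h3⟩ := hr S hS
    apply h3
    funext a
    have h4 : (Pi.single a 1 : α → ℝ) ∈ LinearMap.ker (ψ S) := by rw [hk]; trivial
    rw [LinearMap.mem_ker, hψ] at h4
    simpa [Pi.single_apply] using h4
  have h5 := Subspace.biUnion_ne_univ_of_top_notMem hs
  rw [Set.ne_univ_iff_exists_notMem] at h5
  obtain ⟨h, hh⟩ := h5
  refine ⟨h, fun S hS => ⟨r S, (hr S hS).1, (hr S hS).2.1, ?_⟩⟩
  intro h0
  apply hh
  simp only [Set.mem_iUnion]
  refine ⟨LinearMap.ker (ψ S), Finset.mem_image_of_mem _ (by simpa using hS), ?_⟩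
  simpa [hψ] using h0

theorem mvb_improve {α E : Type*} [Fintype α] [AddCommGroup E] [Module ℝ E] (W : α → E)
    (h a : α → ℝ) (ha : ∀ k, 0 ≤ a k)
    (hmin : ∀ b : α → ℝ, (∀ k, 0 ≤ b k) → ∑ k, b k • W k = ∑ k, a k • W k →
      ∑ k, a k * h k ≤ ∑ k, b k * h k)
    (r : α → ℝ) (hr : ∑ k, r k • W k = 0) (hr0 : ∀ k, a k = 0 → 0 ≤ r k) :
    0 ≤ ∑ k, r k * h k := by
  have ev : ∀ᶠ ε in nhdsWithin (0 : ℝ) (Set.Ioi 0), ∀ k, 0 ≤ a k + ε * r k := by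
    rw [Filter.eventually_all]
    intro k
    rcases (ha k).lt_or_eq with h1 | h1
    · have hc : Continuous (fun ε : ℝ => a k + ε * r k) := by fun_prop
      have := (continuousAt_const (y := (0 : ℝ)) (x := (0 : ℝ))).eventually_lt hc.continuousAt
        (by simpa using h1)
      exact (this.mono fun ε h => h.le).filter_mono nhdsWithin_le_nhds
    · filter_upwards [self_mem_nhdsWithin] with ε hε
      rw [← h1, zero_add]
      exact mul_nonneg (le_of_lt hε) (hr0 k h1.symm)
  obtain ⟨ε, hε, hpos⟩ := (ev.and self_mem_nhdsWithin).exists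
  have hpos : 0 < ε := hpos
  have := hmin (fun k => a k + ε * r k) hε (by
    simp only [add_smul, mul_smul, Finset.sum_add_distrib, ← Finset.smul_sum, hr]; simp)
  simp only [add_mul, mul_assoc, Finset.sum_add_distrib, ← Finset.mul_sum] at this
  have h2 : 0 ≤ ε * ∑ k, r k * h k := by linarith
  exact nonneg_of_mul_nonneg_right h2 hpos

/-- the matrix attached to an `n`-subset -/
def mvbM {α : Type*} {n : ℕ} (w : α → Fin n → ℤ) (B : Finset α) (hB : B.card = n) :
    Matrix (Fin n) (Fin n) ℤ := fun m => w ((Finset.equivFinOfCardEq hB).symm m)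

theorem mvbM_sum {α : Type*} {n : ℕ} (w : α → Fin n → ℤ) (B : Finset α)
    (hB : B.card = n) (b : α → ℝ) :
    (fun m => b ((Finset.equivFinOfCardEq hB).symm m)) ᵥ* mvbR (mvbM w B hB) =
      ∑ a ∈ B, b a • (fun i => (w a i : ℝ)) := by
  rw [Matrix.vecMul_eq_sum, ← Finset.sum_coe_sort B]
  exact Fintype.sum_equiv (Finset.equivFinOfCardEq hB).symm _ _ (fun m => rfl)

theorem mvbM_det {α : Type*} {n : ℕ} (w : α → Fin n → ℤ) (B : Finset α)
    (hB : B.card = n) (hl : LinearIndepOn ℝ (fun a => (fun i => (w a i : ℝ))) (B : Set α)) :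
    (mvbM w B hB).det ≠ 0 := by
  have h1 : LinearIndependent ℝ (mvbR (mvbM w B hB)).row := by
    exact LinearIndependent.comp (ι := (B : Set α)) hl (Finset.equivFinOfCardEq hB).symm
      (Equiv.injective _)
  rw [Matrix.linearIndependent_rows_iff_isUnit, Matrix.isUnit_iff_isUnit_det, mvbR_det] at h1
  intro h0
  simp [h0] at h1

theorem mvb_dense {α : Type*} {n : ℕ} [Fintype α] (W : α → Fin n → ℝ)
    (hspan : Submodule.span ℝ (Set.range W) = ⊤) :
    Dense {a : α → ℝ | ∀ S : Finset α, Submodule.span ℝ (W '' (S : Set α)) ≠ ⊤ →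
      ∑ k, a k • W k ∉ Submodule.span ℝ (W '' (S : Set α))} := by
  classical
  let Λ : (α → ℝ) →ₗ[ℝ] (Fin n → ℝ) := Fintype.linearCombination ℝ W
  have hΛ : ∀ a, Λ a = ∑ k, a k • W k := fun a => by simp [Λ, Fintype.linearCombination_apply]
  have hsurj : LinearMap.range Λ = ⊤ := by
    rw [← hspan]; exact Fintype.range_linearCombination ℝ W
  have h1 : {a : α → ℝ | ∀ S : Finset α, Submodule.span ℝ (W '' (S : Set α)) ≠ ⊤ →
      ∑ k, a k • W k ∉ Submodule.span ℝ (W '' (S : Set α))} =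
      ⋂ S : {S : Finset α // Submodule.span ℝ (W '' (S : Set α)) ≠ ⊤},
        ((((Submodule.span ℝ (W '' (S.1 : Set α))).comap Λ : Submodule ℝ (α → ℝ)) :
          Set (α → ℝ)))ᶜ := by
    ext a
    simp [hΛ]
  rw [h1]
  apply dense_iInter_of_isOpen
  · intro S
    rw [isOpen_compl_iff]
    exact Submodule.closed_of_finiteDimensional _
  · intro S
    rw [← interior_eq_empty_iff_dense_compl]
    by_contra hne
    have h2 := Submodule.eq_top_of_nonempty_interior' (R := ℝ) _
      (Set.nonempty_iff_ne_empty.2 hne)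
    apply S.2
    rw [eq_top_iff]
    intro y _
    have : y ∈ LinearMap.range Λ := by rw [hsurj]; trivial
    obtain ⟨a, rfl⟩ := this
    have : a ∈ (Submodule.span ℝ (W '' (S.1 : Set α))).comap Λ := by rw [h2]; trivial
    exact this

theorem mvb_triang {α : Type} {d : ℕ} [Fintype α] (w : α → Fin (d + 1) → ℤ)
    (h1 : ∀ a, w a 0 = 1)
    (hspan : Submodule.span ℝ (Set.range fun a => (fun i => (w a i : ℝ))) = ⊤) :
    ∃ (ι : Type) (_ : Fintype ι) (A : ι → Matrix (Fin (d + 1)) (Fin (d + 1)) ℤ),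
      (∀ i, (A i).det ≠ 0) ∧ (∀ i m, A i m ∈ Set.range w) ∧
      (∀ a : α → ℝ, (∀ k, 0 ≤ a k) →
        ∃ i, ∀ m, 0 ≤ mvbC (A i) (∑ k, a k • (fun j => (w k j : ℝ))) m) ∧
      (∀ i j y, (∀ m, 0 < mvbC (A i) y m) → (∀ m, 0 < mvbC (A j) y m) → i = j) := by
  classical
  set W : α → Fin (d + 1) → ℝ := fun a => (fun i => (w a i : ℝ)) with hW
  obtain ⟨h, hh⟩ := mvb_generic W
  let ι := {B : Finset α // B.card = d + 1 ∧ LinearIndepOn ℝ W (B : Set α) ∧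
    ∃ u : Fin (d + 1) → ℝ, (∀ a ∈ B, u ⬝ᵥ W a = h a) ∧ ∀ a, u ⬝ᵥ W a ≤ h a}
  let A : ι → Matrix (Fin (d + 1)) (Fin (d + 1)) ℤ := fun B => mvbM w B.1 B.2.1
  have hdet : ∀ i, (A i).det ≠ 0 := fun i => mvbM_det w i.1 i.2.1 i.2.2.1
  have hcoord : ∀ (i : ι) (b : α → ℝ) m, mvbC (A i) (∑ a ∈ i.1, b a • W a) m =
      b ((Finset.equivFinOfCardEq i.2.1).symm m) := by
    intro i b m
    rw [← mvbM_sum w i.1 i.2.1 b, mvbC_uniq (hdet i)]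
  have hcoord2 : ∀ (i : ι) y, ∃ b : α → ℝ, (∀ a ∈ i.1, ∃ m, b a = mvbC (A i) y m) ∧
      ∑ a ∈ i.1, b a • W a = y := by
    intro i y
    refine ⟨fun a => if ha : a ∈ i.1 then
      mvbC (A i) y (Finset.equivFinOfCardEq i.2.1 ⟨a, ha⟩) else 0, ?_, ?_⟩
    · intro a ha
      exact ⟨_, dif_pos ha⟩
    · refine (mvbM_sum w i.1 i.2.1 _).symm.trans ?_
      conv_rhs => rw [← mvbC_spec (hdet i) y]
      congr 1
      funext m
      simp [A]
  refine ⟨ι, inferInstance, A, hdet, fun i m => ⟨_, rfl⟩, ?_, ?_⟩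
  · -- covering
    have hgen : ∀ a : α → ℝ, (∀ k, 0 ≤ a k) →
        (∀ S : Finset α, Submodule.span ℝ (W '' (S : Set α)) ≠ ⊤ →
          ∑ k, a k • W k ∉ Submodule.span ℝ (W '' (S : Set α))) →
        ∃ i, ∀ m, 0 ≤ mvbC (A i) (∑ k, a k • W k) m := by
      intro a0 ha0 hg
      let K : Set (α → ℝ) := {b | (∀ k, 0 ≤ b k) ∧ ∑ k, b k • W k = ∑ k, a0 k • W k}
      have hsum : ∀ b : α → ℝ, (∑ k, b k • W k) 0 = ∑ k, b k := by
        intro b; simp [W, h1]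
      have hKc : IsCompact K := by
        apply IsCompact.of_isClosed_subset (isCompact_Icc (a := (0 : α → ℝ))
          (b := fun _ => ∑ k, a0 k))
        · apply IsClosed.inter
          · exact isClosed_le (f := fun _ => (0 : α → ℝ)) (g := id) continuous_const continuous_id
          · exact isClosed_eq (by fun_prop) continuous_const
        · rintro b ⟨hb0, hb⟩
          refine ⟨hb0, fun k => ?_⟩
          have : ∑ k, b k = ∑ k, a0 k := by rw [← hsum, ← hsum, hb]
          show b k ≤ ∑ k, a0 k
          rw [← this]
          exact Finset.single_le_sum (fun i _ => hb0 i) (Finset.mem_univ k)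
      obtain ⟨a, haK, hamin⟩ := hKc.exists_isMinOn ⟨a0, ha0, rfl⟩
        (f := fun b => ∑ k, b k * h k) (by fun_prop)
      have hmin : ∀ b : α → ℝ, (∀ k, 0 ≤ b k) → ∑ k, b k • W k = ∑ k, a k • W k →
          ∑ k, a k * h k ≤ ∑ k, b k * h k := by
        intro b hb0 hb
        exact hamin ⟨hb0, hb.trans haK.2⟩
      have himp := mvb_improve W h a haK.1 hmin
      let S : Finset α := Finset.univ.filter fun k => a k ≠ 0
      have hS : ∀ k, k ∈ S ↔ a k ≠ 0 := fun k => by simp [S]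
      have hSl : LinearIndepOn ℝ W (S : Set α) := by
        by_contra hn
        obtain ⟨r, hr0, hr, hrh⟩ := hh S hn
        have i1 := himp r hr (fun k hk => by rw [hr0 k (by simp [hS, hk])])
        have i2 := himp (-r) (by simpa using hr)
          (fun k hk => by simp [hr0 k (by simp [hS, hk])])
        simp only [Pi.neg_apply, neg_mul, Finset.sum_neg_distrib] at i2
        exact hrh (by linarith)
      have hyS : ∑ k ∈ S, a k • W k = ∑ k, a0 k • W k := by
        rw [← haK.2]
        apply Finset.sum_subset (Finset.subset_univ _)
        intro k _ hk
        rw [hS, not_not] at hk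
        simp [hk]
      have hStop : Submodule.span ℝ (W '' (S : Set α)) = ⊤ := by
        by_contra hn
        apply hg S hn
        rw [← hyS]
        exact Submodule.sum_mem _ fun k hk =>
          Submodule.smul_mem _ _ (Submodule.subset_span ⟨k, hk, rfl⟩)
      have hScard : S.card = d + 1 := by
        have := finrank_span_eq_card hSl
        rw [← Set.image_eq_range, hStop] at this
        simpa using this.symm
      let e := Finset.equivFinOfCardEq hScard
      let u : Fin (d + 1) → ℝ := (mvbR (mvbM w S hScard))⁻¹ *ᵥ fun m => h (e.symm m)
      have hu : ∀ k ∈ S, u ⬝ᵥ W k = h k := by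
        intro k hk
        have h5 : mvbR (mvbM w S hScard) *ᵥ u = fun m => h (e.symm m) := by
          simp only [u]
          rw [Matrix.mulVec_mulVec, Matrix.mul_nonsing_inv _ (mvbR_unit (mvbM_det w S hScard hSl)),
            Matrix.one_mulVec]
        have h6 := congrFun h5 (e ⟨k, hk⟩)
        simp only [Equiv.symm_apply_apply] at h6
        rw [← h6, Matrix.mulVec, dotProduct_comm]
        congr 1
        funext j
        simp [mvbR, mvbM, W, e]
      have hu' : ∀ v, u ⬝ᵥ W v ≤ h v := by
        intro v
        have hv : W v ∈ Submodule.span ℝ (W '' (S : Set α)) := by rw [hStop]; trivial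
        rw [Submodule.mem_span_image_finset_iff_exists_fun] at hv
        obtain ⟨c, hc⟩ := hv
        let μ : α → ℝ := fun k => if hk : k ∈ S then c ⟨k, hk⟩ else 0
        have hμ0 : ∀ k, k ∉ S → μ k = 0 := fun k hk => dif_neg hk
        have hμ : ∑ k, μ k • W k = W v := by
          rw [← hc]
          rw [← Finset.sum_subset (Finset.subset_univ S) (fun k _ hk => by simp [hμ0 k hk]),
            ← Finset.sum_coe_sort S]
          exact Finset.sum_congr rfl fun k _ => by simp [μ]
        have hi := himp (fun k => (Pi.single v 1 : α → ℝ) k - μ k)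
          (by
            simp only [sub_smul, Finset.sum_sub_distrib, hμ]
            simp [Pi.single_apply, ite_smul])
          (fun k hk => by
            rw [hμ0 k (by simp [hS, hk]), sub_zero, Pi.single_apply]
            split_ifs <;> norm_num)
        have hμh : ∑ k, μ k * h k = u ⬝ᵥ W v := by
          rw [← hμ, dotProduct_sum]
          apply Finset.sum_congr rfl
          intro k _
          rw [dotProduct_smul, smul_eq_mul]
          by_cases hk : k ∈ S
          · rw [hu k hk]
          · simp [hμ0 k hk]
        simp only [sub_mul, Finset.sum_sub_distrib, hμh] at hi
        simp [Pi.single_apply] at hi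
        exact hi
      · refine ⟨⟨S, hScard, hSl, u, hu, hu'⟩, ?_⟩
        intro m
        rw [← hyS]
        have := hcoord ⟨S, hScard, hSl, u, hu, hu'⟩ a m
        rw [this]
        exact haK.1 _
    -- closure argument
    let Z : Set (α → ℝ) := {a | ∃ i, ∀ m, 0 ≤ mvbC (A i) (∑ k, a k • W k) m}
    have hZ : IsClosed Z := by
      have : Z = ⋃ i, ⋂ m, {a : α → ℝ | 0 ≤ mvbC (A i) (∑ k, a k • W k) m} := by
        ext a; simp [Z]
      rw [this]
      apply isClosed_iUnion_of_finite
      intro i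
      apply isClosed_iInter
      intro m
      exact isClosed_le continuous_const ((mvbC_cont (A i) m).comp (by fun_prop))
    let U : Set (α → ℝ) := Set.pi Set.univ fun _ => Set.Ioi (0 : ℝ)
    have hU : IsOpen U := isOpen_set_pi Set.finite_univ fun _ _ => isOpen_Ioi
    have hUZ : U ⊆ Z := by
      refine ((mvb_dense W hspan).open_subset_closure_inter hU).trans ?_
      apply closure_minimal _ hZ
      rintro a ⟨ha, hg⟩
      exact hgen a (fun k => le_of_lt (ha k trivial)) hg
    intro a ha
    have : a ∈ closure U := by
      rw [closure_pi_set]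
      intro k _
      rw [closure_Ioi]
      exact ha k
    exact closure_minimal hUZ hZ this
  · -- disjointness
    have key : ∀ (i j : ι) y, (∀ m, 0 < mvbC (A i) y m) → (∀ m, 0 < mvbC (A j) y m) →
        ∀ u v : Fin (d + 1) → ℝ, (∀ a ∈ i.1, u ⬝ᵥ W a = h a) → (∀ a, u ⬝ᵥ W a ≤ h a) →
        (∀ a ∈ j.1, v ⬝ᵥ W a = h a) → u ⬝ᵥ y ≤ v ⬝ᵥ y ∧
          (v ⬝ᵥ y ≤ u ⬝ᵥ y → ∀ a ∈ j.1, u ⬝ᵥ W a = h a) := by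
      intro i j y hi hj u v hu hu' hv
      obtain ⟨b, hb, rfl⟩ := hcoord2 j y
      have hbpos : ∀ a ∈ j.1, 0 < b a := by
        intro a ha
        obtain ⟨m, hm⟩ := hb a ha
        rw [hm]; exact hj m
      have e1 : ∀ z : Fin (d + 1) → ℝ, z ⬝ᵥ (∑ a ∈ j.1, b a • W a) =
          ∑ a ∈ j.1, b a * (z ⬝ᵥ W a) := by
        intro z; rw [dotProduct_sum]; simp [dotProduct_smul]
      have hle : ∀ a ∈ j.1, b a * (u ⬝ᵥ W a) ≤ b a * (v ⬝ᵥ W a) := by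
        intro a ha
        rw [hv a ha]
        exact mul_le_mul_of_nonneg_left (hu' a) (hbpos a ha).le
      rw [e1, e1]
      refine ⟨Finset.sum_le_sum hle, fun hge a ha => ?_⟩
      have := (Finset.sum_eq_sum_iff_of_le hle).1 (le_antisymm (Finset.sum_le_sum hle) hge) a ha
      rw [mul_right_inj' (hbpos a ha).ne', hv a ha] at this
      exact this
    intro i j y hi hj
    obtain ⟨u, hu, hu'⟩ := i.2.2.2
    obtain ⟨v, hv, hv'⟩ := j.2.2.2
    have k1 := key i j y hi hj u v hu hu' hv
    have k2 := key j i y hj hi v u hv hv' hu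
    have huj := k1.2 k2.1
    have hli : LinearIndepOn ℝ W ((i.1 ∪ j.1 : Finset α) : Set α) := by
      by_contra hn
      obtain ⟨r, hr0, hr, hrh⟩ := hh _ hn
      apply hrh
      have : u ⬝ᵥ ∑ a, r a • W a = 0 := by rw [hr]; simp
      rw [dotProduct_sum] at this
      rw [← this]
      apply Finset.sum_congr rfl
      intro a _
      rw [dotProduct_smul, smul_eq_mul]
      by_cases ha : a ∈ i.1 ∪ j.1
      · rcases Finset.mem_union.1 ha with ha | ha
        · rw [hu a ha]
        · rw [huj a ha]
      · simp [hr0 a ha]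
    have hc : (i.1 ∪ j.1).card ≤ d + 1 := by
      have := LinearIndependent.fintype_card_le_finrank hli
      simpa using this
    have e1 : i.1 = i.1 ∪ j.1 :=
      Finset.eq_of_subset_of_card_le Finset.subset_union_left (by rw [i.2.1]; exact hc)
    have e2 : j.1 = i.1 ∪ j.1 :=
      Finset.eq_of_subset_of_card_le Finset.subset_union_right (by rw [j.2.1]; exact hc)
    exact Subtype.ext (e1.trans e2.symm)

def mvbDelta (d : ℕ) : Set (Fin d → ℝ) := {x | (∀ i, 0 < x i) ∧ ∑ i, x i < 1}

theorem mvbDelta_open (d : ℕ) : IsOpen (mvbDelta d) := by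
  apply IsOpen.inter
  · have : {x : Fin d → ℝ | ∀ i, 0 < x i} = ⋂ i, {x : Fin d → ℝ | 0 < x i} := by ext; simp
    change IsOpen {x : Fin d → ℝ | ∀ i, 0 < x i}
    rw [this]
    exact isOpen_iInter_of_finite fun i => isOpen_lt continuous_const (continuous_apply i)
  · exact isOpen_lt (f := fun x : Fin d → ℝ => ∑ i, x i) (by fun_prop) continuous_const

theorem mvbDelta_vol (d : ℕ) :
    ENNReal.ofReal (1 / (Nat.factorial d : ℝ)) ≤ volume (mvbDelta d) := by
  classical
  let f : (Fin d → Bool) → Fin d → ℝ → ℝ := fun s i => if s i then id else Neg.neg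
  have hf : ∀ s, MeasurePreserving (fun (x : Fin d → ℝ) i => f s i (x i)) := by
    intro s
    apply volume_preserving_pi
    intro i
    by_cases h : s i
    · simpa [f, h] using MeasurePreserving.id (volume : Measure ℝ)
    · simpa [f, h] using Measure.measurePreserving_neg (volume : Measure ℝ)
  have hB := MeasureTheory.volume_sum_rpow_lt_one (Fin d) (p := 1) le_rfl
  have hsub : {x : Fin d → ℝ | ∑ i, |x i| ^ (1 : ℝ) < 1} ⊆
      (⋃ i, {x : Fin d → ℝ | x i = 0}) ∪
      ⋃ s, (fun (x : Fin d → ℝ) i => f s i (x i)) ⁻¹' mvbDelta d := by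
    intro x hx
    simp only [Real.rpow_one, Set.mem_ofPred_eq] at hx
    by_cases h0 : ∃ i, x i = 0
    · left; simpa using h0
    · right
      push Not at h0
      rw [Set.mem_iUnion]
      refine ⟨fun i => decide (0 < x i), ?_⟩
      have h3 : (fun i => f (fun i => decide (0 < x i)) i (x i)) = fun i => |x i| := by
        funext i
        by_cases hi : 0 < x i
        · simp [f, hi, abs_of_pos hi]
        · simp [f, hi, abs_of_nonpos (not_lt.1 hi)]
      change (fun i => f (fun i => decide (0 < x i)) i (x i)) ∈ mvbDelta d
      rw [h3]
      exact ⟨fun i => abs_pos.2 (h0 i), hx⟩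
  have hnull : volume (⋃ i, {x : Fin d → ℝ | x i = 0}) = 0 := by
    rw [measure_iUnion_null_iff]
    intro i
    rw [volume_pi]
    exact Measure.pi_hyperplane (fun _ => volume) i 0
  have h2 : volume {x : Fin d → ℝ | ∑ i, |x i| ^ (1 : ℝ) < 1} ≤ 2 ^ d * volume (mvbDelta d) := by
    calc _ ≤ _ := measure_mono hsub
      _ ≤ _ := measure_union_le _ _
      _ = volume (⋃ s, (fun (x : Fin d → ℝ) i => f s i (x i)) ⁻¹' mvbDelta d) := by
        rw [hnull, zero_add]
      _ ≤ ∑ s, volume ((fun (x : Fin d → ℝ) i => f s i (x i)) ⁻¹' mvbDelta d) :=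
        measure_iUnion_fintype_le _ _
      _ = ∑ s : Fin d → Bool, volume (mvbDelta d) := by
        apply Finset.sum_congr rfl
        intro s _
        exact (hf s).measure_preimage (mvbDelta_open d).measurableSet.nullMeasurableSet
      _ = 2 ^ d * volume (mvbDelta d) := by simp
  rw [hB] at h2
  have h3 : (2 * Real.Gamma (1 / 1 + 1)) ^ Fintype.card (Fin d) /
      Real.Gamma ((Fintype.card (Fin d) : ℝ) / 1 + 1) = 2 ^ d * (1 / (Nat.factorial d : ℝ)) := by
    have : Real.Gamma (1 / 1 + 1) = 1 := by norm_num [Real.Gamma_two]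
    rw [this]
    simp [Real.Gamma_nat_eq_factorial, div_eq_mul_inv]
  rw [h3, ENNReal.ofReal_mul (by positivity), ENNReal.ofReal_pow (by norm_num)] at h2
  have h4 : ENNReal.ofReal 2 = 2 := by simp
  rw [h4] at h2
  exact (ENNReal.mul_le_mul_iff_right (by simp) (by simp)).1 h2

theorem mvb_simplex_vol {d : ℕ} {A : Matrix (Fin (d + 1)) (Fin (d + 1)) ℤ} (h : A.det ≠ 0)
    (h1 : ∀ m, A m 0 = 1) :
    ENNReal.ofReal (|(A.det : ℝ)| / (Nat.factorial d : ℝ)) ≤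
      volume {x : Fin d → ℝ | ∀ m, 0 < mvbC A (mvbH x) m} := by
  let N : Matrix (Fin d) (Fin d) ℝ := fun i j => (A i.succ j.succ : ℝ) - A 0 j.succ
  have hN : N.det = A.det := by
    rw [← mvbR_det]
    let A' : Matrix (Fin (d + 1)) (Fin (d + 1)) ℝ :=
      Fin.cons (mvbR A 0) fun i => fun j => mvbR A i.succ j - mvbR A 0 j
    have e1 : A'.det = (mvbR A).det := by
      apply Matrix.det_eq_of_forall_row_eq_smul_add_const
        (Fin.cons 0 fun _ => -1 : Fin (d + 1) → ℝ) 0 (by simp)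
      intro i j
      refine Fin.cases ?_ (fun i => ?_) i
      · simp [A']
      · simp [A']; ring
    rw [← e1, Matrix.det_succ_column_zero, Fin.sum_univ_succ]
    simp [A', mvbR, h1]
    congr 1
  let v0 : Fin d → ℝ := fun j => (A 0 j.succ : ℝ)
  have hsub : (fun y => v0 + y) '' ((Matrix.toLin' Nᵀ) '' mvbDelta d) ⊆
      {x : Fin d → ℝ | ∀ m, 0 < mvbC A (mvbH x) m} := by
    rintro _ ⟨_, ⟨x, ⟨hx0, hx1⟩, rfl⟩, rfl⟩
    let c : Fin (d + 1) → ℝ := Fin.cons (1 - ∑ i, x i) x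
    have hc : mvbH (v0 + Matrix.toLin' Nᵀ x) = c ᵥ* mvbR A := by
      funext j
      refine Fin.cases ?_ (fun j => ?_) j
      · simp [mvbH, Matrix.vecMul, dotProduct, mvbR, h1, Fin.sum_univ_succ, c]
      · have hNT : ∀ i, Nᵀ j i = (A i.succ j.succ : ℝ) - A 0 j.succ := fun i => rfl
        have e2 : Matrix.toLin' Nᵀ x j = ∑ i, ((A i.succ j.succ : ℝ) - A 0 j.succ) * x i := by
          rw [Matrix.toLin'_apply]
          simp only [Matrix.mulVec, dotProduct, hNT]
        have e3 : (c ᵥ* mvbR A) j.succ =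
            (1 - ∑ i, x i) * A 0 j.succ + ∑ i, x i * (A i.succ j.succ : ℝ) := by
          simp [Matrix.vecMul, dotProduct, mvbR, Fin.sum_univ_succ, c]
        have e4 : mvbH (v0 + Matrix.toLin' Nᵀ x) j.succ = A 0 j.succ + Matrix.toLin' Nᵀ x j := by
          simp [mvbH, v0]
        rw [e3, e4, e2, sub_mul, one_mul, Finset.sum_mul]
        simp only [sub_mul, Finset.sum_sub_distrib]
        simp only [mul_comm]
        ring
    intro m
    show 0 < mvbC A (mvbH (v0 + Matrix.toLin' Nᵀ x)) m
    rw [hc, mvbC_uniq h]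
    refine Fin.cases ?_ (fun m => ?_) m
    · simpa [c] using hx1
    · simpa [c] using hx0 m
  refine le_trans ?_ (measure_mono hsub)
  rw [Set.image_add_left, measure_preimage_add, Measure.addHaar_image_linearMap,
    LinearMap.det_toLin', Matrix.det_transpose, hN, div_eq_mul_one_div,
    ENNReal.ofReal_mul (abs_nonneg _)]
  gcongr
  exact mvbDelta_vol d

theorem mvb_span {d : ℕ} (s : Set (Fin d → ℝ)) (hs : affineSpan ℝ s = ⊤) :
    Submodule.span ℝ (mvbH '' s) = ⊤ := by
  set Q := Submodule.span ℝ (mvbH '' s) with hQ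
  let T : AffineSubspace ℝ (Fin d → ℝ) :=
    { carrier := {x | mvbH x ∈ Q}
      smul_vsub_vadd_mem' := by
        intro c p1 p2 p3 h1 h2 h3
        have : mvbH (c • (p1 -ᵥ p2) +ᵥ p3) = c • (mvbH p1 - mvbH p2) + mvbH p3 := by
          funext k
          refine Fin.cases ?_ (fun k => ?_) k <;> simp [mvbH]
        show mvbH (c • (p1 -ᵥ p2) +ᵥ p3) ∈ Q
        rw [this]
        exact Q.add_mem (Q.smul_mem _ (Q.sub_mem h1 h2)) h3 }
  have hT : affineSpan ℝ s ≤ T := by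
    rw [affineSpan_le]
    intro x hx
    exact Submodule.subset_span ⟨x, hx, rfl⟩
  have hall : ∀ x, mvbH x ∈ Q := by
    intro x
    have : x ∈ affineSpan ℝ s := by rw [hs]; trivial
    exact hT this
  rw [eq_top_iff]
  intro y _
  have : y = mvbH (fun i => y i.succ) + (y 0 - 1) • mvbH 0 := by
    funext k
    refine Fin.cases ?_ (fun k => ?_) k <;> simp [mvbH]
  rw [this]
  exact Q.add_mem (hall _) (Q.smul_mem _ (hall _))

/-- cast of an integer point -/
def mvbI {d : ℕ} (v : Fin d → ℤ) : Fin d → ℝ := fun j => (v j : ℝ)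

theorem mvbI_inj {d : ℕ} : Function.Injective (mvbI (d := d)) := by
  intro a b h
  funext j
  have := congrFun h j
  simpa [mvbI] using this

theorem mvb_init {d : ℕ} (F : Finset (Fin d → ℤ))
    (hspan : affineSpan ℝ (mvbI '' (F : Set (Fin d → ℤ))) = ⊤) :
    ∃ D : ℝ, mvbCov d (convexHull ℝ (mvbI '' (F : Set (Fin d → ℤ)))) (mvbHZ '' F) 1 D ∧
      ENNReal.ofReal (D / (Nat.factorial d : ℝ)) ≤
        volume (convexHull ℝ (mvbI '' (F : Set (Fin d → ℤ)))) := by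
  classical
  set P := convexHull ℝ (mvbI '' (F : Set (Fin d → ℤ))) with hP
  let w : F → Fin (d + 1) → ℤ := fun v => mvbHZ v.1
  have hw : ∀ v, (fun i => (w v i : ℝ)) = mvbH (mvbI v.1) := fun v => mvbHZ_cast v.1
  have hw1 : ∀ a, w a 0 = 1 := fun a => by simp [w, mvbHZ]
  have hsp : Submodule.span ℝ (Set.range fun a => (fun i => (w a i : ℝ))) = ⊤ := by
    rw [← mvb_span _ hspan]
    congr 1
    ext y
    simp [hw]
  obtain ⟨ι, hι, A, hdet, hrow, hcov, hdisj⟩ := mvb_triang w hw1 hsp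
  have hrow1 : ∀ i m, A i m 0 = 1 := by
    intro i m
    obtain ⟨a, ha⟩ := hrow i m
    rw [← ha]; exact hw1 a
  have hcov' : ∀ x ∈ P, ∃ i, ∀ m, 0 ≤ mvbC (A i) (mvbH x) m := by
    intro x hx
    rw [hP, ← Finset.coe_image, Finset.mem_convexHull'] at hx
    obtain ⟨c, hc0, hc1, hcx⟩ := hx
    rw [Finset.sum_image (fun a _ b _ h => mvbI_inj h)] at hc1 hcx
    have := hcov (fun v => c (mvbI v.1)) (fun v => hc0 _ (Finset.mem_image_of_mem _ v.2))
    have e : ∑ k : F, c (mvbI k.1) • (fun j => (w k j : ℝ)) = mvbH x := by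
      simp only [hw]
      rw [Finset.sum_coe_sort F (fun k => c (mvbI k) • mvbH (mvbI k))]
      funext j
      refine Fin.cases ?_ (fun j => ?_) j
      · simpa [mvbH] using hc1
      · rw [← hcx]; simp [mvbH]
    rw [e] at this
    exact this
  have hne : P.Nonempty := by
    rw [hP, convexHull_nonempty_iff]
    by_contra hn
    rw [Set.not_nonempty_iff_eq_empty] at hn
    rw [hn, AffineSubspace.span_empty] at hspan
    exact AffineSubspace.bot_ne_top ℝ _ _ hspan
  refine ⟨∑ i, |((A i).det : ℝ)|, ⟨ι, hι, A, hdet, ?_, hcov', rfl, ?_⟩, ?_⟩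
  · intro i m
    obtain ⟨a, ha⟩ := hrow i m
    exact ⟨a.1, a.2, ha⟩
  · obtain ⟨x, hx⟩ := hne
    obtain ⟨i, _⟩ := hcov' x hx
    exact Fintype.card_pos_iff.2 ⟨i⟩
  · let O : ι → Set (Fin d → ℝ) := fun i => {x | ∀ m, 0 < mvbC (A i) (mvbH x) m}
    have hOm : ∀ i, MeasurableSet (O i) := by
      intro i
      apply IsOpen.measurableSet
      have : O i = ⋂ m, {x | 0 < mvbC (A i) (mvbH x) m} := by ext; simp [O]
      rw [this]
      apply isOpen_iInter_of_finite
      intro m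
      have hc : Continuous (mvbH (d := d)) := by
        apply continuous_pi
        intro k
        refine Fin.cases ?_ (fun k => ?_) k
        · simpa [mvbH] using continuous_const
        · simpa [mvbH] using continuous_apply k
      exact isOpen_lt continuous_const ((mvbC_cont (A i) m).comp hc)
    have hOP : ∀ i, O i ⊆ P := by
      intro i x hx
      have h1 : ∑ m, mvbC (A i) (mvbH x) m = 1 := by
        rw [mvbC_sum (hdet i) (hrow1 i)]; simp [mvbH]
      choose a ha using hrow i
      have h2 : x = ∑ m, mvbC (A i) (mvbH x) m • mvbI (a m).1 := by
        have h3 := mvbC_spec (hdet i) (mvbH x)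
        funext j
        have h4 := congrFun h3 j.succ
        simp only [Matrix.vecMul, dotProduct, mvbR, Matrix.map_apply, ← ha] at h4
        simp only [Finset.sum_apply, Pi.smul_apply, smul_eq_mul]
        have e1 : mvbH x j.succ = x j := by simp [mvbH]
        rw [← e1, ← h4]
        apply Finset.sum_congr rfl
        intro m _
        simp [w, mvbHZ, mvbI]
      rw [h2]
      exact (convex_convexHull ℝ _).sum_mem (fun m _ => (hx m).le) h1
        (fun m _ => subset_convexHull ℝ _ ⟨(a m).1, (a m).2, rfl⟩)
    have hOd : Pairwise (Function.onFun Disjoint O) := by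
      intro i j hij
      rw [Function.onFun, Set.disjoint_left]
      intro x hx hx'
      exact hij (hdisj i j _ hx hx')
    calc ENNReal.ofReal ((∑ i, |((A i).det : ℝ)|) / (Nat.factorial d : ℝ))
        = ∑ i, ENNReal.ofReal (|((A i).det : ℝ)| / (Nat.factorial d : ℝ)) := by
          rw [Finset.sum_div, ENNReal.ofReal_sum_of_nonneg]
          intro i _; positivity
      _ ≤ ∑ i, volume (O i) := Finset.sum_le_sum fun i _ => mvb_simplex_vol (hdet i) (hrow1 i)
      _ = volume (⋃ i, O i) := by rw [measure_iUnion hOd hOm, tsum_fintype]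
      _ ≤ volume P := measure_mono (Set.iUnion_subset hOP)

theorem mvb_insert_all {d : ℕ} (P : Set (Fin d → ℝ)) (F : Finset (Fin d → ℤ)) (D : ℝ)
    (hF : ∀ v ∈ F, mvbI v ∉ interior P)
    (h : mvbCov d P (mvbHZ '' F) 1 D) (T : Finset (Fin d → ℤ))
    (hT : ∀ v ∈ T, mvbI v ∈ interior P) :
    mvbCov d P (mvbHZ '' (F ∪ T : Set (Fin d → ℤ))) (d * T.card + 1) D := by
  classical
  induction T using Finset.induction_on with
  | empty => simpa using h
  | insert a T ha ih =>
    have h1 := ih (fun v hv => hT v (Finset.mem_insert_of_mem hv))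
    have h2 := mvb_insert d P _ _ D (by rintro _ ⟨v, _, rfl⟩; simp [mvbHZ]) h1 a
      (hT a (Finset.mem_insert_self _ _)) (by
        rintro ⟨v, hv, hva⟩
        have : v = a := by
          unfold mvbHZ at hva
          exact Fin.cons_right_injective (α := fun _ => ℤ) _ hva
        subst this
        rcases hv with hv | hv
        · exact hF v hv (hT v (Finset.mem_insert_self _ _))
        · exact ha hv)
    rw [Finset.card_insert_of_notMem ha]
    have e1 : d * (T.card + 1) + 1 = d * T.card + 1 + d := by ring
    have e2 : (F ∪ (insert a T : Finset (Fin d → ℤ)) : Set (Fin d → ℤ)) =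
        insert a (F ∪ T : Set (Fin d → ℤ)) := by
      ext; simp
    rw [e1, e2, Set.image_insert_eq]
    exact h2

/-- For a lattice `d`-polytope (`d ≥ 1`) with exactly `k` interior lattice
points, `Vol(P) ≥ (dk + 1)/d!`. -/
theorem minimal_volume_bound (d k : ℕ) (hd : 1 ≤ d) (P : Set (Fin d → ℝ))
    (hP : IsLatticePolytope d P)
    (hk : {x ∈ interior P | IsLatticePt d x}.ncard = k) :
    ((d * k + 1 : ℕ) : ℝ≥0∞) / (Nat.factorial d : ℝ≥0∞) ≤ volume P := by
  classical
  obtain ⟨F, hspan, hPF⟩ := hP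
  change affineSpan ℝ (mvbI '' (F : Set (Fin d → ℤ))) = ⊤ at hspan
  change P = convexHull ℝ (mvbI '' (F : Set (Fin d → ℤ))) at hPF
  have hfin : (mvbI '' (F : Set (Fin d → ℤ))).Finite := F.finite_toSet.image _
  have hPc : IsCompact P := by rw [hPF]; exact hfin.isCompact_convexHull ℝ
  have hPconv : Convex ℝ P := by rw [hPF]; exact convex_convexHull ℝ _
  let F' : Finset (Fin d → ℤ) := F.filter fun v => mvbI v ∈ Set.extremePoints ℝ P
  have hF' : mvbI '' (F' : Set (Fin d → ℤ)) = Set.extremePoints ℝ P := by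
    ext x
    constructor
    · rintro ⟨v, hv, rfl⟩
      exact (Finset.mem_filter.1 hv).2
    · intro hx
      have h1 : x ∈ mvbI '' (F : Set (Fin d → ℤ)) := by
        rw [hPF] at hx
        exact extremePoints_convexHull_subset hx
      obtain ⟨v, hv, rfl⟩ := h1
      exact ⟨v, Finset.mem_filter.2 ⟨hv, hx⟩, rfl⟩
  have hP' : convexHull ℝ (mvbI '' (F' : Set (Fin d → ℤ))) = P := by
    have h1 := closure_convexHull_extremePoints hPc hPconv
    rw [← hF', ((F'.finite_toSet.image mvbI).isClosed_convexHull ℝ).closure_eq] at h1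
    exact h1
  have hspan' : affineSpan ℝ (mvbI '' (F' : Set (Fin d → ℤ))) = ⊤ := by
    rw [← affineSpan_convexHull, hP', hPF, affineSpan_convexHull, hspan]
  obtain ⟨D, hcov, hvol⟩ := mvb_init F' hspan'
  rw [hP'] at hcov hvol
  have : Nontrivial (Fin d → ℝ) := by
    have : Nonempty (Fin d) := ⟨⟨0, hd⟩⟩
    infer_instance
  have hFint : ∀ v ∈ F', mvbI v ∉ interior P := fun v hv hi =>
    Set.disjoint_left.1 (disjoint_interior_extremePoints P) hi (Finset.mem_filter.1 hv).2
  have hT : ∃ T : Finset (Fin d → ℤ), (∀ v ∈ T, mvbI v ∈ interior P) ∧ T.card = k := by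
    by_cases hk0 : k = 0
    · exact ⟨∅, by simp, by simp [hk0]⟩
    · have hXf : {x ∈ interior P | IsLatticePt d x}.Finite :=
        Set.finite_of_ncard_ne_zero (by rw [hk]; exact hk0)
      have hcast : ∀ x, IsLatticePt d x → mvbI (fun i => ⌊x i⌋) = x := by
        intro x hx
        funext i
        obtain ⟨z, hz⟩ := hx i
        simp [mvbI, hz]
      refine ⟨hXf.toFinset.image fun x i => ⌊x i⌋, ?_, ?_⟩
      · intro v hv
        obtain ⟨x, hx, rfl⟩ := Finset.mem_image.1 hv
        rw [Set.Finite.mem_toFinset] at hx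
        rw [hcast x hx.2]
        exact hx.1
      · rw [Finset.card_image_of_injOn, ← Set.ncard_eq_toFinset_card _ hXf, hk]
        intro x hx y hy hxy
        have hx' := (hXf.mem_toFinset.1 hx).2
        have hy' := (hXf.mem_toFinset.1 hy).2
        rw [← hcast x hx', ← hcast y hy']
        exact congrArg mvbI hxy
  obtain ⟨T, hTint, hTcard⟩ := hT
  obtain ⟨ι, _, A, hdet, -, -, hsum, hN⟩ := mvb_insert_all P F' D hFint hcov T hTint
  rw [hTcard] at hN
  have hD : ((d * k + 1 : ℕ) : ℝ) ≤ D := by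
    have h1 : (Fintype.card ι : ℝ) ≤ D := by
      rw [← hsum]
      have : (Fintype.card ι : ℝ) = ∑ _i : ι, (1 : ℝ) := by simp
      rw [this]
      apply Finset.sum_le_sum
      intro i _
      exact_mod_cast Int.one_le_abs (hdet i)
    exact le_trans (by exact_mod_cast hN) h1
  refine le_trans ?_ hvol
  have hfac : (0 : ℝ) < Nat.factorial d := by exact_mod_cast Nat.factorial_pos d
  rw [ENNReal.ofReal_div_of_pos hfac, ENNReal.ofReal_natCast]
  gcongr
  rw [← ENNReal.ofReal_natCast]
  exact ENNReal.ofReal_le_ofReal hD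
end
end

section
/- Let d ≥ 3, k ≥ 1, and let T ⊂ ℝ^d be a clean lattice d-simplex whose interior contains exactly k lattice points. Then Vol(T) = (dk + 1)/d! if and only if T is unimodularly equivalent to S_d(k). -/
open MeasureTheory Set
open scoped ENNReal

noncomputable section

theorem scherk {G : Type*} [AddCommGroup G] [DecidableEq G] (m : ℕ) :
    ∀ (X Y : Finset G), Y.card ≤ m → (0:G) ∈ X → (0:G) ∈ Y →
    (∀ x ∈ X, ∀ y ∈ Y, x + y = 0 → x = 0) →
    X.card + Y.card ≤ (Finset.image₂ (· + ·) X Y).card + 1 := by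
  induction m with
  | zero =>
    intro X Y hm hX hY _
    have := Finset.card_pos.2 ⟨0, hY⟩
    omega
  | succ m ih =>
    intro X Y hm hX hY h
    by_cases hY0 : ∃ y ∈ Y, y ≠ 0
    · obtain ⟨y, hy, hy0⟩ := hY0
      have hex : ∃ x ∈ X, x + y ∉ X := by
        by_contra hcon
        push Not at hcon
        have hsub : X.image (· + y) ⊆ X := by
          intro z hz
          obtain ⟨x, hx, rfl⟩ := Finset.mem_image.1 hz
          exact hcon x hx
        have heq : X.image (· + y) = X :=
          Finset.eq_of_subset_of_card_le hsub
            (by rw [Finset.card_image_of_injective _ (add_left_injective y)])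
        rw [← heq] at hX
        obtain ⟨x, hx, hxy⟩ := Finset.mem_image.1 hX
        have h0 := h x hx y hy hxy
        subst h0
        simp at hxy
        exact hy0 hxy
      obtain ⟨x, hx, hxy⟩ := hex
      let X' := X ∪ Y.image (· + x)
      let Y' := Y.filter (fun z => z + x ∈ X)
      have hcard : X'.card + Y'.card = X.card + Y.card := by
        have h1 : Y'.card = (X ∩ Y.image (· + x)).card := by
          rw [← Finset.card_image_of_injective Y' (add_left_injective x)]
          congr 1
          ext z
          simp only [Y', Finset.mem_image, Finset.mem_filter, Finset.mem_inter]
          constructor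
          · rintro ⟨a, ⟨ha, hb⟩, rfl⟩; exact ⟨hb, a, ha, rfl⟩
          · rintro ⟨hb, a, ha, rfl⟩; exact ⟨a, ⟨ha, hb⟩, rfl⟩
        rw [h1, Finset.card_union_add_card_inter,
          Finset.card_image_of_injective Y (add_left_injective x)]
      have hlt : Y'.card < Y.card := by
        apply Finset.card_lt_card
        refine Finset.filter_ssubset.2 ⟨y, hy, ?_⟩
        rwa [add_comm]
      have hsub : Finset.image₂ (· + ·) X' Y' ⊆ Finset.image₂ (· + ·) X Y := by
        intro z hz
        obtain ⟨a, ha, b, hb, rfl⟩ := Finset.mem_image₂.1 hz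
        obtain ⟨hb1, hb2⟩ := Finset.mem_filter.1 hb
        rcases Finset.mem_union.1 ha with ha | ha
        · exact Finset.mem_image₂.2 ⟨a, ha, b, hb1, rfl⟩
        · obtain ⟨c, hc, rfl⟩ := Finset.mem_image.1 ha
          exact Finset.mem_image₂.2 ⟨b + x, hb2, c, hc, by abel⟩
      have := ih X' Y' (by omega) (Finset.mem_union_left _ hX)
        (Finset.mem_filter.2 ⟨hY, by simpa using hx⟩) (by
          intro a ha b hb hab
          obtain ⟨hb1, hb2⟩ := Finset.mem_filter.1 hb
          rcases Finset.mem_union.1 ha with ha | ha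
          · exact h a ha b hb1 hab
          · obtain ⟨c, hc, rfl⟩ := Finset.mem_image.1 ha
            have h0 := h (b + x) hb2 c hc (by rw [← hab]; abel)
            have hc0 : c = 0 := by
              have : c + (b + x) = 0 := by rw [← hab]; abel
              rw [h0] at this; simpa using this
            subst hc0
            simpa using h x hx b hb1 (by rw [add_comm]; exact h0))
      have := Finset.card_le_card hsub
      omega
    · push Not at hY0
      have hYe : Y = {0} := by
        ext z; simp only [Finset.mem_singleton]
        exact ⟨hY0 z, fun h => h ▸ hY⟩
      subst hYe
      simp [Finset.image₂_singleton_right]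

structure Sys {G ι : Type*} [AddCommGroup G] [Fintype ι] (N : ℤ) (c : ι → G → ℤ) : Prop where
  pos : 0 < N
  nonneg : ∀ j g, 0 ≤ c j g
  lt : ∀ j g, c j g < N
  add : ∀ j g g', N ∣ c j (g + g') - (c j g + c j g')
  sum : ∀ g, N ∣ ∑ j, c j g
  inj : ∀ g, (∀ j, c j g = 0) → g = 0

namespace Sys
variable {G ι : Type*} [AddCommGroup G] [Fintype ι] {N : ℤ} {c : ι → G → ℤ}

theorem eq_of_modEq (S : Sys N c) {j g} {z : ℤ} (h0 : 0 ≤ z) (h1 : z < N) (h : N ∣ c j g - z) :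
    c j g = z := by
  obtain ⟨w, hw⟩ := h
  have a := S.nonneg j g
  have b := S.lt j g
  have : w < 1 := by by_contra hh; nlinarith [S.pos]
  have : -1 < w := by by_contra hh; nlinarith [S.pos]
  have : w = 0 := by omega
  subst this; linarith

theorem zero (S : Sys N c) (j) : c j 0 = 0 := by
  apply S.eq_of_modEq le_rfl S.pos
  have := S.add j 0 0
  simp at this
  simpa using this

/-- the height -/
def ht (N : ℤ) (c : ι → G → ℤ) (g : G) : ℤ := (∑ j, c j g) / N

theorem ht_mul (S : Sys N c) (g : G) : ∑ j, c j g = N * ht N c g :=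
  (Int.mul_ediv_cancel' (S.sum g)).symm

theorem ht_eq (S : Sys N c) {g : G} {m : ℤ} (h : ∑ j, c j g = N * m) : ht N c g = m := by
  have := S.ht_mul g
  rw [h] at this
  exact (mul_left_cancel₀ S.pos.ne' this).symm

theorem ht_nonneg (S : Sys N c) (g : G) : 0 ≤ ht N c g := by
  have h := S.ht_mul g
  have : 0 ≤ ∑ j, c j g := Finset.sum_nonneg (fun j _ => S.nonneg j g)
  by_contra hh; nlinarith [S.pos]

theorem ht_zero (S : Sys N c) : ht N c (0 : G) = 0 :=
  S.ht_eq (by simp [S.zero])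

theorem eq_zero_of_ht (S : Sys N c) {g : G} (h : ht N c g ≤ 0) : g = 0 := by
  have h1 := S.ht_mul g
  have h2 := S.ht_nonneg g
  have h3 : ht N c g = 0 := le_antisymm h h2
  rw [h3, mul_zero] at h1
  apply S.inj
  intro j
  exact (Finset.sum_eq_zero_iff_of_nonneg (fun j _ => S.nonneg j g)).1 h1 j (Finset.mem_univ j)

theorem add_le (S : Sys N c) (j) (g g' : G) : c j (g + g') ≤ c j g + c j g' := by
  obtain ⟨w, hw⟩ := S.add j g g'
  have a := S.lt j (g + g')
  have b := S.nonneg j g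
  have b' := S.nonneg j g'
  have : w < 1 := by by_contra hh; nlinarith [S.pos]
  nlinarith [S.pos]

theorem ht_add_le (S : Sys N c) (g g' : G) : ht N c (g + g') ≤ ht N c g + ht N c g' := by
  have h1 := S.ht_mul g
  have h2 := S.ht_mul g'
  have h3 := S.ht_mul (g + g')
  have : ∑ j, c j (g + g') ≤ ∑ j, c j g + ∑ j, c j g' := by
    rw [← Finset.sum_add_distrib]
    exact Finset.sum_le_sum (fun j _ => S.add_le j g g')
  by_contra hh; nlinarith [S.pos]

theorem add_eq (S : Sys N c) {g g' : G} (h : ht N c (g + g') = ht N c g + ht N c g') (j) :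
    c j (g + g') = c j g + c j g' := by
  have h1 := S.ht_mul g
  have h2 := S.ht_mul g'
  have h3 := S.ht_mul (g + g')
  have h4 : ∑ j, c j (g + g') = ∑ j, (c j g + c j g') := by
    rw [Finset.sum_add_distrib, h1, h2, h3, h]; ring
  exact (Finset.sum_eq_sum_iff_of_le (fun j _ => S.add_le j g g')).1 h4 j (Finset.mem_univ j)

theorem neg_eq (S : Sys N c) {g : G} (j) (h : c j g ≠ 0) : c j (-g) = N - c j g := by
  have a := S.nonneg j g
  have b := S.lt j g
  apply S.eq_of_modEq (by linarith) (by omega)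
  obtain ⟨w, hw⟩ := S.add j (-g) g
  rw [neg_add_cancel, S.zero] at hw
  exact ⟨-w - 1, by linarith⟩

theorem neg_eq0 (S : Sys N c) {g : G} (j) (h : c j g = 0) : c j (-g) = 0 := by
  apply S.eq_of_modEq le_rfl S.pos
  obtain ⟨w, hw⟩ := S.add j (-g) g
  rw [neg_add_cancel, S.zero, h] at hw
  exact ⟨-w, by linarith⟩

/-- support size -/
def supp (c : ι → G → ℤ) (g : G) : ℕ := (Finset.univ.filter (fun j => c j g ≠ 0)).card

theorem supp_le (g : G) : supp c g ≤ Fintype.card ι := Finset.card_le_univ _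

theorem ht_neg (S : Sys N c) (g : G) : ht N c (-g) = supp c g - ht N c g := by
  apply S.ht_eq
  have h1 := S.ht_mul g
  have : ∀ j, c j (-g) = (if c j g ≠ 0 then N else 0) - c j g := by
    intro j
    split_ifs with h
    · exact S.neg_eq j h
    · push Not at h
      rw [S.neg_eq0 j h, h]; simp
  simp_rw [this]
  rw [Finset.sum_sub_distrib, h1, ← Finset.sum_filter]
  simp [supp]; ring

theorem ht_lt (S : Sys N c) (g : G) (hι : 0 < Fintype.card ι) : ht N c g < Fintype.card ι := by
  have h1 := S.ht_mul g
  have : ∑ j, c j g < ∑ j : ι, N := by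
    apply Finset.sum_lt_sum_of_nonempty
    · exact Finset.card_pos.1 hι
    · intro j _; exact S.lt j g
  simp at this
  by_contra hh; push Not at hh; nlinarith [S.pos]

open Classical in
theorem level [Fintype G] (S : Sys N c) (j : ℕ) :
    (Finset.univ.filter (fun g : G => ht N c g ≤ j)).card +
      (Finset.univ.filter (fun a : G => ht N c a = 1 ∧ j + 2 ≤ supp c a)).card ≤
    (Finset.image₂ (· + ·) (Finset.univ.filter (fun g : G => ht N c g ≤ j))
      (insert 0 (Finset.univ.filter (fun a : G => ht N c a = 1 ∧ j + 2 ≤ supp c a)))).card := by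
  have := scherk _ (Finset.univ.filter (fun g : G => ht N c g ≤ j))
    (insert 0 (Finset.univ.filter (fun a : G => ht N c a = 1 ∧ j + 2 ≤ supp c a))) le_rfl
    (by simp [S.ht_zero]) (by simp) (by
      intro x hx y hy hxy
      rcases Finset.mem_insert.1 hy with rfl | hy
      · simpa using hxy
      · exfalso
        simp only [Finset.mem_filter, Finset.mem_univ, true_and] at hx hy
        have hx' : x = -y := eq_neg_of_add_eq_zero_left hxy
        have := S.ht_neg y
        rw [← hx', hy.1] at this
        have h2 : ((j + 2 : ℕ) : ℤ) ≤ supp c y := by exact_mod_cast hy.2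
        push_cast at h2
        linarith)
  rw [Finset.card_insert_of_notMem (by simp [S.ht_zero])] at this
  omega

open Classical in
theorem level_sub [Fintype G] (S : Sys N c) (j : ℕ) :
    (Finset.image₂ (· + ·) (Finset.univ.filter (fun g : G => ht N c g ≤ j))
      (insert 0 (Finset.univ.filter (fun a : G => ht N c a = 1 ∧ j + 2 ≤ supp c a)))) ⊆
    (Finset.univ.filter (fun g : G => ht N c g ≤ (j + 1 : ℕ))) := by
  intro z hz
  obtain ⟨a, ha, b, hb, rfl⟩ := Finset.mem_image₂.1 hz
  simp only [Finset.mem_filter, Finset.mem_univ, true_and, Finset.mem_insert] at *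
  have := S.ht_add_le a b
  push_cast
  rcases hb with rfl | hb
  · simp; linarith
  · linarith [hb.1]

open Classical in
theorem weighted [Fintype G] (S : Sys N c) :
    1 + ∑ a ∈ Finset.univ.filter (fun a : G => ht N c a = 1), (supp c a - 1) ≤ Fintype.card G := by
  have key : ∀ m : ℕ, 1 + ∑ i ∈ Finset.range m,
      (Finset.univ.filter (fun a : G => ht N c a = 1 ∧ i + 2 ≤ supp c a)).card ≤
      (Finset.univ.filter (fun g : G => ht N c g ≤ m)).card := by
    intro m
    induction m with
    | zero =>
      simp only [Finset.range_zero, Finset.sum_empty, add_zero]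
      exact Finset.card_pos.2 ⟨0, by simp [S.ht_zero]⟩
    | succ m ih =>
      rw [Finset.sum_range_succ]
      have h1 := S.level m
      have h2 := Finset.card_le_card (S.level_sub m)
      omega
  have h := (key (Fintype.card ι)).trans (Finset.card_le_univ _)
  refine le_trans (le_of_eq ?_) h
  congr 1
  have : ∀ i, (Finset.univ.filter (fun a : G => ht N c a = 1 ∧ i + 2 ≤ supp c a)).card =
      ∑ a ∈ Finset.univ.filter (fun a : G => ht N c a = 1), if i + 2 ≤ supp c a then 1 else 0 := by
    intro i
    rw [← Finset.filter_filter, Finset.card_filter]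
  simp_rw [this]
  rw [Finset.sum_comm]
  apply Finset.sum_congr rfl
  intro a _
  rw [← Finset.card_filter]
  have : (Finset.range (Fintype.card ι)).filter (fun i => i + 2 ≤ supp c a) =
    Finset.range (supp c a - 1) := by
    ext i
    have := supp_le (c := c) a
    simp; omega
  rw [this, Finset.card_range]

end Sys


structure Ex {G ι : Type*} [AddCommGroup G] [Fintype G] [Fintype ι] (d k : ℕ) (n : ℤ)
    (c : ι → G → ℤ) : Prop where
  S : Sys n c
  hn : n = d * k + 1
  hd : 3 ≤ d
  hk : 1 ≤ k
  cι : Fintype.card ι = d + 1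
  cG : Fintype.card G = d * k + 1
  full : ∀ a, Sys.ht n c a = 1 → ∀ j, c j a ≠ 0
  cA : (Finset.univ.filter (fun a => Sys.ht n c a = 1)).card = k

namespace Ex
open Sys
variable {G ι : Type*} [AddCommGroup G] [Fintype G] [Fintype ι] {d k : ℕ} {n : ℤ} {c : ι → G → ℤ}

theorem supp_full (E : Ex d k n c) {a : G} (h : ht n c a = 1) : supp c a = d + 1 := by
  rw [← E.cι, supp, ← Finset.card_univ]
  congr 1
  ext j; simp [E.full a h j]

theorem ht_le (E : Ex d k n c) (a : G) : ht n c a ≤ d := by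
  have := E.S.ht_lt a (by rw [E.cι]; omega)
  rw [E.cι] at this; push_cast at this; linarith

theorem step (E : Ex d k n c) (j : ℕ) (hj : j + 1 ≤ d) :
    (Finset.univ.filter (fun g : G => ht n c g ≤ j)).card + k ≤
    (Finset.univ.filter (fun g : G => ht n c g ≤ (j + 1 : ℕ))).card := by
  classical
  have h1 := E.S.level j
  have h2 := Finset.card_le_card (E.S.level_sub j)
  have : (Finset.univ.filter (fun a : G => ht n c a = 1 ∧ j + 2 ≤ supp c a)) =
    Finset.univ.filter (fun a : G => ht n c a = 1) := by
    ext a; simp only [Finset.mem_filter, Finset.mem_univ, true_and, and_iff_left_iff_imp]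
    intro h; rw [E.supp_full h]; omega
  rw [this, E.cA] at h1
  rw [this] at h2
  exact h1.trans h2

theorem cnt_ge (E : Ex d k n c) (j : ℕ) : ∀ i, i + j ≤ d →
    (Finset.univ.filter (fun g : G => ht n c g ≤ i)).card + j * k ≤
    (Finset.univ.filter (fun g : G => ht n c g ≤ (i + j : ℕ))).card := by
  induction j with
  | zero => intro i _; simp
  | succ j ih =>
    intro i hi
    have h1 := ih i (by omega)
    have h2 := E.step (i + j) (by omega)
    rw [show i + (j + 1) = i + j + 1 by ring]
    nlinarith

theorem cnt (E : Ex d k n c) (i : ℕ) (hi : i ≤ d) :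
    (Finset.univ.filter (fun g : G => ht n c g ≤ i)).card = 1 + i * k := by
  have h1 := E.cnt_ge i 0 (by omega)
  have h2 := E.cnt_ge (d - i) i (by omega)
  have h3 : 1 ≤ (Finset.univ.filter (fun g : G => ht n c g ≤ (0 : ℕ))).card :=
    Finset.card_pos.2 ⟨0, by simp [E.S.ht_zero]⟩
  have h4 : (Finset.univ.filter (fun g : G => ht n c g ≤ (i + (d - i) : ℕ))).card ≤ d * k + 1 := by
    rw [← E.cG]; exact Finset.card_le_univ _
  rw [zero_add] at h1
  obtain ⟨e, rfl⟩ := Nat.exists_eq_add_of_le hi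
  simp only [Nat.add_sub_cancel_left] at *
  nlinarith

theorem idp (E : Ex d k n c) (g : G) (j : ℕ) (h : ht n c g = j + 1) :
    ∃ x a, ht n c x = j ∧ ht n c a = 1 ∧ g = x + a := by
  classical
  have hj : j + 1 ≤ d := by have := E.ht_le g; rw [h] at this; exact_mod_cast this
  have h1 := E.S.level j
  have h2 := Finset.eq_of_subset_of_card_le (E.S.level_sub j) (by
    rw [E.cnt (j+1) hj]
    refine le_trans (le_of_eq ?_) h1
    rw [E.cnt j (by omega)]
    have : (Finset.univ.filter (fun a : G => ht n c a = 1 ∧ j + 2 ≤ supp c a)) =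
      Finset.univ.filter (fun a : G => ht n c a = 1) := by
      ext a; simp only [Finset.mem_filter, Finset.mem_univ, true_and, and_iff_left_iff_imp]
      intro h; rw [E.supp_full h]; omega
    rw [this, E.cA]; ring)
  have hg : g ∈ (Finset.univ.filter (fun g : G => ht n c g ≤ (j + 1 : ℕ))) := by
    simp [h]
  rw [← h2] at hg
  obtain ⟨x, hx, a, ha, rfl⟩ := Finset.mem_image₂.1 hg
  simp only [Finset.mem_filter, Finset.mem_univ, true_and, Finset.mem_insert] at hx ha
  rcases ha with rfl | ha
  · simp at h; omega
  · have := E.S.ht_add_le x a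
    exact ⟨x, a, by omega, ha.1, rfl⟩

theorem pos (E : Ex d k n c) {g : G} (h : g ≠ 0) (j) : 0 < c j g := by
  have h0 : 0 < ht n c g := by
    by_contra hh; exact h (E.S.eq_zero_of_ht (not_lt.1 hh))
  obtain ⟨m, hm⟩ := Int.eq_ofNat_of_zero_le (show 0 ≤ ht n c g - 1 by omega)
  obtain ⟨x, a, hx, ha, rfl⟩ := E.idp g m (by omega)
  rw [E.S.add_eq (by omega)]
  have := E.S.nonneg j x
  have := E.S.nonneg j a
  have := E.full a ha j
  omega

theorem ne_zero (E : Ex d k n c) {g : G} (h : ht n c g = 1) : g ≠ 0 := by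
  rintro rfl; rw [E.S.ht_zero] at h; omega

theorem cinj (E : Ex d k n c) {g g' : G} (j) (h : c j g = c j g') : g = g' := by
  by_contra hne
  have h1 := E.pos (sub_ne_zero.2 hne) j
  have h2 : c j (g - g') = 0 := by
    apply E.S.eq_of_modEq le_rfl E.S.pos
    obtain ⟨w, hw⟩ := E.S.add j (g - g') g'
    rw [sub_add_cancel] at hw
    exact ⟨-w, by linarith⟩
  omega

theorem csurj (E : Ex d k n c) (j) (z : ℤ) (h0 : 0 ≤ z) (h1 : z < n) : ∃ g, c j g = z := by
  classical
  have : Finset.univ.image (c j) = Finset.Ico 0 n := by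
    apply Finset.eq_of_subset_of_card_le
    · intro z hz
      obtain ⟨g, _, rfl⟩ := Finset.mem_image.1 hz
      exact Finset.mem_Ico.2 ⟨E.S.nonneg j g, E.S.lt j g⟩
    · rw [Finset.card_image_of_injective _ (fun a b h => E.cinj j h), Finset.card_univ, E.cG,
        Int.card_Ico, E.hn]
      omega
  have hz : z ∈ Finset.univ.image (c j) := by rw [this]; exact Finset.mem_Ico.2 ⟨h0, h1⟩
  obtain ⟨g, _, rfl⟩ := Finset.mem_image.1 hz
  exact ⟨g, rfl⟩

theorem neg (E : Ex d k n c) {g : G} (h : g ≠ 0) (j) : c j (-g) = n - c j g :=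
  E.S.neg_eq j (E.pos h j).ne'

theorem htneg (E : Ex d k n c) {g : G} (h : g ≠ 0) : ht n c (-g) = d + 1 - ht n c g := by
  rw [E.S.ht_neg]
  have : supp c g = d + 1 := by
    rw [← E.cι, supp, ← Finset.card_univ]
    congr 1
    ext j; simp [(E.pos h j).ne']
  rw [this]; push_cast; ring

/-- multiples -/
theorem smul_mod (E : Ex d k n c) (j) (m : ℕ) (g : G) : n ∣ c j (m • g) - m * c j g := by
  induction m with
  | zero => simp [E.S.zero]
  | succ m ih =>
    rw [succ_nsmul]
    obtain ⟨w, hw⟩ := E.S.add j (m • g) g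
    obtain ⟨w', hw'⟩ := ih
    exact ⟨w + w', by push_cast; linarith⟩

end Ex


namespace Ex
open Sys
variable {G ι : Type*} [AddCommGroup G] [Fintype G] [Fintype ι] {d k : ℕ} {n : ℤ} {c : ι → G → ℤ}

/-- argmin of the ratios -/
def I (c : ι → G → ℤ) (y x : G) : Finset ι :=
  Finset.univ.filter (fun i => ∀ j, c i y * c j x ≤ c j y * c i x)

theorem mem_I {y x : G} {i : ι} : i ∈ I c y x ↔ ∀ j, c i y * c j x ≤ c j y * c i x := by
  simp [I]

theorem sumA (E : Ex d k n c) {x : G} (h : ht n c x = 1) : ∑ j, c j x = n := by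
  rw [E.S.ht_mul, h, mul_one]

theorem ratio (E : Ex d k n c) {x : G} (hx : ht n c x = 1) {y : G} {i : ι} (hi : i ∈ I c y x) (j : ι) :
    j ∈ I c y x ↔ c j y * c i x = c i y * c j x := by
  have pi := E.pos (E.ne_zero hx) i
  have pj := E.pos (E.ne_zero hx) j
  rw [mem_I] at hi ⊢
  constructor
  · intro h
    have := hi j
    have := h i
    linarith
  · intro h l
    have := hi l
    have pl := E.pos (E.ne_zero hx) l
    refine le_of_mul_le_mul_right ?_ pi
    calc c j y * c l x * c i x = (c i y * c l x) * c j x := by linear_combination c l x * h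
      _ ≤ (c l y * c i x) * c j x := mul_le_mul_of_nonneg_right this pj.le
      _ = _ := by ring

theorem I_le (E : Ex d k n c) {x y : G} (hx : ht n c x = 1) (hy : ht n c y = 1) {i : ι}
    (hi : i ∈ I c y x) : c i y ≤ c i x := by
  have h1 := E.sumA hx
  have h2 := E.sumA hy
  rw [mem_I] at hi
  have : ∑ j, c i y * c j x ≤ ∑ j, c j y * c i x := Finset.sum_le_sum (fun j _ => hi j)
  rw [← Finset.mul_sum, ← Finset.sum_mul, h1, h2] at this
  nlinarith [E.S.pos]

theorem I_lt (E : Ex d k n c) {x y : G} (hx : ht n c x = 1) (hy : ht n c y = 1) (hne : y ≠ x) {i : ι}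
    (hi : i ∈ I c y x) : c i y < c i x :=
  lt_of_le_of_ne (E.I_le hx hy hi) (fun h => hne (E.cinj i h))

theorem I_nonempty (E : Ex d k n c) {x : G} (hx : ht n c x = 1) (y : G) : (I c y x).Nonempty := by
  have : (Finset.univ : Finset ι).Nonempty := by
    rw [← Finset.card_pos, Finset.card_univ, E.cι]; omega
  obtain ⟨i, _, hi⟩ := Finset.exists_min_image Finset.univ (fun i => (c i y : ℚ) / c i x) this
  refine ⟨i, mem_I.2 fun j => ?_⟩
  have pi := E.pos (E.ne_zero hx) i
  have pj := E.pos (E.ne_zero hx) j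
  have := hi j (Finset.mem_univ j)
  rw [div_le_div_iff₀ (by exact_mod_cast pi) (by exact_mod_cast pj)] at this
  exact_mod_cast this

theorem I_card_le (E : Ex d k n c) {x y : G} (hx : ht n c x = 1) (hy : ht n c y = 1) (hne : y ≠ x) :
    (I c y x).card ≤ d := by
  by_contra hh
  have : (I c y x) = Finset.univ := by
    apply Finset.eq_univ_of_card
    have := Finset.card_le_univ (I c y x)
    rw [E.cι] at *
    omega
  have h1 := E.sumA hx
  have h2 := E.sumA hy
  have : ∑ j, c j y < ∑ j, c j x := by
    apply Finset.sum_lt_sum_of_nonempty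
    · rw [← Finset.card_pos, Finset.card_univ, E.cι]; omega
    · intro j _
      exact E.I_lt hx hy hne (by rw [this]; simp)
  omega

open Classical in
theorem F_ge (E : Ex d k n c) {x : G} (hx : ht n c x = 1) (i : ι) :
    ((1 + ∑ y ∈ (Finset.univ.filter (fun y => ht n c y = 1 ∧ y ≠ x ∧ i ∈ I c y x)),
      (d + 1 - (I c y x).card) : ℕ) : ℤ) ≤ c i x := by
  have npos := E.S.pos
  have mpos := E.pos (E.ne_zero hx) i
  obtain ⟨m, hm⟩ := Int.eq_ofNat_of_zero_le mpos.le
  have m0 : 0 < m := by omega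
  haveI : NeZero m := ⟨m0.ne'⟩
  have n1 : 1 < n := by have := E.S.lt i x; omega
  obtain ⟨q, hq⟩ := E.csurj i 1 (by omega) n1
  -- multiples of q
  have hmul : ∀ y : G, ∀ j, n ∣ c j y - c i y * c j q := by
    intro y j
    obtain ⟨t, ht⟩ := Int.eq_ofNat_of_zero_le (E.S.nonneg i y)
    have : y = t • q := by
      apply E.cinj i
      symm
      apply E.S.eq_of_modEq (E.S.nonneg i y) (E.S.lt i y)
      have := E.smul_mod i t q
      rw [hq, mul_one] at this
      rwa [ht]
    have h2 := E.smul_mod j t q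
    rw [← this] at h2
    rwa [ht]
  choose r hr using hmul
  let κ : ι → ℤ := fun j => - r x j + if j = i then 1 else 0
  have hκs : ∑ j, κ j = ht n c q * m := by
    have h1 := E.sumA hx
    have h2 := E.S.ht_mul q
    have h3 : ∑ j, (c j x - c i x * c j q) = ∑ j, n * r x j := Finset.sum_congr rfl (fun j _ => hr x j)
    rw [Finset.sum_sub_distrib, ← Finset.mul_sum, ← Finset.mul_sum, h1, h2, hm] at h3
    have h4 : ∑ j, κ j = - ∑ j, r x j + 1 := by
      simp [κ, Finset.sum_add_distrib]
    rw [h4]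
    have : n * (1 - m * ht n c q) = n * ∑ j, r x j := by linarith
    have := mul_left_cancel₀ npos.ne' this
    linarith
  let c' : ι → ZMod m → ℤ := fun j u => (((κ j : ZMod m) * u).val : ℤ)
  have hκi : κ i = 1 := by
    have := hr x i
    rw [hq, mul_one, sub_self] at this
    have : r x i = 0 := by
      rcases mul_eq_zero.1 this.symm with h | h
      · omega
      · exact h
    simp [κ, this]
  have hcast : ∀ j u, ((c' j u : ℤ) : ZMod m) = κ j * u := by
    intro j u
    simp only [c', Int.cast_natCast, ZMod.natCast_zmod_val]
  have S' : Sys (m : ℤ) c' := by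
    refine ⟨by omega, fun j g => Int.natCast_nonneg _, fun j g => ?_, fun j g g' => ?_, fun g => ?_,
      fun g hg => ?_⟩
    · simp only [c']; exact_mod_cast ZMod.val_lt _
    · rw [← ZMod.intCast_zmod_eq_zero_iff_dvd]
      simp only [Int.cast_sub, Int.cast_add, hcast]
      ring
    · rw [← ZMod.intCast_zmod_eq_zero_iff_dvd]
      simp only [Int.cast_sum, hcast]
      rw [← Finset.sum_mul, ← Int.cast_sum, hκs]
      simp
    · have := hg i
      have h2 := hcast i g
      rw [this, hκi] at h2
      simpa using h2.symm
  have hW := S'.weighted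
  rw [ZMod.card] at hW
  rw [hm]
  norm_cast
  refine le_trans ?_ hW
  gcongr 1 + ?_
  -- key facts on each y
  have key : ∀ y, ht n c y = 1 → y ≠ x → i ∈ I c y x →
      ht m c' ((c i y : ℤ) : ZMod m) = 1 ∧ supp c' ((c i y : ℤ) : ZMod m) - 1 = d + 1 - (I c y x).card := by
    intro y hy hne hi
    have y1 := E.I_lt hx hy hne hi
    have ypos := E.pos (E.ne_zero hy) i
    have hμ : ∀ j, n ∣ c i x * c j y - c i y * c j x := by
      intro j
      exact ⟨c i x * r y j - c i y * r x j, by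
        have h1 := hr x j
        have h2 := hr y j
        linear_combination c i x * h2 - c i y * h1⟩
    choose μ hμ using hμ
    have μ0 : ∀ j, 0 ≤ μ j := by
      intro j
      have := (mem_I.1 hi) j
      by_contra hh
      nlinarith [hμ j]
    have μm : ∀ j, μ j < m := by
      intro j
      have := E.S.lt j y
      have := E.pos (E.ne_zero hx) j
      by_contra hh
      push Not at hh
      rw [hm] at hμ
      have h1 := hμ j
      have : (m:ℤ) * c j y < m * n := by nlinarith
      have : 0 < c i y * c j x := by positivity
      nlinarith
    have μi : μ i = 0 := by
      have := hμ i
      rw [mul_comm, sub_self] at this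
      rcases mul_eq_zero.1 this.symm with h | h
      · omega
      · exact h
    have hc : ∀ j, c' j ((c i y : ℤ) : ZMod m) = μ j + if j = i then c i y else 0 := by
      intro j
      apply S'.eq_of_modEq
      · have := μ0 j; split_ifs <;> omega
      · split_ifs with h
        · rw [h, μi]; omega
        · have := μm j; omega
      · rw [← ZMod.intCast_zmod_eq_zero_iff_dvd]
        rw [Int.cast_sub, hcast]
        rw [← Int.cast_mul, ← Int.cast_sub, ZMod.intCast_zmod_eq_zero_iff_dvd]
        refine ⟨- r y j, ?_⟩
        simp only [κ]
        apply mul_left_cancel₀ npos.ne'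
        have h1 := hr x j
        have h2 := hr y j
        have h3 := hμ j
        split_ifs with h
        · rw [hm] at *
          linear_combination (c i y) * h1 - m * h2 + h3
        · rw [hm] at *
          linear_combination (c i y) * h1 - m * h2 + h3
    constructor
    · apply S'.ht_eq
      simp_rw [hc]
      rw [Finset.sum_add_distrib]
      simp only [Finset.sum_ite_eq', Finset.mem_univ, if_true]
      have h1 := E.sumA hx
      have h2 := E.sumA hy
      have h3 : ∑ j, (c i x * c j y - c i y * c j x) = ∑ j, n * μ j :=
        Finset.sum_congr rfl (fun j _ => hμ j)
      rw [Finset.sum_sub_distrib, ← Finset.mul_sum, ← Finset.mul_sum, ← Finset.mul_sum, h1, h2] at h3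
      apply mul_left_cancel₀ npos.ne'
      rw [hm] at h3
      linarith
    · have : (Finset.univ.filter (fun j => c' j ((c i y : ℤ) : ZMod m) ≠ 0)) =
        insert i (I c y x)ᶜ := by
        ext j
        simp only [Finset.mem_filter, Finset.mem_univ, true_and, Finset.mem_insert,
          Finset.mem_compl, hc j]
        by_cases hj : j = i
        · simp [hj, μi]; omega
        · simp only [hj, if_false, false_or, add_zero]
          rw [E.ratio hx hi j]
          have := hμ j
          constructor
          · intro h h'
            have : n * μ j = 0 := by rw [← this]; linarith
            rcases mul_eq_zero.1 this with h | h
            · omega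
            · contradiction
          · intro h h'
            rw [h', mul_zero] at this
            apply h; linarith
      rw [supp, this, Finset.card_insert_of_notMem (by simpa using hi), Finset.card_compl, E.cι]
      omega
  have hinj : Set.InjOn (fun y => ((c i y : ℤ) : ZMod m))
      (Finset.univ.filter (fun y => ht n c y = 1 ∧ y ≠ x ∧ i ∈ I c y x) : Finset G) := by
    intro y hy z hz h
    simp only [Finset.coe_filter, Finset.mem_univ, true_and, Set.mem_setOf_eq] at hy hz
    have h1 := E.I_lt hx hy.1 hy.2.1 hy.2.2
    have h2 := E.I_lt hx hz.1 hz.2.1 hz.2.2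
    have h3 := E.S.nonneg i y
    have h4 := E.S.nonneg i z
    apply E.cinj i
    have h5 := (ZMod.intCast_eq_intCast_iff _ _ _).1 h
    rw [Int.ModEq, Int.emod_eq_of_lt h3 (by omega), Int.emod_eq_of_lt h4 (by omega)] at h5
    exact h5
  calc _ = ∑ y ∈ (Finset.univ.filter (fun y => ht n c y = 1 ∧ y ≠ x ∧ i ∈ I c y x)),
        (supp c' ((c i y : ℤ) : ZMod m) - 1) := by
        apply Finset.sum_congr rfl
        intro y hy
        simp only [Finset.mem_filter, Finset.mem_univ, true_and] at hy
        exact (key y hy.1 hy.2.1 hy.2.2).2.symm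
    _ = ∑ u ∈ (Finset.univ.filter (fun y => ht n c y = 1 ∧ y ≠ x ∧ i ∈ I c y x)).image
        (fun y => ((c i y : ℤ) : ZMod m)), (supp c' u - 1) := by
        rw [Finset.sum_image hinj]
    _ ≤ _ := by
        apply Finset.sum_le_sum_of_subset
        intro u hu
        obtain ⟨y, hy, rfl⟩ := Finset.mem_image.1 hu
        simp only [Finset.mem_filter, Finset.mem_univ, true_and] at hy ⊢
        exact (key y hy.1 hy.2.1 hy.2.2).1

open Classical in
/-- the set of height-one elements -/
def A (n : ℤ) (c : ι → G → ℤ) : Finset G := Finset.univ.filter (fun y => ht n c y = 1)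

theorem mem_A {y : G} : y ∈ A n c ↔ ht n c y = 1 := by simp [A]

open Classical in
theorem F_ge' (E : Ex d k n c) {x : G} (hx : ht n c x = 1) (i : ι) :
    1 + ∑ y ∈ (A n c).erase x, (if i ∈ I c y x then (d + 1 - (I c y x).card : ℤ) else 0) ≤ c i x := by
  refine le_trans (le_of_eq ?_) (E.F_ge hx i)
  push_cast
  congr 1
  rw [← Finset.sum_filter]
  apply Finset.sum_congr
  · ext y
    simp [mem_A]; tauto
  · intro y hy
    simp only [Finset.mem_filter, Finset.mem_univ, true_and] at hy
    have := E.I_card_le hx hy.1 hy.2.1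
    rw [Nat.cast_sub (by omega)]
    push_cast; ring

open Classical in
theorem F_aux (E : Ex d k n c) {x : G} (hx : ht n c x = 1) :
    (∀ i, 1 + ∑ y ∈ (A n c).erase x, (if i ∈ I c y x then (d + 1 - (I c y x).card : ℤ) else 0) = c i x)
    ∧ ∀ y ∈ (A n c).erase x, (d : ℤ) = (I c y x).card * (d + 1 - (I c y x).card : ℤ) := by
  have h1 := E.sumA hx
  have hcA : (((A n c).erase x).card : ℤ) = k - 1 := by
    rw [Finset.card_erase_of_mem (mem_A.2 hx)]
    have : (A n c).card = k := by rw [← E.cA, A]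
    rw [this]
    have := E.hk
    omega
  have hle : ∀ y ∈ (A n c).erase x, (d : ℤ) ≤ (I c y x).card * (d + 1 - (I c y x).card : ℤ) := by
    intro y hy
    rw [Finset.mem_erase, mem_A] at hy
    have a := E.I_card_le hx hy.2 hy.1
    have b := Finset.card_pos.2 (E.I_nonempty hx y)
    have a' : ((I c y x).card : ℤ) ≤ d := by exact_mod_cast a
    have b' : (1:ℤ) ≤ (I c y x).card := by exact_mod_cast b
    nlinarith
  have hsum : ∑ i, (1 + ∑ y ∈ (A n c).erase x, (if i ∈ I c y x then (d + 1 - (I c y x).card : ℤ) else 0))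
      = (d + 1) + ∑ y ∈ (A n c).erase x, (I c y x).card * (d + 1 - (I c y x).card : ℤ) := by
    rw [Finset.sum_add_distrib, Finset.sum_comm]
    congr 1
    · simp [E.cι]
    · apply Finset.sum_congr rfl
      intro y _
      rw [← Finset.sum_filter, Finset.sum_const, nsmul_eq_mul, Finset.filter_univ_mem]
  have h2 : ∑ i, (1 + ∑ y ∈ (A n c).erase x, (if i ∈ I c y x then (d + 1 - (I c y x).card : ℤ) else 0))
     ≤ ∑ i, c i x := Finset.sum_le_sum (fun i _ => E.F_ge' hx i)
  have h3 : ∑ y ∈ (A n c).erase x, (d : ℤ) ≤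
     ∑ y ∈ (A n c).erase x, (I c y x).card * (d + 1 - (I c y x).card : ℤ) := Finset.sum_le_sum hle
  have h4 : ∑ y ∈ (A n c).erase x, (d : ℤ) = (k - 1) * d := by
    rw [Finset.sum_const, nsmul_eq_mul, hcA]
  have h5 := E.hn
  have h6 : (d:ℤ) * k + 1 = (d + 1) + (k - 1) * d := by ring
  constructor
  · have : ∑ i, (1 + ∑ y ∈ (A n c).erase x, (if i ∈ I c y x then (d + 1 - (I c y x).card : ℤ) else 0))
     = ∑ i, c i x := le_antisymm h2 (by rw [hsum, h1]; linarith)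
    intro i
    exact (Finset.sum_eq_sum_iff_of_le (fun i _ => E.F_ge' hx i)).1 this i (Finset.mem_univ i)
  · refine (Finset.sum_eq_sum_iff_of_le hle).1 (le_antisymm h3 ?_)
    rw [hsum] at h2
    linarith

theorem I_card (E : Ex d k n c) {x y : G} (hx : ht n c x = 1) (hy : ht n c y = 1) (hne : y ≠ x) :
    (I c y x).card = 1 ∨ (I c y x).card = d := by
  classical
  have := (E.F_aux hx).2 y (Finset.mem_erase.2 ⟨hne, mem_A.2 hy⟩)
  have h : (((I c y x).card : ℤ) - 1) * ((I c y x).card - d) = 0 := by linear_combination this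
  rcases mul_eq_zero.1 h with h | h
  · left; omega
  · right; omega

end Ex


namespace Ex
open Sys
variable {G ι : Type*} [AddCommGroup G] [Fintype G] [Fintype ι] {d k : ℕ} {n : ℤ} {c : ι → G → ℤ}

theorem sub_ge (E : Ex d k n c) {x y : G} {j : ι} (h : c j y ≤ c j x) :
    c j (x - y) = c j x - c j y := by
  have h1 := E.S.lt j x
  have h2 := E.S.nonneg j y
  apply E.S.eq_of_modEq (by omega) (by omega)
  obtain ⟨w, hw⟩ := E.S.add j (x - y) y
  rw [sub_add_cancel] at hw
  exact ⟨-w, by linarith⟩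

theorem sub_lt (E : Ex d k n c) {x y : G} {j : ι} (h : c j x < c j y) :
    c j (x - y) = n + c j x - c j y := by
  have h1 := E.S.lt j y
  have h2 := E.S.nonneg j x
  apply E.S.eq_of_modEq (by omega) (by omega)
  obtain ⟨w, hw⟩ := E.S.add j (x - y) y
  rw [sub_add_cancel] at hw
  exact ⟨-w - 1, by linarith⟩

theorem add_lt (E : Ex d k n c) {x y : G} {j : ι} (h : c j x + c j y < n) :
    c j (x + y) = c j x + c j y := by
  have h1 := E.S.nonneg j y
  have h2 := E.S.nonneg j x
  apply E.S.eq_of_modEq (by omega) (by omega)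
  exact E.S.add j x y

theorem add_ge (E : Ex d k n c) {x y : G} {j : ι} (h : n ≤ c j x + c j y) :
    c j (x + y) = c j x + c j y - n := by
  have h1 := E.S.lt j y
  have h2 := E.S.lt j x
  apply E.S.eq_of_modEq (by omega) (by omega)
  obtain ⟨w, hw⟩ := E.S.add j x y
  exact ⟨w + 1, by linarith⟩

open Classical in
theorem sum_split (E : Ex d k n c) {x : G} (hx : ht n c x = 1) (i : ι) :
    c i x + ∑ j ∈ Finset.univ.erase i, c j x = n := by
  rw [Finset.add_sum_erase _ (fun j => c j x) (Finset.mem_univ i)]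
  exact E.sumA hx

theorem two_lt (E : Ex d k n c) {x : G} (hx : ht n c x = 1) {i j : ι} (h : i ≠ j) :
    c i x + c j x < n := by
  classical
  have h1 := E.sum_split hx i
  have hj : j ∈ Finset.univ.erase i := by simp [h.symm]
  rw [← Finset.add_sum_erase _ _ hj] at h1
  have : 0 < ∑ l ∈ (Finset.univ.erase i).erase j, c l x := by
    apply Finset.sum_pos (fun l _ => E.pos (E.ne_zero hx) l)
    rw [← Finset.card_pos, Finset.card_erase_of_mem hj, Finset.card_erase_of_mem (Finset.mem_univ i),
      Finset.card_univ, E.cι]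
    have := E.hd
    omega
  linarith

theorem exists_off (E : Ex d k n c) (i j : ι) : ∃ o, o ≠ i ∧ o ≠ j := by
  classical
  by_contra hh
  push Not at hh
  have : (Finset.univ : Finset ι) ⊆ {i, j} := by
    intro o _
    by_cases h : o = i
    · simp [h]
    · simp [hh o h]
  have := Finset.card_le_card this
  rw [Finset.card_univ, E.cι] at this
  have := Finset.card_le_two (a := i) (b := j)
  have := E.hd
  omega

/-- collinearity off i -/
def Col (c : ι → G → ℤ) (i : ι) (y x : G) : Prop := ∀ j, j ∈ I c y x ↔ j ≠ i

theorem Col.ne {i : ι} {y x : G} (h : Col c i y x) : y ≠ x := by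
  rintro rfl
  exact (h i).1 (mem_I.2 fun j => by rw [mul_comm]) rfl

theorem Col.prop (E : Ex d k n c) {x : G} (hx : ht n c x = 1) {i : ι} {y : G}
    (h : Col c i y x) {j l : ι} (hj : j ≠ i) (hl : l ≠ i) : c j y * c l x = c l y * c j x :=
  (E.ratio hx ((h l).2 hl) j).1 ((h j).2 hj)

theorem Col.lt (E : Ex d k n c) {x y : G} (hx : ht n c x = 1) (hy : ht n c y = 1) {i : ι}
    (h : Col c i y x) {j : ι} (hj : j ≠ i) : c j y < c j x :=
  E.I_lt hx hy h.ne ((h j).2 hj)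

theorem gt_of_lt (E : Ex d k n c) {x y : G} (hx : ht n c x = 1) (hy : ht n c y = 1) {i : ι}
    (h : ∀ j, j ≠ i → c j y < c j x) : c i x < c i y := by
  classical
  have h1 := E.sum_split hx i
  have h2 := E.sum_split hy i
  have : ∑ j ∈ Finset.univ.erase i, c j y < ∑ j ∈ Finset.univ.erase i, c j x := by
    apply Finset.sum_lt_sum_of_nonempty
    · obtain ⟨o, ho, _⟩ := E.exists_off i i
      exact ⟨o, by simp [ho]⟩
    · intro j hj
      exact h j (by simpa using hj)
  omega

theorem Col.gt (E : Ex d k n c) {x y : G} (hx : ht n c x = 1) (hy : ht n c y = 1) {i : ι}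
    (h : Col c i y x) : c i x < c i y :=
  E.gt_of_lt hx hy (fun _ hj => h.lt E hx hy hj)

theorem mkCol (E : Ex d k n c) {x y : G} (hx : ht n c x = 1) (hy : ht n c y = 1) {i : ι}
    (hp : ∀ j l, j ≠ i → l ≠ i → c j y * c l x = c l y * c j x) {o : ι} (ho : o ≠ i)
    (hlt : c o y < c o x) : Col c i y x := by
  have px := fun j => E.pos (E.ne_zero hx) j
  have py := fun j => E.pos (E.ne_zero hy) j
  have hl : ∀ j, j ≠ i → c j y < c j x := by
    intro j hj
    have := hp j o hj ho
    by_contra hh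
    push Not at hh
    nlinarith [px o, px j, py o, py j]
  have hg := E.gt_of_lt hx hy hl
  intro j
  constructor
  · rintro hj rfl
    have := E.I_le hx hy hj
    omega
  · intro hj
    rw [mem_I]
    intro l
    by_cases h : l = i
    · subst h
      have := hl j hj
      nlinarith [px l, px j, py l, py j]
    · exact (hp j l hj h).le

theorem exists_col (E : Ex d k n c) {x y : G} (h : (I c y x).card = d) : ∃ i, Col c i y x := by
  classical
  have : ((I c y x)ᶜ).card = 1 := by rw [Finset.card_compl, E.cι, h]; omega
  obtain ⟨i, hi⟩ := Finset.card_eq_one.1 this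
  refine ⟨i, fun j => ?_⟩
  have : j ∈ (I c y x)ᶜ ↔ j = i := by rw [hi]; simp
  rw [Finset.mem_compl] at this
  tauto

theorem col_of_two (E : Ex d k n c) {x y : G} (hx : ht n c x = 1) (hy : ht n c y = 1) (hne : y ≠ x)
    {i j : ι} (hij : i ≠ j) (hi : i ∈ I c y x) (hj : j ∈ I c y x) : ∃ i, Col c i y x := by
  rcases E.I_card hx hy hne with h | h
  · exact absurd (Finset.card_le_one.1 h.le i hi j hj) hij
  · exact E.exists_col h

theorem no_two (E : Ex d k n c) {x y : G} (hx : ht n c x = 1) (hy : ht n c y = 1) (hne : y ≠ x)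
    {i j : ι} (hij : i ≠ j) (hi : i ∉ I c y x) (hj : j ∉ I c y x)
    (h : ∀ o, o ≠ i → o ≠ j → o ∈ I c y x) : False := by
  classical
  have : I c y x = ({i, j} : Finset ι)ᶜ := by
    ext o
    simp only [Finset.mem_compl, Finset.mem_insert, Finset.mem_singleton, not_or]
    constructor
    · intro ho
      exact ⟨fun h => hi (h ▸ ho), fun h => hj (h ▸ ho)⟩
    · rintro ⟨a, b⟩; exact h o a b
  have h2 : (I c y x).card = d - 1 := by
    rw [this, Finset.card_compl, Finset.card_pair hij, E.cι]; omega
  have := E.hd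
  rcases E.I_card hx hy hne with h | h <;> omega

theorem mod_gen (E : Ex d k n c) {x : G} (hx : ht n c x = 1) (e : ι)
    (h : ∀ j, j ≠ e → ∀ y, ht n c y = 1 → ¬ Col c j y x) :
    (d : ℤ) ∣ c e x - 1 ∧ ∀ j l, j ≠ e → l ≠ e → (d : ℤ) ∣ c j x - c l x := by
  classical
  have hF := (E.F_aux hx).1
  have hc : ∀ y ∈ (A n c).erase x, (I c y x).card = d → Col c e y x := by
    intro y hy hd
    rw [Finset.mem_erase, mem_A] at hy
    obtain ⟨i, hi⟩ := E.exists_col hd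
    by_cases hie : i = e
    · rwa [← hie]
    · exact absurd hi (h i hie y hy.2)
  constructor
  · rw [← hF e, add_sub_cancel_left]
    apply Finset.dvd_sum
    intro y hy
    have hy' := hy
    rw [Finset.mem_erase, mem_A] at hy'
    split_ifs with hI
    · rcases E.I_card hx hy'.2 hy'.1 with h1 | h1
      · rw [h1]; simp
      · exact absurd rfl ((hc y hy h1 e).1 hI)
    · simp
  · intro j l hj hl
    rw [← hF j, ← hF l, add_sub_add_left_eq_sub, ← Finset.sum_sub_distrib]
    apply Finset.dvd_sum
    intro y hy
    have hy' := hy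
    rw [Finset.mem_erase, mem_A] at hy'
    rcases E.I_card hx hy'.2 hy'.1 with h1 | h1
    · rw [h1]; split_ifs <;> simp
    · rw [if_pos ((hc y hy h1 j).2 hj), if_pos ((hc y hy h1 l).2 hl)]; simp

/-- Lemma D -/
theorem colD (E : Ex d k n c) {x y : G} (hx : ht n c x = 1) (hy : ht n c y = 1) {i : ι}
    (h : Col c i y x) : ht n c (x - y) = 1 ∧ Col c i (x - y) x ∧
      ∀ j, j ≠ i → c j (x - y) = c j x - c j y := by
  classical
  have h1 : ∀ j, j ≠ i → c j (x - y) = c j x - c j y := fun j hj => E.sub_ge (h.lt E hx hy hj).le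
  have h2 := E.sub_lt (h.gt E hx hy)
  have h3 : ht n c (x - y) = 1 := by
    apply E.S.ht_eq
    rw [← Finset.add_sum_erase _ _ (Finset.mem_univ i), h2,
      Finset.sum_congr rfl (fun j hj => h1 j (Finset.ne_of_mem_erase hj)), Finset.sum_sub_distrib]
    have a := E.sum_split hx i
    have b := E.sum_split hy i
    linarith
  refine ⟨h3, ?_, h1⟩
  obtain ⟨o, ho, _⟩ := E.exists_off i i
  refine E.mkCol hx h3 (fun j l hj hl => ?_) ho ?_
  · rw [h1 j hj, h1 l hl]
    have := h.prop E hx hj hl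
    linarith
  · rw [h1 o ho]
    have := E.pos (E.ne_zero hy) o
    omega

theorem half (E : Ex d k n c) {x y : G} (hx : ht n c x = 1) (hy : ht n c y = 1) {i : ι}
    (h : Col c i y x) : ∃ z, ht n c z = 1 ∧ Col c i z x ∧ (∀ j, j ≠ i → 2 * c j z ≤ c j x) ∧
      n < 2 * c i z := by
  classical
  have px := fun j => E.pos (E.ne_zero hx) j
  obtain ⟨o, ho, _⟩ := E.exists_off i i
  have key : ∀ z, ht n c z = 1 → Col c i z x → 2 * c o z ≤ c o x →
      (∀ j, j ≠ i → 2 * c j z ≤ c j x) ∧ n < 2 * c i z := by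
    intro z hz hc hle
    have : ∀ j, j ≠ i → 2 * c j z ≤ c j x := by
      intro j hj
      have := hc.prop E hx hj ho
      have p1 := px j
      have p2 := px o
      by_contra hh
      push Not at hh
      nlinarith
    refine ⟨this, ?_⟩
    have a := E.sum_split hx i
    have b := E.sum_split hz i
    have : ∑ j ∈ Finset.univ.erase i, 2 * c j z ≤ ∑ j ∈ Finset.univ.erase i, c j x :=
      Finset.sum_le_sum (fun j hj => this j (Finset.ne_of_mem_erase hj))
    rw [← Finset.mul_sum] at this
    have := px i
    linarith
  by_cases hle : 2 * c o y ≤ c o x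
  · exact ⟨y, hy, h, key y hy h hle⟩
  · obtain ⟨a, b, e⟩ := E.colD hx hy h
    exact ⟨x - y, a, b, key _ a b (by rw [e o ho]; linarith)⟩

/-- Lemma add -/
theorem addA (E : Ex d k n c) {x y : G} (hx : ht n c x = 1) (hy : ht n c y = 1) {i : ι}
    (h : n ≤ c i x + c i y) : ht n c (x + y) = 1 ∧ c i (x + y) = c i x + c i y - n ∧
      ∀ j, j ≠ i → c j (x + y) = c j x + c j y := by
  classical
  have h2 := E.add_ge h
  have h1 : ∀ j, j ≠ i → c j (x + y) = c j x + c j y := by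
    intro j hj
    apply E.add_lt
    have a := E.two_lt hx hj
    have b := E.two_lt hy hj
    omega
  refine ⟨?_, h2, h1⟩
  apply E.S.ht_eq
  rw [← Finset.add_sum_erase _ _ (Finset.mem_univ i), h2,
    Finset.sum_congr rfl (fun j hj => h1 j (Finset.ne_of_mem_erase hj)), Finset.sum_add_distrib]
  have a := E.sum_split hx i
  have b := E.sum_split hy i
  linarith

theorem dir (E : Ex d k n c) {x y y' : G} (hx : ht n c x = 1) (hy : ht n c y = 1)
    (hy' : ht n c y' = 1) {i j : ι} (hij : i ≠ j) (h : Col c i y x) (h' : Col c j y' x) : False := by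
  classical
  obtain ⟨z, hz, cz, lz, -⟩ := E.half hx hy h
  obtain ⟨z', hz', cz', lz', -⟩ := E.half hx hy' h'
  have px := fun j => E.pos (E.ne_zero hx) j
  have pz := fun j => E.pos (E.ne_zero hz) j
  have pz' := fun j => E.pos (E.ne_zero hz') j
  have gi := cz.gt E hx hz
  have gj := cz'.gt E hx hz'
  have wo : ∀ o, o ≠ i → o ≠ j → c o (x - z - z') = c o x - c o z - c o z' := by
    intro o oi oj
    have h1 := E.sub_ge (cz.lt E hx hz oi).le
    rw [E.sub_ge, h1]
    rw [h1]
    have := lz o oi; have := lz' o oj; omega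
  have wi : c i (x - z - z') = n + c i x - c i z - c i z' := by
    have h1 := E.sub_lt gi
    rw [E.sub_ge, h1]
    rw [h1]
    have := lz' i hij; have := E.S.lt i z; have := px i
    omega
  have wj : c j (x - z - z') = n + c j x - c j z - c j z' := by
    have h1 := E.sub_ge (cz.lt E hx hz hij.symm).le
    rw [E.sub_lt, h1]
    · ring
    · rw [h1]
      have := pz j
      omega
  have hw : ht n c (x - z - z') = 1 := by
    apply E.S.ht_eq
    have hj : j ∈ Finset.univ.erase i := by simp [hij.symm]
    rw [← Finset.add_sum_erase _ _ (Finset.mem_univ i), ← Finset.add_sum_erase _ _ hj, wi, wj,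
      Finset.sum_congr rfl (fun o ho => wo o (Finset.ne_of_mem_erase (Finset.mem_of_mem_erase ho))
        (Finset.ne_of_mem_erase ho)), Finset.sum_sub_distrib, Finset.sum_sub_distrib]
    have a := E.sum_split hx i
    have b := E.sum_split hz i
    have e := E.sum_split hz' i
    rw [← Finset.add_sum_erase _ _ hj] at a b e
    linarith
  obtain ⟨o₁, o1i, o1j⟩ := E.exists_off i j
  have gti : ∀ o, o ≠ i → o ≠ j → c o (x - z - z') * c i x < c i (x - z - z') * c o x := by
    intro o oi oj
    rw [wo o oi oj, wi]
    have e1 := cz'.prop E hx oj hij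
    have l1 := E.S.lt i z
    nlinarith [px o, px i, pz o, pz i]
  have gtj : ∀ o, o ≠ i → o ≠ j → c o (x - z - z') * c j x < c j (x - z - z') * c o x := by
    intro o oi oj
    rw [wo o oi oj, wj]
    have e1 := cz.prop E hx oi hij.symm
    have l1 := E.S.lt j z'
    nlinarith [px o, px j, pz' o, pz' j]
  refine E.no_two hx hw ?_ hij ?_ ?_ ?_
  · intro he
    have := wo o₁ o1i o1j
    rw [he] at this
    have := pz o₁; have := pz' o₁
    omega
  · intro hI
    have := mem_I.1 hI o₁
    have := gti o₁ o1i o1j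
    omega
  · intro hI
    have := mem_I.1 hI o₁
    have := gtj o₁ o1i o1j
    omega
  · intro o oi oj
    rw [mem_I]
    intro l
    by_cases li : l = i
    · rw [li]; exact (gti o oi oj).le
    by_cases lj : l = j
    · rw [lj]; exact (gtj o oi oj).le
    rw [wo o oi oj, wo l li lj]
    have e1 := cz.prop E hx oi li
    have e2 := cz'.prop E hx oj lj
    apply le_of_eq
    linear_combination -e1 - e2

/-- Lemma C -/
theorem colC (E : Ex d k n c) {x z : G} (hx : ht n c x = 1) (hz : ht n c z = 1) {i l : ι}
    (hl : l ≠ i) (h : Col c i z x) : 2 * c l x < n := by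
  by_contra hh
  push Not at hh
  obtain ⟨a1, a2, a3⟩ := E.addA hx hx (i := l) (by linarith)
  have px := fun j => E.pos (E.ne_zero hx) j
  have pz := fun j => E.pos (E.ne_zero hz) j
  have pxx := fun j => E.pos (E.ne_zero a1) j
  have gi := h.gt E hx hz
  obtain ⟨o₁, o1i, o1l⟩ := E.exists_off i l
  have gti : ∀ o, o ≠ i → o ≠ l → c o z * c i (x + x) < c i z * c o (x + x) := by
    intro o oi oj
    rw [a3 o oj, a3 i hl.symm]
    have := h.lt E hx hz oi
    nlinarith [px o, px i, pz o, pz i]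
  have gtl : ∀ o, o ≠ i → o ≠ l → c o z * c l (x + x) < c l z * c o (x + x) := by
    intro o oi oj
    rw [a3 o oj, a2]
    have := h.prop E hx oi hl
    have := E.S.pos
    nlinarith [px o, px l, pz o, pz l]
  refine E.no_two a1 hz ?_ hl ?_ ?_ ?_
  · intro he
    have h1 := a3 o₁ o1l
    rw [← he] at h1
    have := h.lt E hx hz o1i
    have := px o₁
    omega
  · intro hI
    have := mem_I.1 hI o₁
    have := gtl o₁ o1i o1l
    omega
  · intro hI
    have := mem_I.1 hI o₁
    have := gti o₁ o1i o1l
    omega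
  · intro o ol oi
    rw [mem_I]
    intro m
    by_cases mi : m = i
    · rw [mi]; exact (gti o oi ol).le
    by_cases ml : m = l
    · rw [ml]; exact (gtl o oi ol).le
    rw [a3 o ol, a3 m ml]
    have e1 := h.prop E hx oi mi
    apply le_of_eq
    linear_combination 2 * e1

/-- existence of direction -/
theorem dir_of (E : Ex d k n c) {x : G} (hx : ht n c x = 1) (o : ι)
    (h : ∀ i, i ≠ o → ¬ (d : ℤ) ∣ c i x - 1) : ∃ y, ht n c y = 1 ∧ Col c o y x := by
  obtain ⟨i, hi, _⟩ := E.exists_off o o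
  have h1 : ∃ j y, ht n c y = 1 ∧ Col c j y x := by
    by_contra hh
    push Not at hh
    exact h i hi (E.mod_gen hx i (fun j _ y hy => hh j y hy)).1
  obtain ⟨j, y, hy, hc⟩ := h1
  by_cases hj : j = o
  · exact ⟨y, hy, hj ▸ hc⟩
  · exfalso
    exact h j hj (E.mod_gen hx j (fun l hl y' hy' hc' => E.dir hx hy' hy hl hc' hc)).1

end Ex


namespace Ex
open Sys
variable {G ι : Type*} [AddCommGroup G] [Fintype G] [Fintype ι] {d k : ℕ} {n : ℤ} {c : ι → G → ℤ}

/-- proportional off o -/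
def Par (c : ι → G → ℤ) (o : ι) (u z : G) : Prop :=
  ∀ j l, j ≠ o → l ≠ o → c j u * c l z = c l u * c j z

theorem Par.trans (E : Ex d k n c) {o : ι} {y v z : G} (hy : ht n c y = 1) (h1 : Par c o y z)
    (h2 : Par c o y v) : Par c o v z := by
  intro j l hj hl
  have p := E.pos (E.ne_zero hy) j
  apply mul_left_cancel₀ p.ne'
  have a := h1 j l hj hl
  have b := h2 j l hj hl
  linear_combination c j v * a - c j z * b

theorem ones (E : Ex d k n c) {x : G} (hx : ht n c x = 1) (i : ι) (h : n - c i x ≤ d) :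
    ∀ j, j ≠ i → c j x = 1 := by
  classical
  have h1 := E.sum_split hx i
  have h2 : ∑ j ∈ Finset.univ.erase i, (1:ℤ) = d := by
    rw [Finset.sum_const, Finset.card_erase_of_mem (Finset.mem_univ i), Finset.card_univ, E.cι]
    simp
  have hle : ∀ j ∈ Finset.univ.erase i, 1 ≤ c j x := fun j _ => E.pos (E.ne_zero hx) j
  have h3 : ∑ j ∈ Finset.univ.erase i, (1:ℤ) = ∑ j ∈ Finset.univ.erase i, c j x :=
    le_antisymm (Finset.sum_le_sum hle) (by linarith)
  intro j hj
  exact ((Finset.sum_eq_sum_iff_of_le hle).1 h3 j (by simp [hj])).symm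

theorem exists_p (E : Ex d k n c) (o : ι) : ∃ p, c o p = 1 ∧ ht n c p = 1 := by
  have n1 : 1 < n := by
    have h1 := E.hn; have h2 := E.hd; have h3 := E.hk
    have : 1 ≤ d * k := Nat.mul_pos (by omega) h3
    rw [h1]; exact_mod_cast (by omega)
  obtain ⟨p, hp⟩ := E.csurj o 1 (by omega) n1
  refine ⟨p, hp, ?_⟩
  have p0 : p ≠ 0 := by
    rintro rfl
    rw [E.S.zero] at hp; omega
  have h0 : 0 < ht n c p := by
    by_contra hh; exact p0 (E.S.eq_zero_of_ht (not_lt.1 hh))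
  obtain ⟨m, hm⟩ := Int.eq_ofNat_of_zero_le (show 0 ≤ ht n c p - 1 by omega)
  obtain ⟨x, a, hx, ha, rfl⟩ := E.idp p m (by omega)
  rw [E.S.add_eq (by omega)] at hp
  have h1 := E.S.nonneg o x
  have h2 := E.pos (E.ne_zero ha) o
  by_cases hx0 : x = 0
  · rw [hx0, zero_add]; exact ha
  · have := E.pos hx0 o
    omega

theorem wrap (E : Ex d k n c) {o : ι} {p : G} (hp : c o p = 1) (hpA : ht n c p = 1) :
    ∃ w : G → ι → ℤ, (∀ g j, c o g * c j p - c j g = n * w g j) ∧ (∀ g j, 0 ≤ w g j) ∧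
      (∀ g, w g o = 0) ∧ ∀ g, ∑ j, w g j = c o g - ht n c g := by
  have npos := E.S.pos
  have h : ∀ (y : G) (j : ι), n ∣ c o y * c j p - c j y := by
    intro y j
    obtain ⟨t, ht⟩ := Int.eq_ofNat_of_zero_le (E.S.nonneg o y)
    have : y = t • p := by
      apply E.cinj o
      symm
      apply E.S.eq_of_modEq (E.S.nonneg o y) (E.S.lt o y)
      have := E.smul_mod o t p
      rw [hp, mul_one] at this
      rwa [ht]
    have h2 := E.smul_mod j t p
    rw [← this] at h2
    rw [ht, dvd_sub_comm]
    exact h2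
  choose w hw using h
  refine ⟨w, hw, fun g j => ?_, fun g => ?_, fun g => ?_⟩
  · have h1 := hw g j
    have h2 := E.S.lt j g
    have h3 := E.S.nonneg o g
    have h4 := E.S.nonneg j p
    by_contra hh
    push Not at hh
    nlinarith [mul_nonneg h3 h4]
  · have := hw g o
    rw [hp, mul_one, sub_self] at this
    rcases mul_eq_zero.1 this.symm with h | h
    · omega
    · exact h
  · apply mul_left_cancel₀ npos.ne'
    rw [Finset.mul_sum, ← Finset.sum_congr rfl (fun j _ => hw g j), Finset.sum_sub_distrib,
      ← Finset.mul_sum, E.sumA hpA, E.S.ht_mul]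
    ring

theorem idp_le (E : Ex d k n c) {o : ι} {b s : ℤ}
    (h : ∀ y, ht n c y = 1 → c o y < b → c o y ≤ s) (m : ℕ) :
    ∀ g, ht n c g = m → c o g < b → c o g ≤ m * s := by
  induction m with
  | zero =>
    intro g hg _
    have : g = 0 := E.S.eq_zero_of_ht (by simpa using hg.le)
    rw [this, E.S.zero]; simp
  | succ m ih =>
    intro g hg hb
    obtain ⟨x, a, hx, ha, rfl⟩ := E.idp g m (by rw [hg]; push_cast; ring)
    have h1 := E.S.add_eq (g := x) (g' := a) (by rw [hg, hx, ha]; push_cast; ring) o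
    have h2 := E.S.nonneg o x
    have h3 := E.S.nonneg o a
    have h4 := ih x hx (by omega)
    have h5 := h a ha (by omega)
    rw [h1]; push_cast; linarith

theorem Fbound (E : Ex d k n c) {o : ι} {x : G} (hx : ht n c x = 1) {J : ℤ} (hJ : 0 ≤ J)
    (h : ∀ y, ht n c y = 1 → y ≠ x → o ∈ I c y x → c o y ≤ J) : c o x ≤ 1 + d * J := by
  classical
  have hF := (E.F_aux hx).1 o
  rw [← Finset.sum_filter] at hF
  have h1 : ∀ y ∈ ((A n c).erase x).filter (fun y => o ∈ I c y x), (d + 1 - (I c y x).card : ℤ) ≤ d := by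
    intro y hy
    have : 0 < (I c y x).card := Finset.card_pos.2 (E.I_nonempty hx y)
    omega
  have h2 := Finset.sum_le_card_nsmul _ _ _ h1
  have h3 : (((A n c).erase x).filter (fun y => o ∈ I c y x)).card ≤ (Finset.Icc (1:ℤ) J).card := by
    apply Finset.card_le_card_of_injOn (c o)
    · intro y hy
      simp only [Finset.coe_filter, Finset.mem_erase, mem_A, Set.mem_setOf_eq] at hy
      simp only [Finset.coe_Icc, Set.mem_Icc]
      exact ⟨E.pos (E.ne_zero hy.1.2) o, h y hy.1.2 hy.1.1 hy.2⟩
    · intro y _ z _ hyz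
      exact E.cinj o hyz
  rw [Int.card_Icc] at h3
  have h4 : ((((A n c).erase x).filter (fun y => o ∈ I c y x)).card : ℤ) ≤ J := by omega
  rw [nsmul_eq_mul] at h2
  nlinarith

theorem ge_of_le (E : Ex d k n c) {o : ι} {y v : G} (hy : ht n c y = 1) (hv : ht n c v = 1)
    (h : ∀ j, j ≠ o → 2 * c j y ≤ c j v) : n + c o v ≤ 2 * c o y := by
  classical
  have a := E.sum_split hy o
  have b := E.sum_split hv o
  have : ∑ j ∈ Finset.univ.erase o, 2 * c j y ≤ ∑ j ∈ Finset.univ.erase o, c j v :=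
      Finset.sum_le_sum (fun j hj => h j (Finset.ne_of_mem_erase hj))
  rw [← Finset.mul_sum] at this
  linarith

theorem not_dvd_one (E : Ex d k n c) : ¬ (d : ℤ) ∣ 1 := by
  intro h
  have := Int.le_of_dvd one_pos h
  have := E.hd
  omega

/-- Lemma U -/
theorem lemU (E : Ex d k n c) {o : ι} {z : G} (hz : ht n c z = 1)
    (hmax : ∀ y, ht n c y = 1 → c o y ≤ c o z) (hzn : n < 2 * c o z) :
    (∀ i, (d : ℤ) ∣ c i z - 1) ∧ (∀ u, ht n c u = 1 → n < 2 * c o u → Par c o u z) := by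
  classical
  have zmod : ∀ i, (d : ℤ) ∣ c i z - 1 := by
    intro i
    refine (E.mod_gen hz i (fun j _ y hy hc => ?_)).1
    by_cases hj : j = o
    · subst hj
      have := hc.gt E hz hy
      have := hmax y hy
      omega
    · have := E.colC hz hy (Ne.symm hj) hc
      omega
  refine ⟨zmod, ?_⟩
  by_contra hcon
  push Not at hcon
  obtain ⟨u0, h1, h2, h3⟩ := hcon
  obtain ⟨u, hu, humax⟩ := Finset.exists_max_image
    (Finset.univ.filter (fun u => ht n c u = 1 ∧ n < 2 * c o u ∧ ¬ Par c o u z)) (c o)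
    ⟨u0, by simp [h1, h2, h3]⟩
  simp only [Finset.mem_filter, Finset.mem_univ, true_and] at hu humax
  obtain ⟨hu1, hu2, hu3⟩ := hu
  have hgt : ∀ y, ht n c y = 1 → n < 2 * c o y → c o u < c o y → Par c o y z := by
    intro y hy hy2 hlt
    by_contra hh
    have := humax y ⟨hy, hy2, hh⟩
    omega
  have umod : ∀ i, (d : ℤ) ∣ c i u - 1 := by
    intro i
    refine (E.mod_gen hu1 i (fun j _ y hy hc => ?_)).1
    by_cases hj : j = o
    · subst hj
      have h4 := hc.gt E hu1 hy
      exact hu3 (Par.trans E hy (hgt y hy (by omega) h4) (fun j l hj hl => hc.prop E hu1 hj hl))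
    · have := E.colC hu1 hy (Ne.symm hj) hc
      omega
  obtain ⟨hv, hvo, hvj⟩ := E.addA hu1 hz (i := o) (by omega)
  obtain ⟨y0, hy0, hc0⟩ := E.dir_of hv o (by
    intro i hi hdv
    rw [hvj i hi] at hdv
    have := (hdv.sub (umod i)).sub (zmod i)
    apply E.not_dvd_one
    rwa [show c i u + c i z - 1 - (c i u - 1) - (c i z - 1) = 1 by ring] at this)
  obtain ⟨y, hy, hc, hle, hyn⟩ := E.half hv hy0 hc0
  have h5 := E.ge_of_le hy hv hle
  have hne : u ≠ z := by
    rintro rfl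
    exact hu3 (fun j l _ _ => by ring)
  have h6 : c o u < c o z := lt_of_le_of_ne (hmax u hu1) (fun h => hne (E.cinj o h))
  have h7 := hgt y hy hyn (by omega)
  have h8 : Par c o (u + z) z := Par.trans E hy h7 (fun j l hj hl => hc.prop E hv hj hl)
  apply hu3
  intro j l hj hl
  have := h8 j l hj hl
  rw [hvj j hj, hvj l hl] at this
  linarith

/-- final contradiction -/
theorem final (E : Ex d k n c) {o l : ι} {p x : G} (hp : c o p = 1) (hpA : ht n c p = 1)
    (hl : l ≠ o) (hal : n < 2 * c l p) (hx : ht n c x = 1)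
    (hxa : ∀ i, i ≠ o → i ≠ l → c i x < c i p) (hEx : ∃ y, ht n c y = 1 ∧ Col c o y x)
    (hEp : ∀ j y, ht n c y = 1 → ¬ Col c j y p) : False := by
  classical
  have pmod : ∀ i, (d : ℤ) ∣ c i p - 1 := fun i => (E.mod_gen hpA i (fun j _ y hy => hEp j y hy)).1
  obtain ⟨z, hz, hzmax⟩ := Finset.exists_max_image (A n c) (c o) ⟨p, mem_A.2 hpA⟩
  rw [mem_A] at hz
  have hzmax : ∀ y, ht n c y = 1 → c o y ≤ c o z := fun y hy => hzmax y (mem_A.2 hy)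
  obtain ⟨y, hy, hyc⟩ := hEx
  obtain ⟨y0, hy0, hc0, hle0, hn0⟩ := E.half hx hy hyc
  have hzn : n < 2 * c o z := by have := hzmax y0 hy0; omega
  obtain ⟨zmod, hU⟩ := E.lemU hz hzmax hzn
  have hzy : ∀ j, j ≠ o → c j z ≤ c j y0 := by
    by_contra hcon
    push Not at hcon
    obtain ⟨j, hj, hlt⟩ := hcon
    have hpar := hU y0 hy0 hn0
    have : Col c o y0 z := E.mkCol hz hy0 hpar hj hlt
    have := this.gt E hz hy0
    have := hzmax y0 hy0
    omega
  have hza : ∀ j, j ≠ o → c j z < c j p := by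
    intro j hj
    by_cases hjl : j = l
    · subst hjl
      have := E.two_lt hz hj
      omega
    · have h1 := hzy j hj
      have h2 := hle0 j hj
      have h3 := hxa j hj hjl
      have h4 := E.pos (E.ne_zero hx) j
      omega
  have h1 : ∀ j, j ≠ o → c j (p - z) = c j p - c j z := fun j hj => E.sub_ge (hza j hj).le
  have hgo := E.gt_of_lt hpA hz hza
  have h2 := E.sub_lt hgo
  have h3 : ht n c (p - z) = 1 := by
    apply E.S.ht_eq
    rw [← Finset.add_sum_erase _ _ (Finset.mem_univ o), h2,
      Finset.sum_congr rfl (fun j hj => h1 j (Finset.ne_of_mem_erase hj)), Finset.sum_sub_distrib]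
    have a := E.sum_split hpA o
    have b := E.sum_split hz o
    linarith
  obtain ⟨v0, hv0, hcv0⟩ := E.dir_of h3 o (by
    intro i hi hdv
    rw [h1 i hi] at hdv
    have := (pmod i).sub ((hdv).add (zmod i))
    apply E.not_dvd_one
    rwa [show c i p - 1 - (c i p - c i z - 1 + (c i z - 1)) = 1 by ring] at this)
  obtain ⟨v, hv, hcv, -, hvn⟩ := E.half h3 hv0 hcv0
  have h4 := Par.trans E hv (hU v hv hvn) (fun j l hj hl => hcv.prop E h3 hj hl)
  obtain ⟨q, hq, _⟩ := E.exists_off o o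
  refine hEp o z hz (E.mkCol hpA hz (fun j l hj hl => ?_) hq (hza q hq))
  have := h4 j l hj hl
  rw [h1 j hj, h1 l hl] at this
  linarith

set_option maxHeartbeats 2000000 in
theorem main (E : Ex d k n c) : ∃ u i, ∀ j, j ≠ i → c j u = 1 := by
  classical
  have npos := E.S.pos
  have hd := E.hd
  have hn := E.hn
  have hk := E.hk
  have : Nonempty ι := by
    rw [← Fintype.card_pos_iff, E.cι]; omega
  obtain ⟨o⟩ := this
  obtain ⟨p, hp, hpA⟩ := E.exists_p o
  obtain ⟨w, hw, w0, wo, wsum⟩ := E.wrap hp hpA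
  have pp := fun j => E.pos (E.ne_zero hpA) j
  have hoI : ∀ x, o ∈ I c p x := by
    intro x
    rw [mem_I]; intro j
    have := hw x j
    rw [hp]
    nlinarith [w0 x j]
  have hI : ∀ x, ht n c x = 1 → ∀ j, j ∈ I c p x ↔ w x j = 0 := by
    intro x hx j
    rw [E.ratio hx (hoI x) j, hp]
    have := hw x j
    constructor
    · intro h
      have : n * w x j = 0 := by rw [← this]; linarith
      rcases mul_eq_zero.1 this with h | h
      · omega
      · exact h
    · intro h; rw [h] at this; linarith
  by_cases hAW : ∃ x, ht n c x = 1 ∧ x ≠ p ∧ ∀ j, j ≠ o → 1 ≤ w x j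
  · obtain ⟨x0, hx0⟩ := hAW
    obtain ⟨x, hx, hxmin⟩ := Finset.exists_min_image
      (Finset.univ.filter (fun x => ht n c x = 1 ∧ x ≠ p ∧ ∀ j, j ≠ o → 1 ≤ w x j)) (c o)
      ⟨x0, by simpa using hx0⟩
    simp only [Finset.mem_filter, Finset.mem_univ, true_and] at hx hxmin
    obtain ⟨hx, hxp, hxw⟩ := hx
    have px := fun j => E.pos (E.ne_zero hx) j
    have hwx := wsum x
    rw [hx] at hwx
    -- b ≥ d + 1
    have hb1 : (d : ℤ) + 1 ≤ c o x := by
      have h1 : ∑ j ∈ Finset.univ.erase o, (1:ℤ) ≤ ∑ j ∈ Finset.univ.erase o, w x j :=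
        Finset.sum_le_sum (fun j hj => hxw j (Finset.ne_of_mem_erase hj))
      rw [Finset.sum_const, Finset.card_erase_of_mem (Finset.mem_univ o), Finset.card_univ, E.cι] at h1
      rw [← Finset.add_sum_erase _ _ (Finset.mem_univ o), wo] at hwx
      rw [nsmul_eq_mul, mul_one, Nat.add_sub_cancel] at h1
      linarith
    obtain ⟨σ, hσ, hσmax⟩ := Finset.exists_max_image
      (Finset.univ.filter (fun y => ht n c y = 1 ∧ c o y < c o x)) (c o)
      ⟨p, by simp [hpA, hp]; omega⟩
    simp only [Finset.mem_filter, Finset.mem_univ, true_and] at hσ hσmax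
    obtain ⟨hσ, hσb⟩ := hσ
    have hs : ∀ y, ht n c y = 1 → c o y < c o x → c o y ≤ c o σ := fun y a b => hσmax y ⟨a, b⟩
    have hidp := E.idp_le hs
    have hs1 := E.pos (E.ne_zero hσ) o
    by_cases hs2 : c o σ ≤ 1
    · -- s = 1
      obtain ⟨g, hg⟩ := E.csurj o d (by omega) (by have := E.S.lt o x; omega)
      have hg0 : g ≠ 0 := by rintro rfl; rw [E.S.zero] at hg; omega
      obtain ⟨m, hm⟩ := Int.eq_ofNat_of_zero_le (E.S.ht_nonneg g)
      have h1 := hidp m g hm (by omega)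
      have h2 := E.ht_le g
      have h3 : c o σ = 1 := by omega
      rw [h3, mul_one] at h1
      have h4 := E.htneg hg0
      refine ⟨-g, o, E.ones (by rw [h4]; omega) o ?_⟩
      rw [E.neg hg0]; omega
    · exfalso
      push Not at hs2
      have hσp : σ ≠ p := by rintro rfl; omega
      have hcol : ∃ l, Col c l p σ := by
        rcases E.I_card hσ hpA hσp.symm with h | h
        · exfalso
          have := hxmin σ ⟨hσ, hσp, fun j hj => ?_⟩
          · omega
          · by_contra hh
            have := w0 σ j
            have h1 : j ∈ I c p σ := (hI σ hσ j).2 (by omega)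
            exact hj (Finset.card_le_one.1 h.le j h1 o (hoI σ))
        · exact E.exists_col h
      obtain ⟨l, hcl⟩ := hcol
      have hlo : l ≠ o := ((hcl o).1 (hoI σ)).symm
      have hwσ : w σ l = c o σ - 1 := by
        have := wsum σ
        rw [hσ, ← Finset.add_sum_erase _ _ (Finset.mem_univ l),
          Finset.sum_eq_zero (fun j hj => (hI σ hσ j).1 ((hcl j).2 (Finset.ne_of_mem_erase hj)))] at this
        linarith
      obtain ⟨e, he⟩ : ∃ e, e = n - c l p := ⟨_, rfl⟩
      have hse : c o σ * e < n := by
        have h1 := hw σ l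
        rw [hwσ] at h1
        have := E.pos (E.ne_zero hσ) l
        rw [he]; nlinarith
      have he0 : 0 < e := by have := E.S.lt l p; omega
      have hal : n < 2 * c l p := by nlinarith
      have hyl : ∀ y, ht n c y = 1 → c o y < c o x → c l y = n - c o y * e := by
        intro y hy hyb
        have h1 := hs y hy hyb
        have h2 := E.pos (E.ne_zero hy) o
        have h3 : c o y * e ≤ c o σ * e := by nlinarith
        apply E.S.eq_of_modEq
        · linarith
        · nlinarith
        · have := hw y l
          exact ⟨c o y - 1 - w y l, by rw [he]; linear_combination -this⟩
      -- β
      obtain ⟨β, hβ⟩ : ∃ β, β = c o x - w x l := ⟨_, rfl⟩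
      have hxl : c l x = n * β - c o x * e := by
        have := hw x l
        rw [hβ, he]; linear_combination -this
      have hjβ : ∀ y, ht n c y = 1 → y ≠ x → o ∈ I c y x → c o y * β ≤ c o x := by
        intro y hy hne hoy
        have h1 := E.I_lt hx hy hne hoy
        have h2 := mem_I.1 hoy l
        rw [hyl y hy h1, hxl] at h2
        by_contra hh
        push Not at hh
        nlinarith
      have hlm : l ∈ Finset.univ.erase o := by simp [hlo]
      have hcard : (((Finset.univ.erase o).erase l).card : ℤ) = d - 1 := by
        rw [Finset.card_erase_of_mem hlm, Finset.card_erase_of_mem (Finset.mem_univ o),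
          Finset.card_univ, E.cι]
        omega
      have hge : ∀ j ∈ (Finset.univ.erase o).erase l, 1 ≤ w x j :=
        fun j hj => hxw j (Finset.ne_of_mem_erase (Finset.mem_of_mem_erase hj))
      rw [← Finset.add_sum_erase _ _ (Finset.mem_univ o), ← Finset.add_sum_erase _ _ hlm, wo] at hwx
      have hsum1 : ∑ j ∈ (Finset.univ.erase o).erase l, (1:ℤ) = d - 1 := by
        rw [Finset.sum_const, nsmul_eq_mul, hcard, mul_one]
      have hsge := Finset.sum_le_sum hge
      rw [hsum1] at hsge
      have hβd : (d:ℤ) ≤ β := by omega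
      have hJ := E.Fbound hx (o := o) (J := c o x / β) (Int.ediv_nonneg (by omega) (by omega)) (by
        intro y hy hne hoy
        rw [Int.le_ediv_iff_mul_le (by omega)]
        exact hjβ y hy hne hoy)
      have hJ2 : c o x / β * β ≤ c o x := Int.ediv_mul_le _ (by omega)
      have hβe : β = d := by
        by_contra hne
        have h1 : (d:ℤ) + 1 ≤ β := by omega
        have h2 : c o x / β ≤ 1 := by
          have : 0 ≤ c o x / β := Int.ediv_nonneg (by omega) (by omega)
          by_contra hh
          push Not at hh
          nlinarith
        have h3 := hxw l hlo
        have h4 : c o x ≤ 1 + d := by nlinarith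
        omega
      have hw1 : ∀ j, j ≠ o → j ≠ l → w x j = 1 := by
        intro j hjo hjl
        have : ∑ j ∈ (Finset.univ.erase o).erase l, (1:ℤ) = ∑ j ∈ (Finset.univ.erase o).erase l, w x j := by
          rw [hsum1]; omega
        exact ((Finset.sum_eq_sum_iff_of_le hge).1 this j (by simp [hjo, hjl])).symm
      have hxi : ∀ j, j ≠ o → j ≠ l → c j x = c o x * c j p - n := by
        intro j hjo hjl
        have := hw x j
        rw [hw1 j hjo hjl] at this
        linarith
      rw [hβe] at hxl
      have hsmall : ∀ j, j ≠ o → j ≠ l → (c o x - 1) * c j p < n := by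
        obtain ⟨g, hg⟩ := E.csurj o (c o x - 1) (by omega) (by have := E.S.lt o x; omega)
        obtain ⟨m, hm⟩ := Int.eq_ofNat_of_zero_le (E.S.ht_nonneg g)
        have h1 := hidp m g hm (by omega)
        have hm0 : (0:ℤ) < m := by
          by_contra hh
          have : (m:ℤ) = 0 := by omega
          rw [this] at h1; omega
        have h2 : (c o x - 1) * e < m * n := by
          rw [hg] at h1
          nlinarith
        have hwl : c o x - 1 - m ≤ w g l := by
          have h3 := hw g l
          have h4 := E.S.lt l g
          rw [hg, show c l p = n - e by omega] at h3
          by_contra hh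
          push Not at hh
          have : w g l ≤ c o x - 2 - m := by omega
          nlinarith
        have h5 := wsum g
        intro j hjo hjl
        have hjm : j ∈ Finset.univ.erase l := by simp [hjl]
        rw [hm, hg, ← Finset.add_sum_erase _ _ (Finset.mem_univ l), ← Finset.add_sum_erase _ _ hjm] at h5
        have h6 : 0 ≤ ∑ i ∈ (Finset.univ.erase l).erase j, w g i := Finset.sum_nonneg (fun i _ => w0 g i)
        have h7 := w0 g j
        have h8 : w g j = 0 := by omega
        have h9 := hw g j
        rw [h8, hg] at h9
        have := E.S.lt j g
        linarith
      have hxa : ∀ j, j ≠ o → j ≠ l → c j x < c j p := by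
        intro j hjo hjl
        have := hsmall j hjo hjl
        rw [hxi j hjo hjl]
        linarith
      have hEp : ∀ j y, ht n c y = 1 → ¬ Col c j y p := by
        intro j y hy hc
        by_cases hj : j = o
        · subst hj
          have := E.colC hpA hy hlo hc
          omega
        · have := hc.lt E hpA hy (Ne.symm hj)
          have := E.pos (E.ne_zero hy) o
          omega
      have pmod : ∀ i, (d : ℤ) ∣ c i p - 1 :=
        fun i => (E.mod_gen hpA i (fun j _ y hy => hEp j y hy)).1
      have hxl0 : (d : ℤ) ∣ c l x := by
        obtain ⟨r, hr⟩ := pmod l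
        rw [hxl, he, hn]
        exact ⟨d * k + 1 - c o x * k + c o x * r, by linear_combination c o x * hr⟩
      refine E.final hp hpA hlo hal hx hxa ?_ hEp
      by_contra hno
      push Not at hno
      have h1 : ∃ j y, ht n c y = 1 ∧ Col c j y x := by
        by_contra hh
        push Not at hh
        have := (E.mod_gen hx l (fun j _ y hy => hh j y hy)).1
        apply E.not_dvd_one
        have := hxl0.sub this
        rwa [show c l x - (c l x - 1) = 1 by ring] at this
      obtain ⟨j, y, hy, hc⟩ := h1
      have hjo : j ≠ o := by
        rintro rfl; exact hno y hy hc
      obtain ⟨m1, m2⟩ := E.mod_gen hx j (fun l hl y' hy' hc' => E.dir hx hy' hy hl hc' hc)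
      have hjl : j ≠ l := by
        rintro rfl
        apply E.not_dvd_one
        have := hxl0.sub m1
        rwa [show c j x - (c j x - 1) = 1 by ring] at this
      have h2 := m2 o l hjo.symm hjl.symm
      obtain ⟨r1, hr1⟩ := h2
      obtain ⟨r2, hr2⟩ := hxl0
      obtain ⟨r3, hr3⟩ := m1
      obtain ⟨r4, hr4⟩ := pmod j
      rw [hxi j hjo hjl] at hr3
      have : (d : ℤ) ∣ 2 :=
        ⟨r1 + r2 - r3 + c o x * r4 - k, by
          linear_combination hr1 + hr2 - hr3 + c o x * hr4 - hn⟩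
      have := Int.le_of_dvd two_pos this
      omega
  · push Not at hAW
    by_cases hk1 : k = 1
    · refine ⟨p, o, E.ones hpA o ?_⟩
      rw [hn, hp, hk1]; simp
    · obtain ⟨x, hx, hxmax⟩ := Finset.exists_max_image (A n c) (c o) ⟨p, mem_A.2 hpA⟩
      rw [mem_A] at hx
      have hkx : (k : ℤ) ≤ c o x := by
        have h3 : (A n c).card ≤ (Finset.Icc (1:ℤ) (c o x)).card := by
          apply Finset.card_le_card_of_injOn (c o)
          · intro y hy
            have hy' := mem_A.1 hy
            simp only [Finset.coe_Icc, Set.mem_Icc]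
            exact ⟨E.pos (E.ne_zero hy') o, hxmax y hy⟩
          · intro y _ z _ hyz
            exact E.cinj o hyz
        have h4 : (A n c).card = k := by rw [← E.cA, A]
        rw [h4, Int.card_Icc] at h3
        have := E.S.nonneg o x
        omega
      have hxp : x ≠ p := by rintro rfl; omega
      obtain ⟨j, hj, hwj⟩ := hAW x hx hxp
      have hj0 : w x j = 0 := by have := w0 x j; omega
      obtain ⟨l, hcl⟩ := E.col_of_two hx hpA hxp.symm hj ((hI x hx j).2 hj0) (hoI x)
      have hwl : w x l = c o x - 1 := by
        have := wsum x
        rw [hx, ← Finset.add_sum_erase _ _ (Finset.mem_univ l),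
          Finset.sum_eq_zero (fun j hj => (hI x hx j).1 ((hcl j).2 (Finset.ne_of_mem_erase hj)))] at this
        linarith
      refine ⟨p, l, E.ones hpA l ?_⟩
      have h1 := hw x l
      rw [hwl] at h1
      have h2 := E.pos (E.ne_zero hx) l
      by_contra hh
      push Not at hh
      have h3 : c o x * (n - c l p) < n := by nlinarith
      have h4 : (d : ℤ) * k ≤ d * c o x := by nlinarith
      nlinarith

end Ex


def DeltaSet (d : ℕ) (t : ℝ) : Set (Fin d → ℝ) := {x | (∀ i, 0 ≤ x i) ∧ ∑ i, x i ≤ t}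

theorem DeltaSet_closed (d : ℕ) (t : ℝ) : IsClosed (DeltaSet d t) := by
  have h : DeltaSet d t = (⋂ i, {x | 0 ≤ x i}) ∩ {x | ∑ i, x i ≤ t} := by
    ext x; simp [DeltaSet]
  rw [h]
  refine IsClosed.inter (isClosed_iInter fun i => ?_) ?_
  · exact isClosed_le continuous_const (continuous_apply i)
  · exact isClosed_le (by fun_prop) continuous_const

theorem volume_DeltaSet (d : ℕ) : ∀ t : ℝ, 0 ≤ t →
    volume (DeltaSet d t) = ENNReal.ofReal (t ^ d / (Nat.factorial d : ℝ)) := by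
  induction d with
  | zero =>
    intro t ht
    have : DeltaSet 0 t = univ := by ext x; simp [DeltaSet, ht]
    rw [this]; simp [volume_pi]
  | succ d ih =>
    intro t ht
    have e := volume_preserving_piFinSuccAbove (fun _ : Fin (d+1) => ℝ) 0
    have hm : MeasurableSet (DeltaSet (d+1) t) := (DeltaSet_closed _ _).measurableSet
    have h1 := (e.symm).measure_preimage hm.nullMeasurableSet
    rw [← h1]
    have hm2 : MeasurableSet ((MeasurableEquiv.piFinSuccAbove (fun _ : Fin (d+1) => ℝ) 0).symm ⁻¹'
      (DeltaSet (d+1) t)) := (MeasurableEquiv.measurable _) hm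
    rw [show (volume : Measure (ℝ × (Fin d → ℝ))) = (volume : Measure ℝ).prod volume from rfl]
    erw [Measure.prod_apply hm2]
    have hs : ∀ s : ℝ, volume (Prod.mk s ⁻¹'
        ((MeasurableEquiv.piFinSuccAbove (fun _ : Fin (d+1) => ℝ) 0).symm ⁻¹'
      (DeltaSet (d+1) t))) = (Icc (0:ℝ) t).indicator
        (fun s => ENNReal.ofReal ((t - s) ^ d / (Nat.factorial d : ℝ))) s := by
      intro s
      have hset : (Prod.mk s ⁻¹'
        ((MeasurableEquiv.piFinSuccAbove (fun _ : Fin (d+1) => ℝ) 0).symm ⁻¹'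
          (DeltaSet (d+1) t))) = {y : Fin d → ℝ | 0 ≤ s ∧ y ∈ DeltaSet d (t - s)} := by
        ext y
        simp [DeltaSet, MeasurableEquiv.piFinSuccAbove, Fin.forall_fin_succ, Fin.sum_univ_succ]
        constructor
        · rintro ⟨⟨a, b⟩, c⟩; exact ⟨a, b, by linarith⟩
        · rintro ⟨a, b, c⟩; exact ⟨⟨a, b⟩, by linarith⟩
      rw [hset]
      by_cases h : s ∈ Icc (0:ℝ) t
      · rw [indicator_of_mem h, ← ih (t - s) (by linarith [h.2])]
        congr 1
        ext y; simp [h.1]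
      · rw [indicator_of_notMem h]
        have : {y : Fin d → ℝ | 0 ≤ s ∧ y ∈ DeltaSet d (t - s)} = ∅ := by
          ext y
          simp only [mem_ofPred_eq, mem_empty_iff_false, iff_false]
          rintro ⟨a, b, c⟩
          apply h
          refine ⟨a, ?_⟩
          have := Finset.sum_nonneg (fun i (_ : i ∈ Finset.univ) => b i)
          linarith
        rw [this]; simp [volume_pi]
    refine (lintegral_congr hs).trans ?_
    rw [lintegral_indicator measurableSet_Icc]
    rw [← ofReal_integral_eq_lintegral_ofReal]
    · congr 1
      rw [integral_Icc_eq_integral_Ioc, ← intervalIntegral.integral_of_le ht,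
        intervalIntegral.integral_div]
      rw [intervalIntegral.integral_comp_sub_left (fun x => x ^ d)]
      simp only [sub_self, sub_zero, integral_pow]
      rw [Nat.factorial_succ]
      have : (Nat.factorial d : ℝ) ≠ 0 := by positivity
      push_cast
      field_simp
      simp
    · apply Continuous.integrableOn_Icc
      fun_prop
    · filter_upwards [ae_restrict_mem measurableSet_Icc] with s hs'
      have : 0 ≤ t - s := by linarith [hs'.2]
      positivity

theorem mem_hull {ι : Type*} [Fintype ι] {E : Type*} [AddCommGroup E] [Module ℝ E] (v : ι → E)
    (x : E) : x ∈ convexHull ℝ (range v) ↔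
      ∃ w : ι → ℝ, (∀ i, 0 ≤ w i) ∧ ∑ i, w i = 1 ∧ x = ∑ i, w i • v i := by
  classical
  have h : range v = (Fintype.linearCombination ℝ v) '' (range fun i : ι ↦ Pi.single i 1) := by
    rw [← range_comp]; congr 1; ext i; simp
  rw [h, ← LinearMap.image_convexHull, convexHull_rangle_single_eq_stdSimplex]
  constructor
  · rintro ⟨w, ⟨h0, h1⟩, rfl⟩
    exact ⟨w, h0, h1, by simp [Fintype.linearCombination_apply]⟩
  · rintro ⟨w, h0, h1, rfl⟩
    exact ⟨w, ⟨h0, h1⟩, by simp [Fintype.linearCombination_apply]⟩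

/-- edge matrix -/
def edgeMat {R : Type*} [Ring R] {d : ℕ} (v : Fin (d+1) → Fin d → R) : Matrix (Fin d) (Fin d) R :=
  Matrix.of fun j i => v i.succ j - v 0 j

theorem hull_eq {d : ℕ} (v : Fin (d+1) → Fin d → ℝ) :
    convexHull ℝ (range v) =
      (fun x => x + v 0) '' ((Matrix.toLin' (edgeMat v)) '' DeltaSet d 1) := by
  ext x
  rw [mem_hull]
  constructor
  · rintro ⟨w, h0, h1, rfl⟩
    rw [Fin.sum_univ_succ] at h1
    refine ⟨_, ⟨fun i => w i.succ, ⟨fun i => h0 _, by linarith [h0 0]⟩, rfl⟩, ?_⟩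
    ext j
    have : w 0 = 1 - ∑ i : Fin d, w i.succ := by linarith
    simp only [Fin.sum_univ_succ, this]
    simp [edgeMat, Matrix.mulVec, dotProduct, sub_mul, Finset.sum_sub_distrib, ← Finset.mul_sum]
    simp only [mul_comm]
    ring
  · rintro ⟨_, ⟨y, ⟨h0, h1⟩, rfl⟩, rfl⟩
    refine ⟨Fin.cons (1 - ∑ i, y i) y, ?_, ?_, ?_⟩
    · intro i; refine Fin.cases ?_ (fun i => ?_) i
      · simpa using h1
      · simpa using h0 i
    · simp [Fin.sum_univ_succ]
    · ext j
      simp only [Fin.sum_univ_succ]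
      simp [edgeMat, Matrix.mulVec, dotProduct, sub_mul, Finset.sum_sub_distrib, ← Finset.mul_sum]
      simp only [mul_comm]
      ring

theorem volume_hull {d : ℕ} (v : Fin (d+1) → Fin d → ℝ) :
    volume (convexHull ℝ (range v)) = ENNReal.ofReal (|(edgeMat v).det| / (Nat.factorial d : ℝ)) := by
  rw [hull_eq, image_add_right, measure_preimage_add_right, Measure.addHaar_image_linearMap,
    volume_DeltaSet _ _ zero_le_one, ← ENNReal.ofReal_mul (abs_nonneg _)]
  congr 1
  simp [div_eq_mul_inv]

/-- vertices of Sdk -/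
def sdkV (d k : ℕ) : Fin (d+1) → Fin d → ℝ := Fin.cons (fun _ => -(k:ℝ)) (fun i => Pi.single i 1)

theorem sdk_det (d k : ℕ) : (edgeMat (sdkV d k)).det = (d * k + 1 : ℕ) := by
  have : edgeMat (sdkV d k) = 1 + Matrix.replicateCol Unit (fun _ => (k:ℝ)) *
      Matrix.replicateRow Unit (fun _ => (1:ℝ)) := by
    ext i j
    simp [edgeMat, sdkV, Matrix.mul_apply, Matrix.one_apply, Pi.single_apply]
  rw [this, Matrix.det_one_add_replicateCol_mul_replicateRow]
  simp [dotProduct]; ring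

theorem sdk_hull (d k : ℕ) : convexHull ℝ
    ((Set.range fun i : Fin d => (Pi.single i 1 : Fin d → ℝ)) ∪ {fun _ => -(k : ℝ)}) =
      convexHull ℝ (range (sdkV d k)) := by
  rw [sdkV, Fin.range_cons, union_comm]; rfl

theorem sdk_vol (d k : ℕ) : volume (convexHull ℝ (range (sdkV d k))) =
    ((d * k + 1 : ℕ) : ℝ≥0∞) / (Nat.factorial d : ℝ≥0∞) := by
  rw [volume_hull, sdk_det, abs_of_nonneg (by positivity), ENNReal.ofReal_div_of_pos (by positivity),
    ENNReal.ofReal_natCast, ENNReal.ofReal_natCast]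


namespace Brd
variable {d : ℕ}

/-- integer barycentric numerators, linear part -/
def L (v : Fin (d+1) → Fin d → ℤ) (s : ℤ) (z : Fin d → ℤ) : Fin (d+1) → ℤ :=
  Fin.cons (-(∑ i, s * ((edgeMat v).adjugate.mulVec z) i))
    (fun i => s * ((edgeMat v).adjugate.mulVec z) i)

variable (v : Fin (d+1) → Fin d → ℤ) (s : ℤ)

theorem L_add (z z' : Fin d → ℤ) : L v s (z + z') = L v s z + L v s z' := by
  ext j
  refine Fin.cases ?_ (fun i => ?_) j
  · simp [L, Matrix.mulVec_add, mul_add, Finset.sum_add_distrib]; ring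
  · simp [L, Matrix.mulVec_add, mul_add]

theorem L_sum (z : Fin d → ℤ) : ∑ j, L v s z j = 0 := by
  simp [L, Fin.sum_univ_succ]

/-- additive hom version -/
def Lh : (Fin d → ℤ) →+ (Fin (d+1) → ℤ) := AddMonoidHom.mk' (L v s) (L_add v s)

theorem Lh_apply (z : Fin d → ℤ) : Lh v s z = L v s z := rfl

theorem L_comb {n : ℤ} (hn : s * (edgeMat v).det = n) (z : Fin d → ℤ) :
    ∑ j, L v s z j • v j = n • z := by
  have h : (edgeMat v).mulVec ((edgeMat v).adjugate.mulVec z) = (edgeMat v).det • z := by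
    rw [Matrix.mulVec_mulVec, Matrix.mul_adjugate, Matrix.smul_mulVec, Matrix.one_mulVec]
  ext j
  have hj := congrFun h j
  simp only [Matrix.mulVec, dotProduct, edgeMat, Matrix.of_apply, Pi.smul_apply, smul_eq_mul] at hj
  simp only [Fin.sum_univ_succ, L, Finset.sum_apply, Pi.add_apply, Pi.smul_apply, smul_eq_mul,
    Fin.cons_zero, Fin.cons_succ, Matrix.mulVec, dotProduct, edgeMat]
  rw [← hn, mul_assoc]
  erw [← hj]
  rw [Finset.mul_sum, neg_mul, Finset.sum_mul, neg_add_eq_sub, ← Finset.sum_sub_distrib]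
  refine Finset.sum_congr rfl fun i _ => ?_
  ring

theorem L_of_comb {n : ℤ} (hn : s * (edgeMat v).det = n) (x : Fin (d+1) → ℤ) (hx : ∑ j, x j = 0) :
    L v s (∑ j, x j • v j) = n • x := by
  have h0 : x 0 = -∑ i : Fin d, x i.succ := by
    rw [Fin.sum_univ_succ] at hx; linarith
  have h1 : ∑ j, x j • v j = (edgeMat v).mulVec (fun i => x i.succ) := by
    ext j
    simp only [Fin.sum_univ_succ, h0, Finset.sum_apply, Pi.add_apply, Pi.smul_apply, smul_eq_mul,
      Matrix.mulVec, dotProduct, edgeMat, Matrix.of_apply]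
    rw [neg_mul, Finset.sum_mul, neg_add_eq_sub, ← Finset.sum_sub_distrib]
    exact Finset.sum_congr rfl fun i _ => by ring
  have h2 : (edgeMat v).adjugate.mulVec (∑ j, x j • v j) = (edgeMat v).det • fun i => x i.succ := by
    rw [h1, Matrix.mulVec_mulVec, Matrix.adjugate_mul, Matrix.smul_mulVec, Matrix.one_mulVec]
  ext j
  refine Fin.cases ?_ (fun i => ?_) j
  · simp only [L, h2, Fin.cons_zero, Pi.smul_apply, smul_eq_mul, h0, ← hn]
    rw [mul_neg, Finset.mul_sum]
    simp only [mul_assoc]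
  · simp only [L, h2, Fin.cons_succ, Pi.smul_apply, smul_eq_mul, ← hn]
    ring

/-- the hom to ZMod -/
def Phi (n : ℕ) : (Fin d → ℤ) →+ (Fin (d+1) → ZMod n) :=
  (AddMonoidHom.pi fun j => (Int.castAddHom (ZMod n)).comp (Pi.evalAddMonoidHom _ j)).comp (Lh v s)

theorem Phi_apply (n : ℕ) (z : Fin d → ℤ) (j) : Phi v s n z j = (L v s z j : ZMod n) := rfl

theorem Phi_ker {n : ℕ} (hn : s * (edgeMat v).det = n) (hn0 : 0 < n) :
    (Phi v s n).ker = ((edgeMat v).mulVecLin.range).toAddSubgroup := by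
  ext z
  rw [AddMonoidHom.mem_ker]
  constructor
  · intro h
    have h1 : ∀ j, ∃ m : ℤ, L v s z j = n * m := by
      intro j
      have := congrFun h j
      rw [Phi_apply, Pi.zero_apply, ZMod.intCast_zmod_eq_zero_iff_dvd] at this
      exact this
    choose m hm using h1
    refine ⟨fun i => m i.succ, ?_⟩
    have hm0 : ∑ j, m j = 0 := by
      have := L_sum v s z
      simp only [hm, ← Finset.mul_sum] at this
      rcases mul_eq_zero.1 this with h | h
      · omega
      · exact h
    have h3 := L_comb v s hn z
    have h4 : (n:ℤ) • (∑ j, m j • v j) = (n:ℤ) • z := by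
      rw [← h3, Finset.smul_sum]
      exact Finset.sum_congr rfl fun j _ => by rw [hm, mul_smul]
    have h5 : ∑ j, m j • v j = z := by
      exact smul_right_injective _ (by exact_mod_cast hn0.ne' : (n:ℤ) ≠ 0) h4
    rw [← h5]
    have h0 : m 0 = -∑ i : Fin d, m i.succ := by
      rw [Fin.sum_univ_succ] at hm0; linarith
    ext j
    simp only [Fin.sum_univ_succ, h0, Finset.sum_apply, Pi.add_apply, Pi.smul_apply, smul_eq_mul,
      Matrix.mulVecLin_apply, Matrix.mulVec, dotProduct, edgeMat, Matrix.of_apply]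
    rw [neg_mul, Finset.sum_mul, neg_add_eq_sub, ← Finset.sum_sub_distrib]
    exact Finset.sum_congr rfl fun i _ => by ring
  · rintro ⟨y, rfl⟩
    have h1 : (edgeMat v).mulVecLin y =
        ∑ j, (Fin.cons (-∑ i, y i) y : Fin (d+1) → ℤ) j • v j := by
      ext j
      simp only [Fin.sum_univ_succ, Finset.sum_apply, Pi.add_apply, Pi.smul_apply, smul_eq_mul,
        Matrix.mulVecLin_apply, Matrix.mulVec, dotProduct, edgeMat, Matrix.of_apply, Fin.cons_zero,
        Fin.cons_succ]
      rw [neg_mul, Finset.sum_mul, neg_add_eq_sub, ← Finset.sum_sub_distrib]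
      exact Finset.sum_congr rfl fun i _ => by ring
    ext j
    rw [Phi_apply, h1, L_of_comb v s hn _ (by simp [Fin.sum_univ_succ])]
    simp

theorem card_range {n : ℕ} (hn : s * (edgeMat v).det = n) (hs : s.natAbs = 1) (hn0 : 0 < n) :
    Nat.card (Phi v s n).range = n := by
  rw [← AddSubgroup.index_ker, Phi_ker v s hn hn0]
  have hdet : (edgeMat v).det ≠ 0 := by
    intro h; rw [h] at hn; simp at hn; omega
  have hinj : Function.Injective (edgeMat v).mulVecLin := by
    rw [Matrix.coe_mulVecLin]
    exact Matrix.mulVec_injective_of_det_ne_zero hdet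
  have h := Submodule.natAbs_det_equiv ((edgeMat v).mulVecLin.range)
    (LinearEquiv.ofInjective (edgeMat v).mulVecLin hinj)
  have h2 : ((edgeMat v).mulVecLin.range).subtype ∘ₗ AddMonoidHom.toIntLinearMap
    ((LinearEquiv.ofInjective (edgeMat v).mulVecLin hinj : _ ≃ₗ[ℤ] _) : _ →+ ((edgeMat v).mulVecLin.range)) = (edgeMat v).mulVecLin := by
    ext x; rfl
  rw [h2] at h
  have h3 : LinearMap.det (edgeMat v).mulVecLin = (edgeMat v).det := by
    rw [← Matrix.toLin'_apply', LinearMap.det_toLin']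
  rw [h3] at h
  have h4 := congrArg Int.natAbs hn
  rw [Int.natAbs_mul, hs, one_mul, h] at h4
  exact h4.trans (Int.natAbs_natCast n)

end Brd


namespace Brd
variable {d : ℕ} (v : Fin (d+1) → Fin d → ℤ) (s : ℤ)

/-- integer barycentric coordinates (times n) -/
def Lam (n : ℕ) (P : Fin d → ℤ) : Fin (d+1) → ℤ := L v s (P - v 0) + (n:ℤ) • Pi.single 0 1

theorem Lam_sum (n : ℕ) (P : Fin d → ℤ) : ∑ j, Lam v s n P j = n := by
  simp [Lam, Finset.sum_add_distrib, L_sum, ← Finset.mul_sum]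

theorem Lam_comb {n : ℕ} (hn : s * (edgeMat v).det = n) (P : Fin d → ℤ) :
    ∑ j, Lam v s n P j • v j = (n:ℤ) • P := by
  have h := L_comb v s hn (P - v 0)
  simp only [Lam, Pi.add_apply, add_smul, Finset.sum_add_distrib, h]
  have : ∑ j, ((n:ℤ) • (Pi.single 0 1 : Fin (d+1) → ℤ)) j • v j = (n:ℤ) • v 0 := by
    rw [Finset.sum_eq_single 0]
    · simp
    · intro j _ hj; simp [hj]
    · simp
  rw [this, smul_sub, sub_add_cancel]

theorem Lam_cast (n : ℕ) (P : Fin d → ℤ) (j) :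
    ((Lam v s n P j : ℤ) : ZMod n) = Phi v s n (P - v 0) j := by
  rw [Phi_apply]; simp [Lam]

/-- the coordinate functions on the group -/
def cc (n : ℕ) (j : Fin (d+1)) (g : (Phi v s n).range) : ℤ := ((g.1 j).val : ℤ)

theorem cc_cast (n : ℕ) [NeZero n] (j : Fin (d+1)) (g : (Phi v s n).range) :
    ((cc v s n j g : ℤ) : ZMod n) = g.1 j := by
  simp [cc]

theorem cc_lt (n : ℕ) [NeZero n] (j : Fin (d+1)) (g : (Phi v s n).range) : cc v s n j g < n := by
  unfold cc; exact_mod_cast ZMod.val_lt _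

theorem cc_ext (n : ℕ) [NeZero n] {g g' : (Phi v s n).range} (h : ∀ j, cc v s n j g = cc v s n j g') :
    g = g' := by
  apply Subtype.ext
  funext j
  rw [← cc_cast, ← cc_cast, h]

theorem sys (n : ℕ) [NeZero n] : Sys (n:ℤ) (cc v s n) where
  pos := by exact_mod_cast Nat.pos_of_ne_zero (NeZero.ne n)
  nonneg := fun j g => by unfold cc; positivity
  lt := fun j g => cc_lt v s n j g
  add := fun j g g' => by
    rw [← ZMod.intCast_zmod_eq_zero_iff_dvd]
    push_cast
    simp only [cc_cast]
    simp
  sum := fun g => by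
    rw [← ZMod.intCast_zmod_eq_zero_iff_dvd]
    push_cast
    simp only [cc_cast]
    obtain ⟨_, z, rfl⟩ := g
    simp only [Phi_apply]
    exact_mod_cast congrArg (Int.cast : ℤ → ZMod n) (L_sum v s z)
  inj := fun g h => by
    apply cc_ext
    intro j
    rw [h j]
    simp [cc]

theorem lift {n : ℕ} [NeZero n] (hn : s * (edgeMat v).det = n) (g : (Phi v s n).range)
    (hg : ∑ j, cc v s n j g = n) : ∃ P, ∀ j, Lam v s n P j = cc v s n j g := by
  obtain ⟨z, hz⟩ := g.2
  have h1 : ∀ j, ∃ m : ℤ, cc v s n j g - L v s z j = n * m := by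
    intro j
    have : ((cc v s n j g - L v s z j : ℤ) : ZMod n) = 0 := by
      push_cast
      rw [cc_cast, ← hz, Phi_apply, sub_self]
    exact (ZMod.intCast_zmod_eq_zero_iff_dvd _ _).1 this
  choose m hm using h1
  have hn0 : (n:ℤ) ≠ 0 := by exact_mod_cast NeZero.ne n
  have hm1 : ∑ j, m j = 1 := by
    have : (n:ℤ) * ∑ j, m j = n * 1 := by
      rw [Finset.mul_sum, ← Finset.sum_congr rfl (fun j _ => hm j), Finset.sum_sub_distrib, hg, L_sum]
      ring
    exact mul_left_cancel₀ hn0 this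
  refine ⟨z + ∑ j, m j • v j, fun j => ?_⟩
  have h2 : z + ∑ j, m j • v j - v 0 = z + ∑ j, (m j - (Pi.single 0 1 : Fin (d+1) → ℤ) j) • v j := by
    simp only [sub_smul, Finset.sum_sub_distrib]
    have : ∑ j, (Pi.single 0 1 : Fin (d+1) → ℤ) j • v j = v 0 := by
      rw [Finset.sum_eq_single 0]
      · simp
      · intro j _ hj; simp [hj]
      · simp
    rw [this]; abel
  rw [Lam, h2, L_add, L_of_comb v s hn (fun j => m j - (Pi.single 0 1 : Fin (d+1) → ℤ) j)
    (by rw [Finset.sum_sub_distrib, hm1]; simp)]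
  have := hm j
  simp only [Pi.add_apply, Pi.smul_apply, smul_eq_mul]
  linarith

theorem Lam_inj {n : ℕ} [NeZero n] (hn : s * (edgeMat v).det = n) {P Q : Fin d → ℤ}
    (h : Lam v s n P = Lam v s n Q) : P = Q := by
  have h1 := Lam_comb v s hn P
  rw [h, Lam_comb v s hn Q] at h1
  have hn0 : (n:ℤ) ≠ 0 := by exact_mod_cast NeZero.ne n
  exact (smul_right_injective _ hn0 h1).symm

/-- real cast -/
def toR (P : Fin d → ℤ) : Fin d → ℝ := fun j => (P j : ℝ)

theorem toR_inj {P Q : Fin d → ℤ} (h : toR P = toR Q) : P = Q := by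
  funext j
  have h1 : (P j : ℝ) = Q j := congrFun h j
  exact_mod_cast h1

theorem toR_lat (P : Fin d → ℤ) : IsLatticePt d (toR P) := fun i => ⟨P i, rfl⟩

theorem lat_toR {x : Fin d → ℝ} (h : IsLatticePt d x) : ∃ P, x = toR P := by
  choose P hP using h
  exact ⟨P, funext hP⟩

theorem coord_eq {n : ℕ} [NeZero n] (hn : s * (edgeMat v).det = n)
    (b : AffineBasis (Fin (d+1)) ℝ (Fin d → ℝ)) (hb : ∀ i, b i = toR (v i)) (P : Fin d → ℤ) (j) :
    b.coord j (toR P) = (Lam v s n P j : ℝ) / n := by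
  have hn0 : (n:ℝ) ≠ 0 := by exact_mod_cast NeZero.ne n
  have hsum : ∑ j, (Lam v s n P j : ℝ) / n = 1 := by
    rw [← Finset.sum_div]
    have : (∑ j, (Lam v s n P j : ℝ)) = n := by exact_mod_cast Lam_sum v s n P
    rw [this, div_self hn0]
  have hP : toR P = Finset.univ.affineCombination ℝ b (fun j => (Lam v s n P j : ℝ) / n) := by
    rw [Finset.affineCombination_eq_linear_combination _ _ _ hsum]
    ext t
    have h := congrFun (Lam_comb v s hn P) t
    simp only [Finset.sum_apply, Pi.smul_apply, smul_eq_mul] at h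
    have h' : ∑ j, (Lam v s n P j : ℝ) * (v j t : ℝ) = n * P t := by exact_mod_cast h
    simp only [Finset.sum_apply, Pi.smul_apply, smul_eq_mul, hb, toR]
    rw [eq_comm, ← mul_right_inj' hn0, ← h', Finset.mul_sum]
    refine Finset.sum_congr rfl fun i _ => ?_
    field_simp
  rw [hP, AffineBasis.coord_apply_combination_of_mem _ (Finset.mem_univ j) hsum]

theorem mkEx {k n : ℕ} (hnk : n = d * k + 1) [NeZero n] (hd : 3 ≤ d) (hk : 1 ≤ k)
    (hs : s.natAbs = 1) (hn : s * (edgeMat v).det = n) [Fintype (Phi v s n).range]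
    (hind : AffineIndependent ℝ (fun i => toR (v i)))
    (hclean : IsClean d (convexHull ℝ (range (fun i => toR (v i)))))
    (hint : {x ∈ interior (convexHull ℝ (range (fun i => toR (v i)))) | IsLatticePt d x}.ncard = k) :
    Ex d k (n:ℤ) (cc v s n) := by
  have hn0 : (0:ℝ) < n := by exact_mod_cast Nat.pos_of_ne_zero (NeZero.ne n)
  have hspan : affineSpan ℝ (range (fun i => toR (v i))) = ⊤ := by
    rw [hind.affineSpan_eq_top_iff_card_eq_finrank_add_one]; simp
  let b : AffineBasis (Fin (d+1)) ℝ (Fin d → ℝ) := ⟨fun i => toR (v i), hind, hspan⟩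
  have hb : ∀ i, b i = toR (v i) := fun i => rfl
  have hbr : range (fun i => toR (v i)) = range b := rfl
  have hco := coord_eq v s hn b hb
  have hI : ∀ P, toR P ∈ interior (convexHull ℝ (range (fun i => toR (v i)))) ↔
      ∀ j, 0 < Lam v s n P j := by
    intro P
    rw [hbr, AffineBasis.interior_convexHull]
    refine forall_congr' fun j => ?_
    rw [hco, lt_div_iff₀ hn0, zero_mul]
    exact_mod_cast Iff.rfl
  have hH : ∀ P, toR P ∈ (convexHull ℝ (range (fun i => toR (v i)))) ↔
      ∀ j, 0 ≤ Lam v s n P j := by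
    intro P
    rw [hbr, AffineBasis.convexHull_eq_nonneg_coord]
    refine forall_congr' fun j => ?_
    rw [hco, le_div_iff₀ hn0, zero_mul]
    exact_mod_cast Iff.rfl
  have S := sys v s n
  have hht : ∀ a, Sys.ht (n:ℤ) (cc v s n) a = 1 ↔ ∑ j, cc v s n j a = n := by
    intro a
    constructor
    · intro h; rw [S.ht_mul, h, mul_one]
    · intro h; exact S.ht_eq (by rw [h, mul_one])
  have hfull : ∀ a, Sys.ht (n:ℤ) (cc v s n) a = 1 → ∀ j, cc v s n j a ≠ 0 := by
    intro a ha j hj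
    obtain ⟨P, hP⟩ := lift v s hn a ((hht a).1 ha)
    have h1 : toR P ∈ frontier (convexHull ℝ (range (fun i => toR (v i)))) := by
      refine ⟨subset_closure ((hH P).2 fun j => ?_), fun h => ?_⟩
      · rw [hP]; exact S.nonneg _ _
      · have := (hI P).1 h j
        rw [hP, hj] at this; exact lt_irrefl _ this
    have h2 : toR P ∈ extremePoints ℝ (convexHull ℝ (range (fun i => toR (v i)))) := by
      rw [← hclean]; exact ⟨h1, toR_lat P⟩
    obtain ⟨i, hi⟩ := extremePoints_convexHull_subset h2
    have h3 : b.coord i (toR P) = 1 := by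
      rw [← hi]; exact b.coord_apply_eq i
    rw [hco, div_eq_one_iff_eq hn0.ne'] at h3
    have h4 : Lam v s n P i = n := by exact_mod_cast h3
    rw [hP] at h4
    exact (cc_lt v s n i a).ne h4
  have hA : (Finset.univ.filter (fun a => Sys.ht (n:ℤ) (cc v s n) a = 1)).card = k := by
    rw [← hint, ← Set.ncard_coe_finset]
    have hex : ∀ a, a ∈ ((Finset.univ.filter (fun a => Sys.ht (n:ℤ) (cc v s n) a = 1) : Finset _) :
        Set _) → ∃ P, ∀ j, Lam v s n P j = cc v s n j a := fun a ha =>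
      lift v s hn a ((hht a).1 (by simpa using ha))
    choose F hF using hex
    refine Set.ncard_congr (fun a ha => toR (F a ha)) ?_ ?_ ?_
    · intro a ha
      refine ⟨(hI _).2 fun j => ?_, toR_lat _⟩
      rw [hF]
      exact lt_of_le_of_ne (S.nonneg _ _) (Ne.symm (hfull a (by simpa using ha) j))
    · intro a a' ha ha' h
      apply cc_ext
      intro j
      rw [← hF a ha, ← hF a' ha', toR_inj h]
    · rintro x ⟨hx, hl⟩
      obtain ⟨P, rfl⟩ := lat_toR hl
      have hpos := (hI P).1 hx
      have hlt : ∀ j, Lam v s n P j < n := by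
        intro j
        rw [← Lam_sum v s n P]
        have : Nontrivial (Fin (d+1)) := Fin.nontrivial_iff_two_le.2 (by omega)
        obtain ⟨i, hi⟩ := exists_ne j
        exact Finset.single_lt_sum hi (Finset.mem_univ _) (Finset.mem_univ _) (hpos i)
          (fun t _ _ => (hpos t).le)
      let g : (Phi v s n).range := ⟨Phi v s n (P - v 0), ⟨_, rfl⟩⟩
      have hg : ∀ j, cc v s n j g = Lam v s n P j := by
        intro j
        refine S.eq_of_modEq (hpos j).le (hlt j) ?_
        rw [← ZMod.intCast_zmod_eq_zero_iff_dvd]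
        push_cast
        rw [cc_cast, Lam_cast, sub_self]
      have hg1 : g ∈ ((Finset.univ.filter (fun a => Sys.ht (n:ℤ) (cc v s n) a = 1) : Finset _) :
        Set _) := by
        simp only [Finset.coe_filter, Finset.mem_univ, true_and]
        refine (hht g).2 ?_
        rw [Finset.sum_congr rfl fun j _ => hg j, Lam_sum]
      refine ⟨g, hg1, ?_⟩
      congr 1
      apply Lam_inj v s hn
      funext j
      rw [hF, hg]
  exact
    { S := S
      hn := by rw [hnk]; push_cast; ring
      hd := hd
      hk := hk
      cι := by simp
      cG := by
        rw [← Nat.card_eq_fintype_card, card_range v s hn hs (Nat.pos_of_ne_zero (NeZero.ne n)), hnk]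
      full := hfull
      cA := hA }

theorem exists_center {k n : ℕ} (hnk : n = d * k + 1) (hd : 3 ≤ d) (hk : 1 ≤ k)
    (hs : s.natAbs = 1) (hn : s * (edgeMat v).det = n)
    (hind : AffineIndependent ℝ (fun i => toR (v i)))
    (hclean : IsClean d (convexHull ℝ (range (fun i => toR (v i)))))
    (hint : {x ∈ interior (convexHull ℝ (range (fun i => toR (v i)))) | IsLatticePt d x}.ncard = k) :
    ∃ (P : Fin d → ℤ) (i : Fin (d+1)),
      (n:ℤ) • P = v i + ∑ j : Fin d, (k:ℤ) • v (i.succAbove j) := by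
  have : NeZero n := ⟨by omega⟩
  have : Fintype (Phi v s n).range := Fintype.ofFinite _
  have E := mkEx v s hnk hd hk hs hn hind hclean hint
  obtain ⟨u, i, hu⟩ := E.main
  have S := E.S
  have hkn : (k:ℤ) < n := by
    rw [hnk]; push_cast; nlinarith
  have hj : ∀ j, j ≠ i → cc v s n j (k • u) = k := by
    intro j hj
    refine S.eq_of_modEq (by positivity) hkn ?_
    have := E.smul_mod j k u
    rwa [hu j hj, mul_one] at this
  have hi : cc v s n i (k • u) = 1 := by
    refine S.eq_of_modEq (by norm_num) (by omega) ?_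
    have h1 := E.smul_mod i k u
    have h2 := S.sum u
    rw [Fin.sum_univ_succAbove _ i, Finset.sum_congr rfl
      (fun j _ => hu _ (Fin.succAbove_ne i j))] at h2
    simp at h2
    have h3 : cc v s n i (k • u) - 1 = (cc v s n i (k • u) - k * cc v s n i u)
      + k * (cc v s n i u + d) - n := by
        have hN : (n:ℤ) = d * k + 1 := by rw [hnk]; push_cast; ring
        linear_combination hN
    rw [h3]
    exact dvd_sub (dvd_add h1 (Dvd.dvd.mul_left h2 _)) dvd_rfl
  have hsum : ∑ j, cc v s n j (k • u) = n := by
    rw [Fin.sum_univ_succAbove _ i, hi, Finset.sum_congr rfl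
      (fun j _ => hj _ (Fin.succAbove_ne i j)), hnk]
    simp; ring
  obtain ⟨P, hP⟩ := lift v s hn _ hsum
  refine ⟨P, i, ?_⟩
  rw [← Lam_comb v s hn P, Fin.sum_univ_succAbove _ i, hP, hi, one_smul]
  congr 1
  refine Finset.sum_congr rfl fun j _ => ?_
  rw [hP, hj _ (Fin.succAbove_ne i j)]

end Brd


theorem vol_ne_zero (d k : ℕ) : ((d * k + 1 : ℕ) : ℝ≥0∞) / (Nat.factorial d : ℝ≥0∞) ≠ 0 :=
  ENNReal.div_ne_zero.2 ⟨Nat.cast_ne_zero.2 (Nat.succ_ne_zero (d * k)), ENNReal.natCast_ne_top _⟩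

theorem vol_ne_top (d k : ℕ) : ((d * k + 1 : ℕ) : ℝ≥0∞) / (Nat.factorial d : ℝ≥0∞) ≠ ⊤ :=
  ENNReal.div_ne_top (ENNReal.natCast_ne_top _) (by exact_mod_cast Nat.factorial_ne_zero d)

theorem vol_affine {d : ℕ} (M : Matrix (Fin d) (Fin d) ℤ) (u : Fin d → ℤ) (P : Set (Fin d → ℝ)) :
    volume ((fun x => (M.map (fun z : ℤ => (z : ℝ))).mulVec x + (fun i => (u i : ℝ))) '' P) =
      ENNReal.ofReal |(M.det : ℝ)| * volume P := by
  have h : ((fun x => (M.map (fun z : ℤ => (z : ℝ))).mulVec x + (fun i => (u i : ℝ))) '' P) =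
      (fun x => x + (fun i => (u i : ℝ))) '' (Matrix.toLin' (M.map (fun z : ℤ => (z : ℝ))) '' P) := by
    rw [image_image]; rfl
  rw [h, image_add_right, measure_preimage_add_right, Measure.addHaar_image_linearMap,
    LinearMap.det_toLin']
  congr 3
  exact (Int.cast_det M).symm

theorem forward_geom {d k : ℕ} (v : Fin (d+1) → Fin d → ℤ)
    (P : Fin d → ℤ) (i : Fin (d+1))
    (hP : ((d * k + 1 : ℕ):ℤ) • P = v i + ∑ j : Fin d, (k:ℤ) • v (i.succAbove j))
    (hvol : volume (convexHull ℝ (range (fun i => Brd.toR (v i)))) =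
      ((d * k + 1 : ℕ) : ℝ≥0∞) / (Nat.factorial d : ℝ≥0∞)) :
    UnimodEquiv d (convexHull ℝ (range (fun i => Brd.toR (v i)))) (Sdk d k) := by
  let W : Matrix (Fin d) (Fin d) ℤ := Matrix.of fun t j => v (i.succAbove j) t - P t
  let f : (Fin d → ℝ) → (Fin d → ℝ) :=
    fun x => (W.map (fun z : ℤ => (z : ℝ))).mulVec x + (fun i => (P i : ℝ))
  have hsucc : ∀ j : Fin d, f (sdkV d k j.succ) = Brd.toR (v (i.succAbove j)) := by
    intro j
    ext t
    simp [f, sdkV, W, Brd.toR]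
  have hzero : f (sdkV d k 0) = Brd.toR (v i) := by
    ext t
    have h := congrFun hP t
    simp only [Pi.add_apply, Pi.smul_apply, Finset.sum_apply, smul_eq_mul] at h
    have h' : ((d:ℝ) * k + 1) * P t = v i t + ∑ j : Fin d, (k:ℝ) * v (i.succAbove j) t := by
      exact_mod_cast h
    simp only [f, sdkV, W, Brd.toR, Matrix.mulVec, dotProduct, Fin.cons_zero, Pi.add_apply,
      Matrix.map_apply, Matrix.of_apply]
    push_cast
    rw [← Finset.sum_mul, Finset.sum_sub_distrib]
    rw [← Finset.mul_sum] at h'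
    simp only [Finset.sum_const, Finset.card_univ, Fintype.card_fin, nsmul_eq_mul]
    linear_combination h'
  have hrange : f '' (range (sdkV d k)) = range (fun i => Brd.toR (v i)) := by
    ext x
    constructor
    · rintro ⟨_, ⟨j, rfl⟩, rfl⟩
      refine Fin.cases ?_ (fun j => ?_) j
      · exact ⟨i, hzero.symm⟩
      · exact ⟨i.succAbove j, (hsucc j).symm⟩
    · rintro ⟨j, rfl⟩
      rcases Fin.eq_self_or_eq_succAbove i j with rfl | ⟨t, rfl⟩
      · exact ⟨_, ⟨0, rfl⟩, hzero⟩
      · exact ⟨_, ⟨t.succ, rfl⟩, hsucc t⟩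
  have hT : f '' (Sdk d k) = convexHull ℝ (range (fun i => Brd.toR (v i))) := by
    rw [← hrange, Sdk, sdk_hull]
    let F : (Fin d → ℝ) →ᵃ[ℝ] (Fin d → ℝ) :=
      (Matrix.toLin' (W.map (fun z : ℤ => (z : ℝ)))).toAffineMap + AffineMap.const ℝ _ (fun i => (P i : ℝ))
    have hF : f = F := by ext x; simp [F, f]
    rw [hF]
    exact F.image_convexHull _
  have hv := vol_affine W P (Sdk d k)
  change volume (f '' Sdk d k) = _ at hv
  rw [hT, hvol, Sdk, sdk_hull, sdk_vol] at hv
  have hW1 : ENNReal.ofReal |(W.det : ℝ)| = 1 := by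
    have h1 : (1:ℝ≥0∞) * (((d * k + 1 : ℕ) : ℝ≥0∞) / (Nat.factorial d : ℝ≥0∞)) =
      ENNReal.ofReal |(W.det : ℝ)| * (((d * k + 1 : ℕ) : ℝ≥0∞) / (Nat.factorial d : ℝ≥0∞)) := by
      rw [one_mul]; exact hv
    exact ((ENNReal.mul_left_inj (vol_ne_zero d k) (vol_ne_top d k)).1 h1).symm
  have hW2 : |W.det| = 1 := by
    have h1 : |(W.det : ℝ)| = 1 := ENNReal.ofReal_eq_one.1 hW1
    exact_mod_cast h1
  have hW3 : W.det * W.det = 1 := by rw [← abs_mul_abs_self, hW2, one_mul]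
  let M : Matrix (Fin d) (Fin d) ℤ := W.det • W.adjugate
  have hMW : M * W = 1 := by
    simp only [M]
    rw [Matrix.smul_mul, Matrix.adjugate_mul, smul_smul, hW3, one_smul]
  have hMdet : M.det = 1 ∨ M.det = -1 := by
    have h := congrArg Matrix.det hMW
    rw [Matrix.det_mul, Matrix.det_one] at h
    exact Int.isUnit_iff.1 (IsUnit.of_mul_eq_one _ h)
  refine ⟨M, -(M.mulVec P), hMdet, ?_⟩
  rw [← hT, image_image]
  have hid : ∀ x : Fin d → ℝ, (M.map (fun z : ℤ => (z : ℝ))).mulVec (f x) +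
      (fun i => (((-(M.mulVec P)) i : ℤ) : ℝ)) = x := by
    intro x
    have h1 : (M.map (fun z : ℤ => (z : ℝ))) * (W.map (fun z : ℤ => (z : ℝ))) = 1 := by
      have := congrArg (fun X : Matrix (Fin d) (Fin d) ℤ => X.map (Int.castRingHom ℝ)) hMW
      simp only [Matrix.map_mul] at this
      rw [Matrix.map_one _ (map_zero _) (map_one _)] at this
      exact this
    simp only [f]
    rw [Matrix.mulVec_add, Matrix.mulVec_mulVec, h1, Matrix.one_mulVec]
    ext t
    simp [Matrix.mulVec, dotProduct]
  simp only [hid, image_id']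

/-- For `d ≥ 3`, `k ≥ 1` and a clean lattice `d`-simplex with exactly `k`
interior lattice points, `Vol(T) = (dk+1)/d!` iff `T` is unimodularly equivalent to
`S_d(k)`. -/
theorem minimal_volume_iff_equiv_Sdk (d k : ℕ) (hd : 3 ≤ d) (hk : 1 ≤ k)
    (T : Set (Fin d → ℝ)) (hT : IsLatticeSimplex d T) (hclean : IsClean d T)
    (hint : {x ∈ interior T | IsLatticePt d x}.ncard = k) :
    volume T = ((d * k + 1 : ℕ) : ℝ≥0∞) / (Nat.factorial d : ℝ≥0∞) ↔
      UnimodEquiv d T (Sdk d k) := by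
  constructor
  · intro hvol
    obtain ⟨v, hind, rfl⟩ := hT
    have hdet : |(edgeMat v).det| = ((d * k + 1 : ℕ) : ℤ) := by
      have h1 := volume_hull (fun i => Brd.toR (v i))
      have h2 : edgeMat (fun i => Brd.toR (v i)) = (edgeMat v).map (fun z : ℤ => (z : ℝ)) := by
        ext a b; simp [edgeMat, Brd.toR]
      have h3 : ((edgeMat v).map (fun z : ℤ => (z : ℝ))).det = ((edgeMat v).det : ℝ) :=
        (Int.cast_det _).symm
      rw [h2, h3] at h1
      have h4 : ENNReal.ofReal (|((edgeMat v).det : ℝ)| / (Nat.factorial d : ℝ)) =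
          ENNReal.ofReal (((d * k + 1 : ℕ) : ℝ) / (Nat.factorial d : ℝ)) := by
        rw [← h1, ENNReal.ofReal_div_of_pos (by positivity), ENNReal.ofReal_natCast,
          ENNReal.ofReal_natCast]
        exact hvol
      rw [ENNReal.ofReal_eq_ofReal_iff (by positivity) (by positivity)] at h4
      have hf : (Nat.factorial d : ℝ) ≠ 0 := by positivity
      rw [div_left_inj' hf] at h4
      exact_mod_cast h4
    have hpos : 0 < |(edgeMat v).det| := by rw [hdet]; positivity
    obtain ⟨P, i, hP⟩ := Brd.exists_center (n := d * k + 1) v ((edgeMat v).det.sign) rfl hd hk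
      (by rw [Int.natAbs_sign_of_ne_zero (abs_pos.1 hpos)])
      (by rw [← hdet, Int.sign_mul_self_eq_abs]) hind hclean hint
    exact forward_geom v P i hP hvol
  · rintro ⟨M, u, hM, h⟩
    have hv := vol_affine M u T
    rw [h, Sdk, sdk_hull, sdk_vol] at hv
    rw [hv]
    rcases hM with hM | hM <;> simp [hM]
end
end
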